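/- Fix δ > 0. There exists a constant c > 0 such that for all A ≥ A₀(δ, n) with 2A+1 a power of 3 and all N > N₀(n) the following holds: if Q ⊂ ℝⁿ is a cube, u is harmonic on a sufficiently large neighborhood of Q, and the maximal doubling index satisfies N(Q) ≤ (1+c)N, then upon partitioning Q into (2A+1)ⁿ congruent subcubes, the number of subcubes with maximal doubling index greater than N is less than (1/2)·(2A+1)^{n-2+δ}. -/

import Mathlib

open MeasureTheory Metric Set ENNReal Matrix RealInnerProductSpace

/-- `sup` of `|∇u|` over a set. -/
noncomputable def supGrad {n : ℕ} (u : EuclideanSpace ℝ (Fin n) → ℝ)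
    (s : Set (EuclideanSpace ℝ (Fin n))) : ℝ :=
  sSup ((fun x => ‖fderiv ℝ u x‖) '' s)

/-- `u` is harmonic on `U`: smooth on `U` and its Laplacian vanishes on `U`. -/
def IsHarmonicOn {n : ℕ} (u : EuclideanSpace ℝ (Fin n) → ℝ)
    (U : Set (EuclideanSpace ℝ (Fin n))) : Prop :=
  ContDiffOn ℝ (⊤ : ℕ∞) u U ∧
    ∀ x ∈ U, ∑ i : Fin n,
      fderiv ℝ (fun y => fderiv ℝ u y (EuclideanSpace.single i 1)) x (EuclideanSpace.single i 1) = 0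

/-- normalized doubling index of the gradient on `B(x,r)`:
`N(x,r) = log ( sup_{B(x,2r)} |∇u| / sup_{B(x,r)} |∇u| )`. -/
noncomputable def doublingIndex {n : ℕ} (u : EuclideanSpace ℝ (Fin n) → ℝ)
    (x : EuclideanSpace ℝ (Fin n)) (r : ℝ) : ℝ :=
  Real.log (supGrad u (ball x (2 * r)) / supGrad u (ball x r))

/-- the closed axis-parallel cube with center `c` and side length `ℓ` -/
def cube {n : ℕ} (c : EuclideanSpace ℝ (Fin n)) (ℓ : ℝ) : Set (EuclideanSpace ℝ (Fin n)) :=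
  {x | ∀ i, |x i - c i| ≤ ℓ / 2}

/-- maximal normalized doubling index of the cube of center `c` and side `ℓ`:
`N(Q) = sup_{x ∈ Q, 0 < r ≤ ℓ(Q)} log ( sup_{B(x,10nr)} |∇u| / sup_{B(x,r)} |∇u| )`. -/
noncomputable def cubeDoublingIndex {n : ℕ} (u : EuclideanSpace ℝ (Fin n) → ℝ)
    (c : EuclideanSpace ℝ (Fin n)) (ℓ : ℝ) : ℝ :=
  sSup {t | ∃ x ∈ cube c ℓ, ∃ r : ℝ, 0 < r ∧ r ≤ ℓ ∧
    t = Real.log (supGrad u (ball x (10 * n * r)) / supGrad u (ball x r))}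

/-- `s`-dimensional Hausdorff content -/
noncomputable def hausdorffContent {n : ℕ} (s : ℝ) (E : Set (EuclideanSpace ℝ (Fin n))) : ℝ≥0∞ :=
  ⨅ (U : ℕ → Set (EuclideanSpace ℝ (Fin n))) (_ : E ⊆ ⋃ i, U i), ∑' i, EMetric.diam (U i) ^ s

/-- Riesz `s`-energy of a measure: `I_s(μ) = ∬ |x-y|^{-s} dμ(x) dμ(y)`. -/
noncomputable def rieszEnergy {n : ℕ} (s : ℝ) (μ : Measure (EuclideanSpace ℝ (Fin n))) : ℝ≥0∞ :=
  ∫⁻ x, ∫⁻ y, edist x y ^ (-s) ∂μ ∂μ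

/-- Riesz `s`-capacity of a set: the sup of `I_s(μ)⁻¹` over probability measures compactly
supported in `E`. -/
noncomputable def rieszCapacity {n : ℕ} (s : ℝ) (E : Set (EuclideanSpace ℝ (Fin n))) : ℝ≥0∞ :=
  ⨆ (μ : Measure (EuclideanSpace ℝ (Fin n)))
    (_ : μ E = 1 ∧ ∃ K, IsCompact K ∧ K ⊆ E ∧ μ Kᶜ = 0), (rieszEnergy s μ)⁻¹

/-- a function `Fin n → ℝ` regarded as a point of `EuclideanSpace ℝ (Fin n)` -/
noncomputable def vec {n : ℕ} (f : Fin n → ℝ) : EuclideanSpace ℝ (Fin n) :=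
  (EuclideanSpace.equiv (Fin n) ℝ).symm f

/-- center of the subcube indexed by `k` when the cube of center `c` and side `ℓ` is divided
into `M^n` congruent subcubes -/
noncomputable def subCenter {n : ℕ} (c : EuclideanSpace ℝ (Fin n)) (ℓ : ℝ) (M : ℕ)
    (k : Fin n → Fin M) : EuclideanSpace ℝ (Fin n) :=
  vec (fun i => c i + (((k i : ℝ) + 1 / 2) / M - 1 / 2) * ℓ)

/-- the last coordinate index of `Fin n` -/
def lastIdx (n : ℕ) (hn : 0 < n) : Fin n := ⟨n - 1, Nat.sub_lt hn Nat.one_pos⟩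

/-- the hyperplane `{xₙ = 0}` -/
def lastHyperplane (n : ℕ) (hn : 0 < n) : Set (EuclideanSpace ℝ (Fin n)) :=
  {x | x (lastIdx n hn) = 0}

namespace CW

abbrev EE (n : ℕ) := EuclideanSpace ℝ (Fin n)

variable {n : ℕ}

/-- coordinate vector -/
noncomputable def ev (i : Fin n) : EE n := EuclideanSpace.single i 1

/-- directional derivative -/
noncomputable def D (e : EE n) (f : EE n → ℝ) : EE n → ℝ := fun x => fderiv ℝ f x e

noncomputable def lap (f : EE n → ℝ) (x : EE n) : ℝ := ∑ i, D (ev i) (D (ev i) f) x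

abbrev Sm (f : EE n → ℝ) : Prop := ContDiff ℝ (⊤ : ℕ∞) f

lemma Sm.diff {f : EE n → ℝ} (hf : Sm f) : Differentiable ℝ f := hf.differentiable (by simp)

lemma Sm.D {f : EE n → ℝ} (hf : Sm f) (e : EE n) : Sm (D e f) := by
  have h : ContDiff ℝ (⊤ : ℕ∞) (fderiv ℝ f) := hf.fderiv_right (by simp)
  exact h.clm_apply contDiff_const

lemma D_comm {f : EE n → ℝ} (hf : Sm f) (v w : EE n) : D v (D w f) = D w (D v f) := by
  funext x
  have h : ContDiff ℝ (⊤ : ℕ∞) (fderiv ℝ f) := hf.fderiv_right (by simp)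
  have hd : Differentiable ℝ (fderiv ℝ f) := h.differentiable (by simp)
  have hs : IsSymmSndFDerivAt ℝ f x := by
    apply ContDiffAt.isSymmSndFDerivAt (n := (⊤ : ℕ∞)) hf.contDiffAt
    simp only [minSmoothness_of_isRCLikeNormedField]
    exact WithTop.coe_le_coe.2 (le_top : (2:ℕ∞) ≤ ⊤)
  have h1 : ∀ a b : EE n, D a (D b f) x = fderiv ℝ (fderiv ℝ f) x a b := by
    intro a b
    unfold D
    rw [fderiv_clm_apply (hd x) (differentiableAt_const b)]
    simp
  rw [h1, h1]
  exact hs v w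

lemma D_zero_of_open {f : EE n → ℝ} {U : Set (EE n)} (hU : IsOpen U) (h : ∀ x ∈ U, f x = 0)
    (e : EE n) : ∀ x ∈ U, D e f x = 0 := by
  intro x hx
  have : f =ᶠ[nhds x] fun _ => 0 := by
    filter_upwards [hU.mem_nhds hx] with y hy using h y hy
  unfold D
  rw [this.fderiv_eq]; simp

lemma D_sum {ι : Type*} (s : Finset ι) (f : ι → EE n → ℝ) (hf : ∀ i ∈ s, Sm (f i)) (e : EE n) :
    D e (fun x => ∑ i ∈ s, f i x) = fun x => ∑ i ∈ s, D e (f i) x := by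
  funext x
  unfold D
  rw [fderiv_fun_sum (fun i hi => (hf i hi).diff x)]
  simp

lemma lap_D {f : EE n → ℝ} (hf : Sm f) {U : Set (EE n)} (hU : IsOpen U)
    (h : ∀ x ∈ U, lap f x = 0) (e : EE n) : ∀ x ∈ U, lap (D e f) x = 0 := by
  intro x hx
  have h1 : D e (lap f) x = 0 := D_zero_of_open hU h e x hx
  have h2 : lap f = fun x => ∑ i, D (ev i) (D (ev i) f) x := rfl
  rw [h2, D_sum _ _ (fun i _ => (hf.D _).D _)] at h1
  unfold lap
  rw [← h1]
  apply Finset.sum_congr rfl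
  intro i _
  rw [D_comm hf (ev i) e, D_comm (hf.D _) (ev i) e]

lemma lap_trans (f : EE n → ℝ) (p x : EE n) : lap (fun y => f (p + y)) x = lap f (p + x) := by
  have : ∀ (g : EE n → ℝ) (e : EE n), D e (fun y => g (p + y)) = fun y => D e g (p + y) := by
    intro g e; funext y; unfold D; rw [fderiv_comp_add_left]
  unfold lap
  simp_rw [this]

lemma D_smul (f : EE n → ℝ) (hf : Sm f) (s : ℝ) (e : EE n) :
    D e (fun y => f (s • y)) = fun y => s * D e f (s • y) := by
  funext y; unfold D
  have : HasFDerivAt (fun y => f (s • y)) ((fderiv ℝ f (s • y)).comp (s • ContinuousLinearMap.id ℝ (EE n))) y := by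
    apply HasFDerivAt.comp y (hf.diff _).hasFDerivAt
    exact (hasFDerivAt_id y).const_smul s
  rw [this.fderiv]; simp

lemma Sm.comp_smul {f : EE n → ℝ} (hf : Sm f) (s : ℝ) : Sm (fun y => f (s • y)) :=
  hf.comp (contDiff_const_smul s)

lemma Sm.trans {f : EE n → ℝ} (hf : Sm f) (p : EE n) : Sm (fun y => f (p + y)) :=
  hf.comp (contDiff_const.add contDiff_id)

lemma lap_smul (f : EE n → ℝ) (hf : Sm f) (s : ℝ) (x : EE n) :
    lap (fun y => f (s • y)) x = s ^ 2 * lap f (s • x) := by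
  unfold lap
  rw [Finset.mul_sum]
  apply Finset.sum_congr rfl
  intro i _
  rw [D_smul f hf]
  have h := D_smul (D (ev i) f) (hf.D _) s (ev i)
  have : D (ev i) (fun y => s * D (ev i) f (s • y)) = fun y => s * D (ev i) (fun y => D (ev i) f (s • y)) y := by
    funext y; unfold D
    rw [fderiv_const_mul]
    · simp
    · exact ((hf.D (ev i)).comp_smul s).diff y
  rw [this, h]; ring

/-- weight -/
noncomputable def ph (y : EE n) : ℝ := max (1 - ‖y‖ ^ 2) 0

lemma ph_nonneg (y : EE n) : 0 ≤ ph y := le_max_right _ _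
lemma ph_le (y : EE n) : ph y ≤ 1 := by
  unfold ph; apply max_le <;> nlinarith [sq_nonneg ‖y‖]
lemma ph_cont : Continuous (ph : EE n → ℝ) := by unfold ph; fun_prop
lemma ph_zero {y : EE n} (h : 1 ≤ ‖y‖) : ph y = 0 := by
  unfold ph; apply max_eq_right; nlinarith
lemma ph_pos {y : EE n} (h : ‖y‖ < 1) : 0 < ph y := by
  unfold ph; apply lt_max_of_lt_left; nlinarith [norm_nonneg y]
lemma norm_lt_of_ph {y : EE n} (h : ph y ≠ 0) : ‖y‖ < 1 := by
  by_contra h'; exact h (ph_zero (not_lt.1 h'))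

lemma hasDerivAt_maxpow (k : ℕ) (s : ℝ) :
    HasDerivAt (fun s : ℝ => (max s 0) ^ (k + 2)) ((k + 2) * (max s 0) ^ (k + 1)) s := by
  rcases lt_trichotomy s 0 with h | h | h
  · have : (fun s : ℝ => (max s 0) ^ (k + 2)) =ᶠ[nhds s] fun _ => 0 := by
      filter_upwards [Iio_mem_nhds h] with x hx
      rw [max_eq_right (le_of_lt hx)]; simp
    rw [max_eq_right h.le]
    simpa using (hasDerivAt_const s (0:ℝ)).congr_of_eventuallyEq this
  · subst h
    simp only [max_self]
    rw [hasDerivAt_iff_isLittleO_nhds_zero]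
    simp only [zero_add, max_self, ne_eq, Nat.succ_ne_zero, not_false_eq_true, zero_pow, sub_zero, mul_zero, smul_zero]
    rw [Asymptotics.isLittleO_iff]
    intro c hc
    have : ∀ᶠ x : ℝ in nhds 0, |x| < min c 1 := by
      have := (continuous_abs.tendsto (0:ℝ))
      simp only [abs_zero] at this
      exact this.eventually (Iio_mem_nhds (by positivity))
    filter_upwards [this] with x hx
    have hm : max x 0 ≤ |x| := max_le (le_abs_self x) (abs_nonneg x)
    have hm0 : 0 ≤ max x 0 := le_max_right _ _
    rw [Real.norm_eq_abs, abs_of_nonneg (by positivity), Real.norm_eq_abs, pow_succ]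
    have h1 : (max x 0) ^ (k+1) ≤ c := by
      rw [pow_succ]
      have hk : (max x 0)^k ≤ 1 := pow_le_one₀ hm0 (hm.trans (hx.le.trans (min_le_right _ _)))
      have : max x 0 ≤ c := hm.trans (hx.le.trans (min_le_left _ _))
      nlinarith [pow_nonneg hm0 k]
    exact mul_le_mul h1 hm hm0 hc.le
  · have : (fun s : ℝ => (max s 0) ^ (k + 2)) =ᶠ[nhds s] fun s => s ^ (k+2) := by
      filter_upwards [Ioi_mem_nhds h] with x hx
      rw [max_eq_left (le_of_lt hx)]
    rw [max_eq_left h.le]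
    have h2 := (hasDerivAt_pow (k+2) s).congr_of_eventuallyEq this
    refine h2.congr_deriv ?_
    push_cast; rfl

lemma hasFDerivAt_ph (k : ℕ) (y : EE n) :
    HasFDerivAt (fun y : EE n => ph y ^ (k+2)) ((-(2 * (k+2) * ph y ^ (k+1))) • innerSL ℝ y) y := by
  have h1 : HasFDerivAt (fun y : EE n => 1 - ‖y‖^2) (-(2 • innerSL ℝ y)) y := by
    have := (hasStrictFDerivAt_norm_sq y).hasFDerivAt
    simpa using this.const_sub 1
  have := (hasDerivAt_maxpow k (1 - ‖y‖^2)).comp_hasFDerivAt y h1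
  refine HasFDerivAt.congr_fderiv this ?_
  ext v
  simp [ph]; ring

lemma D_ph (k : ℕ) (y : EE n) (i : Fin n) :
    fderiv ℝ (fun y : EE n => ph y ^ (k+2)) y (ev i) = -(2 * (k+2) * ph y ^ (k+1)) * y i := by
  rw [(hasFDerivAt_ph k y).fderiv]
  simp only [_root_.smul_apply, smul_eq_mul, innerSL_apply_apply, ev]
  rw [EuclideanSpace.inner_single_right]; simp

lemma ph_compact : HasCompactSupport (ph : EE n → ℝ) := by
  apply HasCompactSupport.of_support_subset_isCompact (isCompact_closedBall (0 : EE n) 1)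
  intro y hy
  rw [mem_closedBall_zero_iff]
  exact (norm_lt_of_ph hy).le

lemma ph_pow_compact (k : ℕ) : HasCompactSupport (fun y : EE n => ph y ^ (k+1)) := by
  apply ph_compact.mono
  intro y hy h; apply hy; simp [h]

lemma integ_ph (k : ℕ) {g : EE n → ℝ} (hg : Continuous g) :
    Integrable (fun y => g y * ph y ^ (k+1)) := by
  apply Continuous.integrable_of_hasCompactSupport
  · exact hg.mul (ph_cont.pow _)
  · exact (ph_pow_compact k).mul_left

/-- integration by parts -/
lemma ibp (k : ℕ) {g : EE n → ℝ} (hg : ContDiff ℝ 1 g) (i : Fin n) :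
    ∫ y, fderiv ℝ g y (ev i) * ph y ^ (k+2) = (2 * (k+2)) * ∫ y, g y * y i * ph y ^ (k+1) := by
  have hgd : Differentiable ℝ g := hg.differentiable (by simp)
  have hgc : Continuous fun y => fderiv ℝ g y (ev i) := (hg.continuous_fderiv (by simp)).clm_apply continuous_const
  have hyi : Continuous fun y : EE n => y i := by fun_prop
  have h := integral_mul_fderiv_eq_neg_fderiv_mul_of_integrable (𝕜 := ℝ) (μ := (volume : Measure (EE n)))
    (f := fun y : EE n => ph y ^ (k+2)) (g := g) (v := ev i) ?_ ?_ ?_ ?_ ?_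
  · rw [← integral_const_mul]
    calc ∫ y, fderiv ℝ g y (ev i) * ph y ^ (k+2) = ∫ y, ph y ^ (k+2) * fderiv ℝ g y (ev i) := by
          simp_rw [mul_comm]
      _ = _ := h
      _ = _ := by
        rw [← integral_neg]
        congr 1; funext y
        rw [D_ph]; ring
  · have : (fun x : EE n => fderiv ℝ (fun y : EE n => ph y ^ (k+2)) x (ev i) * g x) = fun x => (-(2 * (k+2)) * x i * g x) * ph x ^ (k+1) := by
      funext x; rw [D_ph]; ring
    rw [this]
    exact integ_ph k (by fun_prop)
  · simpa only [mul_comm] using integ_ph (k+1) hgc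
  · simpa only [mul_comm] using integ_ph (k+1) hg.continuous
  · exact fun x _ => (hasFDerivAt_ph k x).differentiableAt
  · exact fun x _ => hgd x

end CW

namespace CW
variable {n : ℕ}

lemma hasDerivAt_param (k : ℕ) (h h' : ℝ → EE n → ℝ) (hc : ∀ t, Continuous (h t))
    (hc' : Continuous (fun q : ℝ × EE n => h' q.1 q.2))
    (hd : ∀ t y, HasDerivAt (fun t => h t y) (h' t y) t) (t₀ : ℝ) :
    HasDerivAt (fun t => ∫ y, h t y * ph y ^ (k+1)) (∫ y, h' t₀ y * ph y ^ (k+1)) t₀ := by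
  have hK : IsCompact (Icc (t₀ - 1) (t₀ + 1) ×ˢ closedBall (0 : EE n) 1) :=
    isCompact_Icc.prod (isCompact_closedBall _ _)
  obtain ⟨C, hC⟩ := hK.exists_bound_of_continuousOn hc'.continuousOn
  have := hasDerivAt_integral_of_dominated_loc_of_deriv_le (μ := (volume : Measure (EE n)))
    (F := fun t y => h t y * ph y ^ (k+1)) (F' := fun t y => h' t y * ph y ^ (k+1)) (x₀ := t₀)
    (s := Icc (t₀-1) (t₀+1)) (bound := fun y => C * ph y ^ (k+1))
    (Icc_mem_nhds (by linarith) (by linarith)) ?_ ?_ ?_ ?_ ?_ ?_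
  · exact this.2
  · refine Filter.Eventually.of_forall fun t => ?_
    exact (integ_ph k (hc t)).aestronglyMeasurable
  · exact integ_ph k (hc t₀)
  · exact (integ_ph k (hc'.comp (continuous_const.prodMk continuous_id))).aestronglyMeasurable
  · refine Filter.Eventually.of_forall fun y t ht => ?_
    rw [norm_mul, Real.norm_of_nonneg (pow_nonneg (ph_nonneg y) _)]
    by_cases hy : ph y = 0
    · simp [hy]
    · apply mul_le_mul_of_nonneg_right _ (pow_nonneg (ph_nonneg y) _)
      exact hC (t, y) ⟨ht, mem_closedBall_zero_iff.2 (norm_lt_of_ph hy).le⟩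
  · exact integ_ph k continuous_const
  · refine Filter.Eventually.of_forall fun y t _ => ?_
    exact (hd t y).mul_const _

noncomputable def G (f g : EE n → ℝ) (a b : ℝ) : ℝ := ∫ y, (f (a • y) * g (b • y)) * ph y ^ 2

lemma fderiv_eq_sum (f : EE n → ℝ) (x y : EE n) :
    fderiv ℝ f x y = ∑ i, y i * D (ev i) f x := by
  have : y = ∑ i, y i • ev i := by
    ext j
    simp [ev, Finset.sum_apply, Pi.single_apply]
  conv_lhs => rw [this]
  simp [D]

lemma Sm.cont {f : EE n → ℝ} (hf : Sm f) : Continuous f := hf.continuous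

lemma Sm.mul {f g : EE n → ℝ} (hf : Sm f) (hg : Sm g) : Sm (fun x => f x * g x) := ContDiff.mul hf hg

lemma D_mul {f g : EE n → ℝ} (hf : Sm f) (hg : Sm g) (e : EE n) :
    D e (fun x => f x * g x) = fun x => f x * D e g x + g x * D e f x := by
  funext x; unfold D
  rw [fderiv_fun_mul (hf.diff x) (hg.diff x)]
  simp

lemma D_sub {f g : EE n → ℝ} (hf : Sm f) (hg : Sm g) (e : EE n) :
    D e (fun x => f x - g x) = fun x => D e f x - D e g x := by
  funext x; unfold D
  rw [fderiv_fun_sub (hf.diff x) (hg.diff x)]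
  simp

lemma D_const_mul {f : EE n → ℝ} (hf : Sm f) (s : ℝ) (e : EE n) :
    D e (fun x => s * f x) = fun x => s * D e f x := by
  funext x; unfold D
  rw [fderiv_const_mul (hf.diff x)]
  simp

lemma Sm.lap {f : EE n → ℝ} (hf : Sm f) : Sm (lap f) := by
  have h2 : CW.lap f = fun x => ∑ i, CW.D (ev i) (CW.D (ev i) f) x := rfl
  rw [h2]
  exact ContDiff.sum fun i _ => (hf.D _).D _

lemma div_id {f g : EE n → ℝ} (hf : Sm f) (hg : Sm g) (a b : ℝ) (i : Fin n) (y : EE n) :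
    D (ev i) (fun y => g (b • y) * (a * D (ev i) f (a • y)) - f (a • y) * (b * D (ev i) g (b • y))) y
     = g (b • y) * (a^2 * D (ev i) (D (ev i) f) (a • y)) - f (a • y) * (b^2 * D (ev i) (D (ev i) g) (b • y)) := by
  have h1 := (hf.D (ev i)).comp_smul a
  have h2 := (hg.D (ev i)).comp_smul b
  have h3 : Sm (fun y => a * D (ev i) f (a • y)) := contDiff_const.mul h1
  have h4 : Sm (fun y => b * D (ev i) g (b • y)) := contDiff_const.mul h2
  rw [D_sub ((hg.comp_smul b).mul h3) ((hf.comp_smul a).mul h4), D_mul (hg.comp_smul b) h3,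
    D_mul (hf.comp_smul a) h4, D_const_mul h1, D_const_mul h2, D_smul f hf, D_smul g hg, D_smul _ (hf.D _), D_smul _ (hg.D _)]
  ring

lemma G_deriv {f g : EE n → ℝ} (hf : Sm f) (hg : Sm g) (a b : ℝ) (t : ℝ) :
    HasDerivAt (fun t => G f g (a * Real.exp t) (b * Real.exp (-t)))
      (1/6 * ∫ y, (g ((b * Real.exp (-t)) • y) * ((a * Real.exp t)^2 * lap f ((a * Real.exp t) • y))
        - f ((a * Real.exp t) • y) * ((b * Real.exp (-t))^2 * lap g ((b * Real.exp (-t)) • y))) * ph y ^ 3) t := by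
  set V : Fin n → ℝ → EE n → ℝ := fun i t y => g ((b * Real.exp (-t)) • y) * ((a * Real.exp t) * D (ev i) f ((a * Real.exp t) • y))
     - f ((a * Real.exp t) • y) * ((b * Real.exp (-t)) * D (ev i) g ((b * Real.exp (-t)) • y)) with hV
  have hfc := hf.cont
  have hgc := hg.cont
  have hDf := fun i => (hf.D (ev i)).cont
  have hDg := fun i => (hg.D (ev i)).cont
  have hLf := hf.lap.cont
  have hLg := hg.lap.cont
  have key := hasDerivAt_param 1 (fun t y => f ((a * Real.exp t) • y) * g ((b * Real.exp (-t)) • y))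
    (fun t y => ∑ i, V i t y * y i) (fun t => by fun_prop) ?_ ?_ t
  · refine key.congr_deriv ?_
    have e1 : ∀ i, ∫ y, D (ev i) (V i t) y * ph y ^ 3 = 6 * ∫ y, V i t y * y i * ph y ^ 2 := by
      intro i
      have hVs : Sm (V i t) := by
        apply ContDiff.sub
        · exact (hg.comp_smul _).mul (contDiff_const.mul ((hf.D _).comp_smul _))
        · exact (hf.comp_smul _).mul (contDiff_const.mul ((hg.D _).comp_smul _))
      have := ibp 1 (hVs.of_le (by exact_mod_cast le_top)) i
      norm_num at this
      exact this
    have hVc : ∀ i, Continuous (fun y => V i t y * y i) := by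
      intro i; simp only [hV]; have := hDf i; have := hDg i; fun_prop
    have e2 : ∫ y, (∑ i, V i t y * y i) * ph y ^ (1+1) = ∑ i, ∫ y, V i t y * y i * ph y ^ 2 := by
      rw [← integral_finsetSum]
      · congr 1; funext y; rw [Finset.sum_mul]
      · intro i _; exact integ_ph 1 (hVc i)
    have hDD : ∀ i, Continuous (fun y => D (ev i) (V i t) y) := by
      intro i
      have h1 := ((hf.D (ev i)).D (ev i)).cont
      have h2 := ((hg.D (ev i)).D (ev i)).cont
      simp only [hV, div_id hf hg]; fun_prop
    rw [e2]
    have e3 : ∀ y, (g ((b * Real.exp (-t)) • y) * ((a * Real.exp t)^2 * lap f ((a * Real.exp t) • y))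
        - f ((a * Real.exp t) • y) * ((b * Real.exp (-t))^2 * lap g ((b * Real.exp (-t)) • y))) = ∑ i, D (ev i) (V i t) y := by
      intro y
      simp only [hV, div_id hf hg]
      rw [Finset.sum_sub_distrib]
      simp only [lap, Finset.mul_sum]
    simp_rw [e3, Finset.sum_mul]
    rw [integral_finsetSum]
    · rw [Finset.mul_sum]
      apply Finset.sum_congr rfl
      intro i _
      rw [e1 i]; ring
    · intro i _; exact integ_ph 2 (hDD i)
  · have : ∀ i, Continuous (fun q : ℝ × EE n => V i q.1 q.2 * q.2 i) := by
      intro i; simp only [hV]; have := hDf i; have := hDg i; fun_prop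
    fun_prop
  · intro t y
    have h1 : HasDerivAt (fun t => (a * Real.exp t) • y) ((a * Real.exp t) • y) t :=
      ((Real.hasDerivAt_exp t).const_mul a).smul_const y
    have h2 : HasDerivAt (fun t => (b * Real.exp (-t)) • y) ((-(b * Real.exp (-t))) • y) t := by
      have : HasDerivAt (fun t => b * Real.exp (-t)) (-(b * Real.exp (-t))) t := by
        have := ((Real.hasDerivAt_exp (-t)).comp t (hasDerivAt_neg t)).const_mul b
        refine this.congr_deriv ?_; ring
      exact this.smul_const y
    have h3 := (hf.diff _).hasFDerivAt.comp_hasDerivAt t h1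
    have h4 := (hg.diff _).hasFDerivAt.comp_hasDerivAt t h2
    refine (h3.mul h4).congr_deriv ?_
    simp only [map_smul, fderiv_eq_sum, hV, Function.comp, smul_eq_mul, Finset.mul_sum, Finset.sum_mul]
    rw [← Finset.sum_add_distrib]
    apply Finset.sum_congr rfl
    intro i _; ring

/-- quantitative G lemma -/
lemma G_approx {f g : EE n → ℝ} (hf : Sm f) (hg : Sm g) {R Mf Mg ef eg : ℝ}
    (h1 : ∀ x ∈ ball (0 : EE n) R, |f x| ≤ Mf) (h2 : ∀ x ∈ ball (0 : EE n) R, |g x| ≤ Mg)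
    (h3 : ∀ x ∈ ball (0 : EE n) R, |lap f x| ≤ ef) (h4 : ∀ x ∈ ball (0 : EE n) R, |lap g x| ≤ eg)
    {a b t : ℝ} (ha : 0 < a) (hb : 0 < b) (ht : 0 ≤ t) (haR : a * Real.exp t ≤ R) (hbR : b ≤ R) :
    |G f g (a * Real.exp t) (b * Real.exp (-t)) - G f g a b| ≤
      t * (R ^ 2 * (Mg * ef + Mf * eg) * ∫ y : EE n, ph y ^ 3) := by
  have hR : 0 < R := hb.trans_le hbR
  have hMf : 0 ≤ Mf := (abs_nonneg _).trans (h1 0 (mem_ball_self hR))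
  have hMg : 0 ≤ Mg := (abs_nonneg _).trans (h2 0 (mem_ball_self hR))
  have hef : 0 ≤ ef := (abs_nonneg _).trans (h3 0 (mem_ball_self hR))
  have heg : 0 ≤ eg := (abs_nonneg _).trans (h4 0 (mem_ball_self hR))
  have := norm_image_sub_le_of_norm_deriv_le_segment' (a := 0) (b := t) (C := R ^ 2 * (Mg * ef + Mf * eg) * ∫ y : EE n, ph y ^ 3)
    (f := fun t => G f g (a * Real.exp t) (b * Real.exp (-t)))
    (fun s _ => (G_deriv hf hg a b s).hasDerivWithinAt) ?_ t ⟨ht, le_rfl⟩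
  · simp only [neg_zero, Real.exp_zero, mul_one, sub_zero] at this
    rw [mul_comm t]; exact this
  · intro s hs
    have hP : 0 ≤ ∫ y : EE n, ph y ^ 3 := integral_nonneg fun y => pow_nonneg (ph_nonneg y) _
    have hA : a * Real.exp s ≤ R := le_trans (by gcongr; exact hs.2.le) haR
    have hA0 : 0 < a * Real.exp s := by positivity
    have hB : b * Real.exp (-s) ≤ R := by
      have : Real.exp (-s) ≤ 1 := Real.exp_le_one_iff.2 (by linarith [hs.1])
      nlinarith
    have hB0 : 0 < b * Real.exp (-s) := by positivity
    have mem : ∀ c, 0 < c → c ≤ R → ∀ y : EE n, ph y ≠ 0 → c • y ∈ ball (0 : EE n) R := by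
      intro c hc hcR y hy
      rw [mem_ball_zero_iff, norm_smul, Real.norm_of_nonneg hc.le]
      nlinarith [norm_lt_of_ph hy]
    rw [norm_mul]
    have : ‖∫ y, (g ((b * Real.exp (-s)) • y) * ((a * Real.exp s)^2 * lap f ((a * Real.exp s) • y))
        - f ((a * Real.exp s) • y) * ((b * Real.exp (-s))^2 * lap g ((b * Real.exp (-s)) • y))) * ph y ^ 3‖ ≤
        ∫ y : EE n, (R ^ 2 * (Mg * ef + Mf * eg)) * ph y ^ 3 := by
      apply norm_integral_le_of_norm_le (integ_ph 2 continuous_const)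
      refine Filter.Eventually.of_forall fun y => ?_
      rw [norm_mul, Real.norm_of_nonneg (pow_nonneg (ph_nonneg y) 3)]
      by_cases hy : ph y = 0
      · simp [hy]
      apply mul_le_mul_of_nonneg_right _ (pow_nonneg (ph_nonneg y) _)
      have m1 := mem _ hA0 hA y hy
      have m2 := mem _ hB0 hB y hy
      have q1 : (a * Real.exp s)^2 ≤ R^2 := by gcongr
      have q2 : (b * Real.exp (-s))^2 ≤ R^2 := by gcongr
      calc _ ≤ ‖g ((b * Real.exp (-s)) • y) * ((a * Real.exp s)^2 * lap f ((a * Real.exp s) • y))‖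
            + ‖f ((a * Real.exp s) • y) * ((b * Real.exp (-s))^2 * lap g ((b * Real.exp (-s)) • y))‖ := norm_sub_le _ _
        _ ≤ Mg * (R^2 * ef) + Mf * (R^2 * eg) := by
          simp only [norm_mul, Real.norm_eq_abs, abs_pow]
          rw [abs_of_pos hA0, abs_of_pos hB0] at *
          gcongr
          · exact h2 _ m2
          · exact h3 _ m1
          · exact h1 _ m1
          · exact h4 _ m2
        _ = _ := by ring
    rw [integral_const_mul] at this
    have h6 : ‖(1/6:ℝ)‖ ≤ 1 := by norm_num
    calc _ ≤ 1 * (R ^ 2 * (Mg * ef + Mf * eg) * ∫ y : EE n, ph y ^ 3) := by gcongr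
      _ = _ := one_mul _

end CW

namespace CW
variable {n : ℕ}

lemma Sm.bdd {f : EE n → ℝ} (hf : Sm f) (p : EE n) (R : ℝ) : ∃ M, ∀ x ∈ ball p R, |f x| ≤ M := by
  obtain ⟨C, hC⟩ := (isCompact_closedBall p R).exists_bound_of_continuousOn hf.cont.continuousOn
  exact ⟨C, fun x hx => hC x (ball_subset_closedBall hx)⟩

lemma G_eq {f g : EE n → ℝ} (hf : Sm f) (hg : Sm g) {R : ℝ}
    (h3 : ∀ x ∈ ball (0 : EE n) R, lap f x = 0) (h4 : ∀ x ∈ ball (0 : EE n) R, lap g x = 0)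
    {a b a' b' : ℝ} (ha : 0 < a) (hb : 0 < b) (ha' : 0 < a') (hb' : 0 < b') (haR : a ≤ R) (hbR : b ≤ R)
    (haR' : a' ≤ R) (hbR' : b' ≤ R) (hab : a * b = a' * b') : G f g a b = G f g a' b' := by
  wlog h : a ≤ a' generalizing a b a' b'
  · exact (this ha' hb' ha hb haR' hbR' haR hbR hab.symm (le_of_not_ge h)).symm
  obtain ⟨Mf, h1⟩ := hf.bdd 0 R
  obtain ⟨Mg, h2⟩ := hg.bdd 0 R
  have e1 : a * Real.exp (Real.log (a'/a)) = a' := by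
    rw [Real.exp_log (by positivity)]; field_simp
  have e2 : b * Real.exp (-Real.log (a'/a)) = b' := by
    rw [Real.exp_neg, Real.exp_log (by positivity)]; field_simp; linarith
  have := G_approx hf hg (ef := 0) (eg := 0) h1 h2 (fun x hx => by simp [h3 x hx]) (fun x hx => by simp [h4 x hx])
    ha hb (t := Real.log (a'/a)) (Real.log_nonneg (by rw [le_div_iff₀ ha]; linarith)) (by rw [e1]; exact haR') hbR
  rw [e1, e2] at this
  simp at this
  have := abs_nonpos_iff.1 (le_of_eq (abs_eq_zero.2 this))
  linarith

lemma ball_trans {p x : EE n} {R : ℝ} (h : x ∈ ball (0 : EE n) R) : p + x ∈ ball p R := by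
  simpa [mem_ball, dist_eq_norm] using h

noncomputable def c0 (n : ℕ) : ℝ := ∫ y : EE n, ph y ^ 2

lemma ph_integ_pos (k : ℕ) : 0 < ∫ y : EE n, ph y ^ (k+1) := by
  have hi := integ_ph (n := n) k (g := fun _ => 1) continuous_const
  simp only [one_mul] at hi
  rw [integral_pos_iff_support_of_nonneg (fun y => pow_nonneg (ph_nonneg y) _) hi]
  have : ball (0 : EE n) 1 ⊆ Function.support fun y : EE n => ph y ^ (k+1) := by
    intro y hy
    rw [mem_ball_zero_iff] at hy
    exact (pow_pos (ph_pos hy) _).ne'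
  exact lt_of_lt_of_le (measure_ball_pos volume (0 : EE n) one_pos) (measure_mono this)

lemma c0_pos : 0 < c0 n := ph_integ_pos 1

lemma mvp {f : EE n → ℝ} (hf : Sm f) {p : EE n} {R : ℝ} (h : ∀ x ∈ ball p R, lap f x = 0)
    {a : ℝ} (ha : 0 < a) (haR : a ≤ R) : f p * c0 n = ∫ y, f (p + a • y) * ph y ^ 2 := by
  have hfp := hf.trans p
  have h1 : Sm (fun _ : EE n => (1:ℝ)) := contDiff_const
  have hl : ∀ x ∈ ball (0 : EE n) R, lap (fun y => f (p + y)) x = 0 := by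
    intro x hx; rw [lap_trans]; exact h _ (ball_trans hx)
  have hl1 : ∀ x ∈ ball (0 : EE n) R, lap (fun _ : EE n => (1:ℝ)) x = 0 := by
    intro x _
    have : ∀ (c : ℝ) (e : EE n), D e (fun _ : EE n => c) = fun _ => 0 := by
      intro c e; funext x; simp [D]
    simp [lap, this]
  have hG : ∀ c, 0 < c → c ≤ a → ∫ y, f (p + c • y) * ph y ^ 2 = ∫ y, f (p + a • y) * ph y ^ 2 := by
    intro c hc hca
    have := G_eq hfp h1 hl hl1 (a := c) (b := a) (a' := a) (b' := c) hc ha ha hc (hca.trans haR) haR haR (hca.trans haR) (mul_comm _ _)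
    simpa [G] using this
  have hd := hasDerivAt_param 1 (fun t y => f (p + t • y)) (fun t y => fderiv ℝ f (p + t • y) y)
    (fun t => by have := hf.cont; fun_prop) ?_ ?_ 0
  · have hc := hd.continuousAt.tendsto
    have hc2 := hc.mono_left (nhdsWithin_le_nhds (s := Ioi 0))
    have : (fun t : ℝ => ∫ y, f (p + t • y) * ph y ^ (1+1)) =ᶠ[nhdsWithin 0 (Ioi 0)] fun _ => ∫ y, f (p + a • y) * ph y ^ 2 := by
      filter_upwards [Ioc_mem_nhdsGT ha] with t ht
      exact hG t ht.1 ht.2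
    have h2 := tendsto_nhds_unique (hc2.congr' this) tendsto_const_nhds
    simp only [zero_smul, add_zero] at h2
    rw [← h2, integral_const_mul]; rfl
  · simp only [fderiv_eq_sum]
    have := fun i => (hf.D (ev i)).cont
    fun_prop
  · intro t y
    have h1 : HasDerivAt (fun t : ℝ => p + t • y) y t := by
      simpa using ((hasDerivAt_id t).smul_const y).const_add p
    exact (hf.diff _).hasFDerivAt.comp_hasDerivAt t h1

noncomputable def Cg (n : ℕ) : ℝ := 1 + n * (4 * (∫ y : EE n, ph y ^ 1) / c0 n)

lemma Cg_pos : 1 ≤ Cg n := by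
  have := (ph_integ_pos (n := n) 0).le
  have := (c0_pos (n := n)).le
  unfold Cg
  have : 0 ≤ n * (4 * (∫ y : EE n, ph y ^ 1) / c0 n) := by positivity
  linarith

lemma grad_i {f : EE n → ℝ} (hf : Sm f) {p : EE n} {R A : ℝ} (hR : 0 < R) (h : ∀ x ∈ ball p R, lap f x = 0)
    (hA : ∀ x ∈ ball p R, |f x| ≤ A) (i : Fin n) :
    |D (ev i) f p| ≤ (4 * (∫ y : EE n, ph y ^ 1) / c0 n) / R * A := by
  have h1 := mvp (hf.D (ev i)) (lap_D hf isOpen_ball h (ev i)) hR le_rfl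
  have hs : Sm (fun y => f (p + R • y)) := (hf.trans p).comp_smul R
  have h2 := ibp 0 (hs.of_le (by exact_mod_cast le_top)) i
  have h3 : ∀ y, fderiv ℝ (fun y => f (p + R • y)) y (ev i) = R * D (ev i) f (p + R • y) := by
    intro y
    have := congrFun (D_smul _ (hf.trans p) R (ev i)) y
    refine this.trans ?_
    unfold D; rw [fderiv_comp_add_left]
  simp_rw [h3, mul_assoc] at h2
  rw [integral_const_mul] at h2
  simp only [zero_add] at h2
  rw [← h1] at h2
  have hA0 : 0 ≤ A := (abs_nonneg _).trans (hA p (mem_ball_self hR))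
  have h5 : |∫ y, f (p + R • y) * (y i * ph y ^ 1)| ≤ ∫ y : EE n, A * ph y ^ 1 := by
    rw [← Real.norm_eq_abs]
    refine norm_integral_le_of_norm_le (integ_ph (n := n) 0 (g := fun _ => A) continuous_const) ?_
    refine Filter.Eventually.of_forall fun y => ?_
    by_cases hy : ph y = 0
    · simp [hy]
    have hy1 := norm_lt_of_ph hy
    rw [norm_mul, norm_mul, Real.norm_of_nonneg (pow_nonneg (ph_nonneg y) 1)]
    have : ‖y i‖ ≤ 1 := (PiLp.norm_apply_le y i).trans hy1.le
    have h6 : ‖f (p + R • y)‖ ≤ A := by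
      apply hA; apply ball_trans
      rw [mem_ball_zero_iff, norm_smul, Real.norm_of_nonneg hR.le]; nlinarith
    calc _ ≤ A * (1 * ph y ^ 1) := by
          have hph := pow_nonneg (ph_nonneg y) 1
          exact mul_le_mul h6 (mul_le_mul_of_nonneg_right this hph) (mul_nonneg (norm_nonneg _) hph) hA0
      _ = _ := by ring
  rw [integral_const_mul] at h5
  have hc := c0_pos (n := n)
  have h7 : R * c0 n * |D (ev i) f p| = 4 * |∫ y, f (p + R • y) * (y i * ph y ^ 1)| := by
    have := congrArg abs h2
    rw [abs_mul, abs_mul, abs_mul, abs_mul, abs_of_pos hR, abs_of_pos hc] at this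
    have h4 : |(((0:ℕ):ℝ) + 2)| = 2 := by norm_num
    have h4' : |(2:ℝ)| = 2 := by norm_num
    rw [h4, h4'] at this
    linarith
  have h8 : |D (ev i) f p| = (R * c0 n)⁻¹ * (R * c0 n * |D (ev i) f p|) := by field_simp
  rw [h8, h7]
  calc _ ≤ (R * c0 n)⁻¹ * (4 * (A * ∫ y : EE n, ph y ^ 1)) := by gcongr
    _ = _ := by field_simp

lemma grad {f : EE n → ℝ} (hf : Sm f) {p : EE n} {R A : ℝ} (hR : 0 < R) (h : ∀ x ∈ ball p R, lap f x = 0)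
    (hA : ∀ x ∈ ball p R, |f x| ≤ A) {e : EE n} (he : ‖e‖ ≤ 1) : |D e f p| ≤ Cg n / R * A := by
  have hA0 : 0 ≤ A := (abs_nonneg _).trans (hA p (mem_ball_self hR))
  set q := (4 * (∫ y : EE n, ph y ^ 1) / c0 n) / R * A with hq
  have h1 : |D e f p| ≤ ∑ i : Fin n, q := by
    have : D e f p = ∑ i, e i * D (ev i) f p := fderiv_eq_sum f p e
    rw [this]
    refine (Finset.abs_sum_le_sum_abs _ _).trans (Finset.sum_le_sum fun i _ => ?_)
    rw [abs_mul]
    have h1 : |e i| ≤ 1 := (PiLp.norm_apply_le e i).trans he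
    have h2 := grad_i hf hR h hA i
    calc _ ≤ 1 * q := by gcongr
      _ = q := one_mul q
  refine h1.trans ?_
  simp only [Finset.sum_const, Finset.card_univ, Fintype.card_fin, nsmul_eq_mul]
  unfold Cg
  rw [hq, add_div, add_mul]
  have : 0 ≤ 1 / R * A := by positivity
  have h3 : n * ((4 * (∫ y : EE n, ph y ^ 1) / c0 n) / R * A) = n * (4 * (∫ y : EE n, ph y ^ 1) / c0 n) / R * A := by ring
  linarith

/-- iterated derivative estimate -/
lemma grad_iter {f : EE n → ℝ} (hf : Sm f) {p : EE n} {R A : ℝ} (hR : 0 < R) (h : ∀ x ∈ ball p R, lap f x = 0)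
    (hA : ∀ x ∈ ball p R, |f x| ≤ A) {e : EE n} (he : ‖e‖ ≤ 1) (k : ℕ) :
    |(D e)^[k] f p| ≤ (Cg n * k / R) ^ k * A := by
  rcases Nat.eq_zero_or_pos k with hk | hk
  · subst hk; simpa using hA p (mem_ball_self hR)
  have hk' : (0:ℝ) < k := by exact_mod_cast hk
  have hC := Cg_pos (n := n)
  have key : ∀ j : ℕ, j ≤ k → Sm ((D e)^[j] f) ∧ (∀ x ∈ ball p R, lap ((D e)^[j] f) x = 0) ∧
      ∀ x, ‖x - p‖ < R - j * (R / k) ∨ (x = p) → |(D e)^[j] f x| ≤ (Cg n * k / R) ^ j * A := by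
    intro j
    induction j with
    | zero =>
      intro _
      refine ⟨hf, h, ?_⟩
      intro x hx
      simp only [Function.iterate_zero, id, pow_zero, one_mul]
      rcases hx with hx | hx
      · apply hA; rw [mem_ball, dist_eq_norm]; simpa using hx
      · rw [hx]; exact hA p (mem_ball_self hR)
    | succ j ih =>
      intro hj
      obtain ⟨i1, i2, i3⟩ := ih (by omega)
      rw [Function.iterate_succ_apply']
      refine ⟨i1.D e, lap_D i1 isOpen_ball i2 e, ?_⟩
      intro x hx
      have hjk : ((j:ℝ) + 1) * (R / k) ≤ R := by
        have : ((j:ℝ)+1) ≤ k := by exact_mod_cast hj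
        calc _ ≤ k * (R / k) := by gcongr
          _ = R := by field_simp
      have hx' : ‖x - p‖ ≤ R - (j+1) * (R / k) := by
        rcases hx with hx | hx
        · push_cast at hx; exact hx.le
        · rw [hx]; simp; linarith
      have hRk : 0 < R / k := by positivity
      have := grad i1 (p := x) (R := R / k) (A := (Cg n * k / R) ^ j * A) hRk ?_ ?_ he
      · refine this.trans (le_of_eq ?_)
        rw [pow_succ]; field_simp
      · intro z hz
        apply i2
        rw [mem_ball, dist_eq_norm] at hz ⊢
        have : ‖z - p‖ ≤ ‖z - x‖ + ‖x - p‖ := norm_sub_le_norm_sub_add_norm_sub _ _ _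
        have : 0 ≤ j * (R / k) := by positivity
        linarith
      · intro z hz
        apply i3; left
        rw [mem_ball, dist_eq_norm] at hz
        have : ‖z - p‖ ≤ ‖z - x‖ + ‖x - p‖ := norm_sub_le_norm_sub_add_norm_sub _ _ _
        linarith
  exact (key k le_rfl).2.2 p (Or.inr rfl)

end CW

namespace CW
variable {n : ℕ}

abbrev Fam (n : ℕ) := Fin n → EE n → ℝ

noncomputable def nF (F : Fam n) (x : EE n) : ℝ := √(∑ i, F i x ^ 2)
noncomputable def Mx (F : Fam n) (x : EE n) (r : ℝ) : ℝ := sSup (nF F '' ball x r)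
def SmF (F : Fam n) : Prop := ∀ i, Sm (F i)
def HaF (F : Fam n) (p : EE n) (R : ℝ) : Prop := ∀ i, ∀ x ∈ ball p R, lap (F i) x = 0
noncomputable def H (F : Fam n) (x : EE n) (s : ℝ) : ℝ :=
  ∑ i, G (fun y => F i (x + y)) (fun y => F i (x + y)) s s

lemma nF_nonneg (F : Fam n) (x : EE n) : 0 ≤ nF F x := Real.sqrt_nonneg _
lemma nF_sq (F : Fam n) (x : EE n) : nF F x ^ 2 = ∑ i, F i x ^ 2 :=
  Real.sq_sqrt (Finset.sum_nonneg fun i _ => sq_nonneg _)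
lemma abs_le_nF (F : Fam n) (i : Fin n) (x : EE n) : |F i x| ≤ nF F x := by
  apply Real.abs_le_sqrt
  exact Finset.single_le_sum (f := fun i => F i x ^ 2) (fun i _ => sq_nonneg _) (Finset.mem_univ i)
lemma nF_le (F : Fam n) (x : EE n) {B : ℝ} (h : ∀ i, |F i x| ≤ B) : nF F x ≤ n * B := by
  have hs : ∑ i, F i x ^ 2 ≤ (∑ i, |F i x|) ^ 2 := by
    calc ∑ i, F i x ^ 2 = ∑ i, |F i x| ^ 2 := by simp
      _ ≤ _ := Finset.sum_sq_le_sq_sum_of_nonneg (fun i _ => abs_nonneg _)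
  have h1 : nF F x ≤ ∑ i, |F i x| := by
    unfold nF
    rw [Real.sqrt_le_left (Finset.sum_nonneg fun i _ => abs_nonneg _)]
    exact hs
  refine h1.trans ((Finset.sum_le_sum fun i _ => h i).trans ?_)
  simp

lemma nF_cont {F : Fam n} (hF : SmF F) : Continuous (nF F) := by
  unfold nF
  have := fun i => (hF i).cont
  fun_prop

lemma Mx_bdd {F : Fam n} (hF : SmF F) (x : EE n) (r : ℝ) : BddAbove (nF F '' ball x r) :=
  ((isCompact_closedBall x r).bddAbove_image (nF_cont hF).continuousOn).mono (image_mono ball_subset_closedBall)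

lemma le_Mx {F : Fam n} (hF : SmF F) {x z : EE n} {r : ℝ} (h : z ∈ ball x r) : nF F z ≤ Mx F x r :=
  le_csSup (Mx_bdd hF x r) ⟨z, h, rfl⟩

lemma Mx_le {F : Fam n} {x : EE n} {r A : ℝ} (hA : 0 ≤ A) (h : ∀ z ∈ ball x r, nF F z ≤ A) : Mx F x r ≤ A := by
  apply Real.sSup_le _ hA
  rintro _ ⟨z, hz, rfl⟩; exact h z hz

lemma Mx_nonneg (F : Fam n) (x : EE n) (r : ℝ) : 0 ≤ Mx F x r := by
  apply Real.sSup_nonneg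
  rintro _ ⟨z, hz, rfl⟩; exact nF_nonneg F z

lemma Mx_mono {F : Fam n} (hF : SmF F) {x y : EE n} {r s : ℝ} (h : ball x r ⊆ ball y s) : Mx F x r ≤ Mx F y s :=
  Mx_le (Mx_nonneg _ _ _) fun _ hz => le_Mx hF (h hz)

lemma Mx_mono' {F : Fam n} (hF : SmF F) {x : EE n} {r s : ℝ} (h : r ≤ s) : Mx F x r ≤ Mx F x s :=
  Mx_mono hF (ball_subset_ball h)

lemma H_eq {F : Fam n} (hF : SmF F) (x : EE n) (s : ℝ) :
    H F x s = ∫ y, nF F (x + s • y) ^ 2 * ph y ^ 2 := by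
  simp_rw [nF_sq, Finset.sum_mul]
  rw [integral_finsetSum]
  · unfold H G; simp_rw [sq]
  · intro i _
    have := (hF i).cont
    exact integ_ph 1 (by fun_prop)

lemma H_nonneg {F : Fam n} (hF : SmF F) (x : EE n) (s : ℝ) : 0 ≤ H F x s := by
  rw [H_eq hF]
  exact integral_nonneg fun y => mul_nonneg (sq_nonneg _) (sq_nonneg _)

lemma mem_ball_smul {x y : EE n} {s : ℝ} (hs : 0 < s) (hy : ph y ≠ 0) : x + s • y ∈ ball x s := by
  apply ball_trans
  rw [mem_ball_zero_iff, norm_smul, Real.norm_of_nonneg hs.le]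
  nlinarith [norm_lt_of_ph hy]

lemma H_le {F : Fam n} (hF : SmF F) (x : EE n) {s : ℝ} (hs : 0 < s) : H F x s ≤ c0 n * Mx F x s ^ 2 := by
  rw [H_eq hF, mul_comm, c0, ← integral_const_mul]
  have := nF_cont hF
  apply integral_mono (integ_ph 1 (by fun_prop)) (integ_ph 1 continuous_const)
  intro y
  by_cases hy : ph y = 0
  · simp [hy]
  apply mul_le_mul_of_nonneg_right _ (sq_nonneg _)
  have := le_Mx hF (mem_ball_smul (x := x) hs hy)
  have := nF_nonneg F (x + s • y)
  gcongr

/-- log-convexity -/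
lemma H_logconv {F : Fam n} (hF : SmF F) {x : EE n} {R : ℝ} (hh : HaF F x R) {a b s : ℝ} (ha : 0 < a) (hb : 0 < b)
    (hs : 0 < s) (haR : a ≤ R) (hbR : b ≤ R) (hsR : s ≤ R) (hab : a * b = s * s) :
    H F x s ^ 2 ≤ H F x a * H F x b := by
  have e1 : H F x s = ∑ i, G (fun y => F i (x + y)) (fun y => F i (x + y)) a b := by
    unfold H
    apply Finset.sum_congr rfl
    intro i _
    have hl : ∀ z ∈ ball (0 : EE n) R, lap (fun y => F i (x + y)) z = 0 := by
      intro z hz; rw [lap_trans]; exact hh i _ (ball_trans hz)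
    exact G_eq ((hF i).trans x) ((hF i).trans x) hl hl hs hs ha hb hsR hsR haR hbR hab.symm
  have key : ∀ t : ℝ, 0 ≤ H F x a * (t * t) + 2 * H F x s * t + H F x b := by
    intro t
    have : H F x a * (t * t) + 2 * H F x s * t + H F x b = ∑ i, ∫ y, (t * F i (x + a • y) + F i (x + b • y)) ^ 2 * ph y ^ 2 := by
      rw [e1]
      unfold H
      rw [Finset.sum_mul, Finset.mul_sum, Finset.sum_mul, ← Finset.sum_add_distrib, ← Finset.sum_add_distrib]
      apply Finset.sum_congr rfl
      intro i _
      unfold G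
      have hc := (hF i).cont
      rw [← integral_mul_const, ← integral_const_mul, ← integral_mul_const, ← integral_add, ← integral_add]
      · congr 1; funext y; ring
      · apply Integrable.add
        · exact (integ_ph 1 (by fun_prop)).mul_const _
        · exact ((integ_ph 1 (by fun_prop)).const_mul _).mul_const _
      · exact integ_ph 1 (by fun_prop)
      · exact (integ_ph 1 (by fun_prop)).mul_const _
      · exact ((integ_ph 1 (by fun_prop)).const_mul _).mul_const _
    rw [this]
    exact Finset.sum_nonneg fun i _ => integral_nonneg fun y => mul_nonneg (sq_nonneg _) (sq_nonneg _)
  have := discrim_le_zero key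
  unfold discrim at this
  nlinarith

lemma sq_le_avg {f : EE n → ℝ} (hf : Sm f) {p : EE n} {t : ℝ} (ht : 0 < t) (h : ∀ x ∈ ball p t, lap f x = 0) :
    c0 n * f p ^ 2 ≤ ∫ y, f (p + t • y) ^ 2 * ph y ^ 2 := by
  have h1 := mvp hf h ht le_rfl
  have hc := hf.cont
  have h2 : 0 ≤ ∫ y, (f (p + t • y) - f p) ^ 2 * ph y ^ 2 := integral_nonneg fun y => mul_nonneg (sq_nonneg _) (sq_nonneg _)
  have h3 : ∫ y, (f (p + t • y) - f p) ^ 2 * ph y ^ 2 = (∫ y, f (p + t • y) ^ 2 * ph y ^ 2) - 2 * f p * (∫ y, f (p + t • y) * ph y ^ 2) + f p ^ 2 * c0 n := by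
    unfold c0
    rw [← integral_const_mul, ← integral_const_mul, ← integral_sub, ← integral_add]
    · congr 1; funext y; ring
    · exact (integ_ph 1 (by fun_prop)).sub ((integ_ph 1 (by fun_prop)).const_mul _)
    · exact integ_ph 1 (by fun_prop)
    · exact integ_ph 1 (by fun_prop)
    · exact (integ_ph 1 (by fun_prop)).const_mul _
  rw [h3, ← h1] at h2
  nlinarith

lemma nF_sq_le_avg {F : Fam n} (hF : SmF F) {p : EE n} {t : ℝ} (ht : 0 < t) (h : HaF F p t) :
    c0 n * nF F p ^ 2 ≤ ∫ y, nF F (p + t • y) ^ 2 * ph y ^ 2 := by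
  rw [← H_eq hF, nF_sq, Finset.mul_sum]
  unfold H G
  apply Finset.sum_le_sum
  intro i _
  simpa only [sq] using sq_le_avg (hF i) ht (h i)

/-- comparison constant -/
noncomputable def Kc (n : ℕ) (ε : ℝ) : ℝ :=
  (1 - ((1 + ε / 2) / (1 + ε)) ^ 2)⁻¹ ^ 2 * (2 * (1 + ε) / ε) ^ n / c0 n

lemma Kc_pos {ε : ℝ} (hε : 0 < ε) : 0 < Kc n ε := by
  have := c0_pos (n := n)
  have h1 : (1 + ε / 2) / (1 + ε) < 1 := by rw [div_lt_one (by positivity)]; linarith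
  have h0 : 0 ≤ (1 + ε / 2) / (1 + ε) := by positivity
  have : 0 < 1 - ((1 + ε / 2) / (1 + ε)) ^ 2 := by nlinarith
  unfold Kc; positivity

lemma avg_compare {F : Fam n} (hF : SmF F) {x z : EE n} {t s κ : ℝ} (ht : 0 < t) (hs : 0 < s) (hκ : 0 < κ)
    (hz : ∀ y : EE n, ‖y‖ < 1 → κ ≤ ph (s⁻¹ • ((z - x) + t • y))) :
    ∫ y, nF F (z + t • y) ^ 2 * ph y ^ 2 ≤ κ⁻¹ ^ 2 * (s / t) ^ n * H F x s := by
  have hc := nF_cont hF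
  set q : EE n → ℝ := fun w => nF F (x + s • w) ^ 2 * ph w ^ 2 with hq
  have e1 : ∫ y, q (s⁻¹ • ((z - x) + t • y)) = (s / t) ^ n * H F x s := by
    have a1 := Measure.integral_comp_smul (volume : Measure (EE n)) (fun y => q (s⁻¹ • ((z - x) + y))) t
    have a2 := integral_add_left_eq_self (μ := (volume : Measure (EE n))) (fun y => q (s⁻¹ • y)) (z - x)
    have a3 := Measure.integral_comp_smul (volume : Measure (EE n)) q s⁻¹
    rw [a1, a2, a3, H_eq hF]
    simp only [finrank_euclideanSpace, Fintype.card_fin, smul_eq_mul]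
    rw [abs_of_pos (by positivity), abs_of_pos (by positivity), ← mul_assoc]
    congr 1
    rw [div_pow, inv_pow, inv_inv]; field_simp
  rw [mul_assoc, ← e1, ← integral_const_mul]
  have hphc := ph_cont (n := n)
  have hqc : Integrable (fun y => q (s⁻¹ • ((z - x) + t • y))) := by
    have hqi : Integrable q := integ_ph 1 (by fun_prop)
    have b1 : Integrable (fun y => q (s⁻¹ • y)) := hqi.comp_smul (inv_ne_zero hs.ne')
    have b2 : Integrable (fun y => q (s⁻¹ • ((z - x) + y))) := b1.comp_add_left (z - x)
    exact b2.comp_smul ht.ne'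
  apply integral_mono (integ_ph 1 (by fun_prop)) (hqc.const_mul _)
  intro y
  by_cases hy : ph y = 0
  · simp only [hy, hq]
    simp; positivity
  have h1 := hz y (norm_lt_of_ph hy)
  simp only [hq]
  have e2 : x + s • s⁻¹ • ((z - x) + t • y) = z + t • y := by
    rw [smul_inv_smul₀ hs.ne']; abel
  rw [e2]
  have h2 : ph y ^ 2 ≤ 1 := pow_le_one₀ (ph_nonneg y) (ph_le y)
  have h3 : 1 ≤ κ⁻¹ ^ 2 * ph (s⁻¹ • ((z - x) + t • y)) ^ 2 := by
    rw [← mul_pow]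
    apply one_le_pow₀
    rw [inv_mul_eq_div, le_div_iff₀ hκ]; linarith
  calc _ ≤ nF F (z + t • y) ^ 2 * (κ⁻¹ ^ 2 * ph (s⁻¹ • ((z - x) + t • y)) ^ 2) := by
        gcongr; exact h2.trans h3
    _ = _ := by ring

lemma Mx_sq_le {F : Fam n} (hF : SmF F) {x : EE n} {s ε : ℝ} (hs : 0 < s) (hε : 0 < ε)
    (hh : HaF F x (s * (1 + ε))) : Mx F x s ^ 2 ≤ Kc n ε * H F x (s * (1 + ε)) := by
  have hH := H_nonneg hF x (s * (1 + ε))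
  have hc := c0_pos (n := n)
  have hk := Kc_pos (n := n) hε
  have h1 : (1 + ε / 2) / (1 + ε) < 1 := by rw [div_lt_one (by positivity)]; linarith
  have h0 : 0 ≤ (1 + ε / 2) / (1 + ε) := by positivity
  have hκ : 0 < 1 - ((1 + ε / 2) / (1 + ε)) ^ 2 := by nlinarith
  have : Mx F x s ≤ √(Kc n ε * H F x (s * (1 + ε))) := by
    apply Mx_le (Real.sqrt_nonneg _)
    intro z hz
    apply Real.le_sqrt_of_sq_le
    have hzx : ‖z - x‖ < s := by rwa [mem_ball, dist_eq_norm] at hz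
    have ht : 0 < s * ε / 2 := by positivity
    have a1 := nF_sq_le_avg hF (p := z) ht ?_
    · have a2 := avg_compare hF (x := x) (z := z) ht (s := s * (1 + ε)) (by positivity) hκ ?_
      · have a3 := a1.trans a2
        have : s * (1 + ε) / (s * ε / 2) = 2 * (1 + ε) / ε := by field_simp
        rw [this] at a3
        have : Kc n ε * H F x (s * (1 + ε)) = (((1 - ((1 + ε / 2) / (1 + ε)) ^ 2)⁻¹ ^ 2 * (2 * (1 + ε) / ε) ^ n) * H F x (s * (1 + ε))) / c0 n := by
          unfold Kc; ring
        rw [this, le_div_iff₀ hc]; linarith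
      · intro y hy
        unfold ph
        apply le_max_of_le_left
        have : ‖(s * (1 + ε))⁻¹ • ((z - x) + (s * ε / 2) • y)‖ ≤ (1 + ε / 2) / (1 + ε) := by
          rw [norm_smul, Real.norm_of_nonneg (by positivity)]
          have h5 : ‖(z - x) + (s * ε / 2) • y‖ ≤ s * (1 + ε / 2) := by
            refine (norm_add_le _ _).trans ?_
            rw [norm_smul, Real.norm_of_nonneg ht.le]
            nlinarith
          calc _ ≤ (s * (1 + ε))⁻¹ * (s * (1 + ε / 2)) := by gcongr
            _ = _ := by field_simp
        gcongr
    · intro i w hw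
      apply hh i w
      rw [mem_ball, dist_eq_norm] at hw ⊢
      have := norm_sub_le_norm_sub_add_norm_sub w z x
      nlinarith
  calc _ ≤ √(Kc n ε * H F x (s * (1 + ε))) ^ 2 := by
        have := Mx_nonneg F x s
        gcongr
    _ = _ := Real.sq_sqrt (by positivity)

end CW

namespace CW
variable {n : ℕ}

lemma ratio_mono {h : ℕ → ℝ} {q : ℝ} {m : ℕ} (hpos : ∀ k, k ≤ m → 0 < h k)
    (hlc : ∀ k, k + 2 ≤ m → h (k+1) ^ 2 ≤ h k * h (k+2)) (h1 : q * h 0 ≤ h 1) (hq : 0 < q) :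
    ∀ j, j ≤ m → q ^ (m - j) * h j ≤ h m := by
  have step : ∀ k, k + 1 ≤ m → q * h k ≤ h (k+1) := by
    intro k
    induction k with
    | zero => intro _; simpa using h1
    | succ k ih =>
      intro hk
      have i1 := ih (by omega)
      have i2 := hlc k (by omega)
      have p0 := hpos k (by omega)
      have p1 := hpos (k+1) (by omega)
      have : h k * (q * h (k+1)) ≤ h k * h (k+2) := by nlinarith
      exact le_of_mul_le_mul_left this p0
  intro j hj
  obtain ⟨d, rfl⟩ := Nat.exists_eq_add_of_le hj
  have : ∀ e, e ≤ d → q ^ e * h j ≤ h (j + e) := by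
    intro e
    induction e with
    | zero => intro _; simp
    | succ e ih =>
      intro he
      have i1 := ih (by omega)
      have i2 := step (j + e) (by omega)
      calc q ^ (e+1) * h j = q * (q ^ e * h j) := by ring
        _ ≤ q * h (j + e) := by gcongr
        _ ≤ _ := i2
  simpa using this d le_rfl

lemma H_pos {F : Fam n} (hF : SmF F) {x : EE n} {s : ℝ} (hs : 0 < s) (hh : HaF F x s)
    (hp : ∀ r, 0 < r → 0 < Mx F x r) : 0 < H F x s := by
  have e : s / 2 * (1 + 1) = s := by ring
  have := Mx_sq_le hF (x := x) (s := s/2) (ε := 1) (by positivity) one_pos (by rw [e]; exact hh)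
  rw [e] at this
  have h2 := hp (s/2) (by positivity)
  have h3 := Kc_pos (n := n) one_pos
  by_contra hcon
  have : Kc n 1 * H F x s ≤ 0 := by nlinarith
  nlinarith

lemma HaF.mono {F : Fam n} {x : EE n} {R R' : ℝ} (h : HaF F x R) (hR : R' ≤ R) : HaF F x R' :=
  fun i z hz => h i z (ball_subset_ball hR hz)

/-- `L = 10 n` -/
lemma logL_ge {n : ℕ} (hn : 1 ≤ n) : 2 ≤ Real.log (10 * n) := by
  have hn' : (1:ℝ) ≤ n := by exact_mod_cast hn
  have h1 : Real.exp 2 ≤ 10 * n := by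
    have := Real.exp_one_lt_d9
    have h2 : Real.exp 2 = Real.exp 1 * Real.exp 1 := by rw [← Real.exp_add]; norm_num
    nlinarith [Real.exp_pos 1]
  calc (2:ℝ) = Real.log (Real.exp 2) := (Real.log_exp 2).symm
    _ ≤ _ := Real.log_le_log (Real.exp_pos 2) h1

set_option maxHeartbeats 1000000 in
lemma bad_decay (hn : 1 ≤ n) {η : ℝ} (hη : 0 < η) (hη1 : η < 1) : ∃ N₀ : ℝ, 0 < N₀ ∧ ∀ N, N₀ ≤ N →
    ∀ F : Fam n, SmF F → ∀ x : EE n, HaF F x 1 → (∀ r, 0 < r → 0 < Mx F x r) →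
    ∀ r : ℝ, 0 < r → 20 * n * r ≤ 1 → Real.exp N * Mx F x r ≤ Mx F x (10 * n * r) →
    ∀ ρ : ℝ, r ≤ ρ → ρ ≤ 1 →
      Mx F x ρ ≤ Real.exp (4 * N - (1 - η) * N / Real.log (10 * n) * Real.log (1/ρ)) * Mx F x 1 := by
  set η' := η / 4 with hη'
  have hη'0 : 0 < η' := by positivity
  set C := Kc n η' * c0 n with hC
  have hCp : 0 < C := mul_pos (Kc_pos hη'0) c0_pos
  refine ⟨max 1 (|Real.log C| / (2 * η')), by positivity, ?_⟩
  intro N hN F hF x hh hp r hr hr1 hbad ρ hρr hρ1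
  have hN1 : 1 ≤ N := (le_max_left _ _).trans hN
  have hCN : C ≤ Real.exp (2 * η' * N) := by
    have h1 : |Real.log C| / (2 * η') ≤ N := (le_max_right _ _).trans hN
    rw [div_le_iff₀ (by positivity)] at h1
    calc C = Real.exp (Real.log C) := (Real.exp_log hCp).symm
      _ ≤ _ := Real.exp_le_exp.2 ((le_abs_self _).trans (by linarith))
  have hn' : (1:ℝ) ≤ n := by exact_mod_cast hn
  have hlL := logL_ge hn
  set L : ℝ := 10 * n with hL
  have hL10 : 10 ≤ L := by rw [hL]; linarith
  set lam := L * (1 + η') with hlam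
  have hlam1 : 1 < lam := by nlinarith
  have hlog1 : Real.log lam ≤ (1 + η') * Real.log L := by
    rw [hlam, Real.log_mul (by positivity) (by positivity)]
    have : Real.log (1 + η') ≤ η' := by
      have := Real.log_le_sub_one_of_pos (show 0 < 1 + η' by positivity); linarith
    nlinarith
  have hlogL : Real.log L ≤ Real.log lam := Real.log_le_log (by positivity) (by rw [hlam]; exact le_mul_of_one_le_right (by positivity) (by linarith))
  have hll : 0 < Real.log lam := by linarith
  have hρ : 0 < ρ := hr.trans_le hρr
  set σ := Real.log (1/ρ) with hσ
  have hσ0 : 0 ≤ σ := Real.log_nonneg (by rw [le_div_iff₀ hρ]; linarith)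
  have hσ' : Real.log ρ = -σ := by rw [hσ, one_div, Real.log_inv]; ring
  have hη4 : η = 4 * η' := by rw [hη']; ring
  -- exponent comparison
  have hexp : (1 - η) * N / Real.log L * σ ≤ (1 - η') * N * (σ / Real.log lam) := by
    have h1 : (1 - η) / Real.log L ≤ (1 - η') / Real.log lam := by
      rw [div_le_div_iff₀ (by linarith) hll]
      have : (1 - η) * ((1 + η') * Real.log L) ≤ (1 - η') * Real.log L := by
        rw [← mul_assoc]; apply mul_le_mul_of_nonneg_right _ (by linarith); nlinarith
      nlinarith
    calc _ = (1 - η) / Real.log L * (N * σ) := by ring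
      _ ≤ (1 - η') / Real.log lam * (N * σ) := by gcongr
      _ = _ := by ring
  set j := ⌈Real.log (ρ * (1 + η') / r) / Real.log lam⌉₊ with hj
  set m := ⌊Real.log (1 / r) / Real.log lam⌋₊ with hm
  have hlr : 0 ≤ Real.log (ρ * (1 + η') / r) := Real.log_nonneg (by rw [le_div_iff₀ hr, one_mul]; exact hρr.trans (le_mul_of_one_le_right hρ.le (by linarith)))
  have hj1 : (j:ℝ) < Real.log (ρ * (1 + η') / r) / Real.log lam + 1 := Nat.ceil_lt_add_one (by positivity)
  have hj2 : Real.log (ρ * (1 + η') / r) / Real.log lam ≤ j := Nat.le_ceil _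
  have hr1' : r ≤ 1 := hρr.trans hρ1
  have h1r : 0 ≤ Real.log (1 / r) := Real.log_nonneg (by rw [le_div_iff₀ hr]; linarith)
  have hm1 : (m:ℝ) ≤ Real.log (1 / r) / Real.log lam := Nat.floor_le (by positivity)
  have hm2 : Real.log (1 / r) / Real.log lam < m + 1 := Nat.lt_floor_add_one _
  have hlr2 : Real.log (ρ * (1 + η') / r) = Real.log (1/r) - σ + Real.log (1 + η') := by
    rw [Real.log_div (by positivity) hr.ne', Real.log_mul hρ.ne' (by positivity), hσ', one_div, Real.log_inv]; ring
  have hle : Real.log (1 + η') ≤ Real.log lam := Real.log_le_log (by positivity) (by rw [hlam]; exact le_mul_of_one_le_left (by positivity) (by linarith))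
  have hdiff : σ / Real.log lam - 3 ≤ (m:ℝ) - j := by
    rw [hlr2, add_div, sub_div] at hj1
    have : Real.log (1 + η') / Real.log lam ≤ 1 := by rw [div_le_one hll]; exact hle
    linarith
  have hM1 := hp 1 one_pos
  by_cases hjm : j ≤ m
  · have hlp : ∀ k : ℕ, k ≤ m → lam ^ k * r ≤ 1 := by
      intro k hk
      have : Real.log (lam ^ k * r) ≤ 0 := by
        rw [Real.log_mul (by positivity) hr.ne', Real.log_pow]
        have h1 : (k:ℝ) ≤ Real.log (1 / r) / Real.log lam := le_trans (by exact_mod_cast hk) hm1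
        rw [le_div_iff₀ hll, one_div, Real.log_inv] at h1
        linarith
      exact (Real.log_nonpos_iff (by positivity)).1 this
    have hspos : ∀ k : ℕ, 0 < lam ^ k * r := fun k => by positivity
    have hq0 : 0 < Real.exp (2 * (1 - η') * N) := Real.exp_pos _
    have key := ratio_mono (h := fun k => H F x (lam ^ k * r)) (q := Real.exp (2 * (1 - η') * N)) (m := m)
      (fun k hk => H_pos hF (hspos k) (hh.mono (hlp k hk)) hp)
      (fun k hk => by
        refine H_logconv hF hh (hspos k) (hspos (k+2)) (hspos (k+1)) (hlp _ (by omega)) (hlp _ (by omega)) (hlp _ (by omega)) ?_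
        ring)
      ?_ hq0 j hjm
    · have b1 : Mx F x ρ ^ 2 ≤ Kc n η' * H F x (lam ^ j * r) := by
        have e : lam ^ j * r / (1 + η') * (1 + η') = lam ^ j * r := by field_simp
        have c1 : ρ ≤ lam ^ j * r / (1 + η') := by
          rw [le_div_iff₀ (by positivity)]
          rw [div_le_iff₀ hll] at hj2
          have : Real.log (ρ * (1 + η') / r) ≤ Real.log (lam ^ j) := by rw [Real.log_pow]; exact hj2
          have := (Real.log_le_log_iff (by positivity) (by positivity)).1 this
          rw [div_le_iff₀ hr] at this; exact this
        have c2 := Mx_sq_le hF (x := x) (s := lam ^ j * r / (1 + η')) (by have := hspos j; positivity) hη'0 (by rw [e]; exact hh.mono (hlp j hjm))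
        rw [e] at c2
        refine le_trans ?_ c2
        have := Mx_nonneg F x ρ
        have := Mx_mono' hF (x := x) c1
        gcongr
      have b2 : H F x (lam ^ m * r) ≤ c0 n * Mx F x 1 ^ 2 := by
        refine (H_le hF x (hspos m)).trans ?_
        have := Mx_mono' hF (x := x) (hlp m le_rfl)
        have := Mx_nonneg F x (lam ^ m * r)
        have := c0_pos (n := n)
        gcongr
      have b3 : Real.exp (2 * (1 - η') * N) ^ (m - j) = Real.exp (2 * (1 - η') * N * ((m:ℝ) - j)) := by
        rw [← Real.exp_nat_mul, Nat.cast_sub hjm]; congr 1; ring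
      simp only [b3] at key
      have b4 : H F x (lam ^ j * r) ≤ Real.exp (-(2 * (1 - η') * N * ((m:ℝ) - j))) * H F x (lam ^ m * r) := by
        rw [Real.exp_neg, inv_mul_eq_div, le_div_iff₀ (Real.exp_pos _)]; linarith
      have b5 : Mx F x ρ ^ 2 ≤ (Real.exp (4 * N - (1 - η) * N / Real.log L * σ) * Mx F x 1) ^ 2 := by
        have hk := (Kc_pos (n := n) hη'0).le
        calc Mx F x ρ ^ 2 ≤ Kc n η' * (Real.exp (-(2 * (1 - η') * N * ((m:ℝ) - j))) * (c0 n * Mx F x 1 ^ 2)) := by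
              refine b1.trans ?_
              gcongr
              exact b4.trans (by gcongr)
          _ = C * Real.exp (-(2 * (1 - η') * N * ((m:ℝ) - j))) * Mx F x 1 ^ 2 := by rw [hC]; ring
          _ ≤ Real.exp (2 * η' * N) * Real.exp (-(2 * (1 - η') * N * ((m:ℝ) - j))) * Mx F x 1 ^ 2 := by gcongr
          _ ≤ Real.exp (2 * (4 * N - (1 - η) * N / Real.log L * σ)) * Mx F x 1 ^ 2 := by
              rw [← Real.exp_add]
              gcongr
              have : (1 - η') * N * (σ / Real.log lam - 3) ≤ (1 - η') * N * ((m:ℝ) - j) := by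
                apply mul_le_mul_of_nonneg_left hdiff; apply mul_nonneg <;> linarith
              have e1 : (1 - η') * N * (σ / Real.log lam - 3) = (1 - η') * N * (σ / Real.log lam) - (3 * N - 3 * (η' * N)) := by ring
              have e2 : 0 ≤ η' * N := by positivity
              have e3 : η' * N ≤ 1 * N := by gcongr; linarith
              have e4 : 2 * (1 - η') * N * ((m:ℝ) - j) = 2 * ((1 - η') * N * ((m:ℝ) - j)) := by ring
              rw [e4]
              linarith
          _ = _ := by rw [mul_pow, ← Real.exp_nat_mul]; norm_num
      have hnn : 0 ≤ Real.exp (4 * N - (1 - η) * N / Real.log L * σ) * Mx F x 1 := by positivity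
      exact (pow_le_pow_iff_left₀ (Mx_nonneg _ _ _) hnn two_ne_zero).1 b5
    · -- first ratio
      have hlr1 : lam * r ≤ 1 := by
        have h2 : lam ≤ 20 * n := by
          have : lam ≤ L * 2 := by rw [hlam]; gcongr; linarith
          rw [hL] at this; linarith
        exact (mul_le_mul_of_nonneg_right h2 hr.le).trans hr1
      have c1 := Mx_sq_le hF (x := x) (s := L * r) (ε := η') (by positivity) hη'0 (hh.mono (by rw [hlam] at hlr1; linarith))
      have c2 := H_le hF x hr
      have e : L * r * (1 + η') = lam * r := by rw [hlam]; ring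
      rw [e] at c1
      simp only [pow_zero, one_mul, pow_one]
      have hk := Kc_pos (n := n) hη'0
      have c3 : Real.exp (2 * N) * Mx F x r ^ 2 ≤ Mx F x (L * r) ^ 2 := by
        have : Real.exp (2 * N) = Real.exp N ^ 2 := by rw [← Real.exp_nat_mul]; norm_num
        rw [this, ← mul_pow]
        have := (hp r hr).le
        gcongr
      have c4 : Kc n η' * (Real.exp (2 * (1 - η') * N) * H F x r) ≤ Kc n η' * H F x (lam * r) := by
        refine le_trans ?_ c1
        refine le_trans ?_ c3
        calc _ ≤ Kc n η' * (Real.exp (2 * (1 - η') * N) * (c0 n * Mx F x r ^ 2)) := by gcongr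
          _ = C * Real.exp (2 * (1 - η') * N) * Mx F x r ^ 2 := by rw [hC]; ring
          _ ≤ Real.exp (2 * η' * N) * Real.exp (2 * (1 - η') * N) * Mx F x r ^ 2 := by gcongr
          _ = _ := by rw [← Real.exp_add]; congr 2; ring
      exact le_of_mul_le_mul_left c4 hk
  · have h1 : (m:ℝ) - j < 0 := by
      have : (m:ℝ) < j := by exact_mod_cast not_le.1 hjm
      linarith
    have h2 : (1 - η') * N * (σ / Real.log lam) ≤ (1 - η') * N * 3 := by
      apply mul_le_mul_of_nonneg_left (by linarith); apply mul_nonneg <;> linarith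
    have h3 : 1 ≤ Real.exp (4 * N - (1 - η) * N / Real.log L * σ) := Real.one_le_exp (by
      have e1 : (1 - η') * N * 3 = 3 * N - 3 * (η' * N) := by ring
      have e2 : 0 ≤ η' * N := by positivity
      linarith)
    have h4 := Mx_mono' hF (x := x) hρ1
    exact h4.trans (le_mul_of_one_le_left hM1.le h3)

lemma growth (hn : 1 ≤ n) {F : Fam n} (hF : SmF F) {x : EE n} {B R₀ : ℝ} (hB : 0 ≤ B)
    (hd : ∀ r : ℝ, 0 < r → r ≤ R₀ → Mx F x (10 * n * r) ≤ Real.exp B * Mx F x r)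
    {r R : ℝ} (hr : 0 < r) (hrR : r ≤ R) (hR : R ≤ R₀) :
    Mx F x R ≤ Real.exp (B + B / Real.log (10 * n) * Real.log (R / r)) * Mx F x r := by
  have hlL := logL_ge hn
  have hn' : (1:ℝ) ≤ n := by exact_mod_cast hn
  set L : ℝ := 10 * n with hL
  have hL10 : 10 ≤ L := by rw [hL]; linarith
  have hll : 0 < Real.log L := by linarith
  have hRr : 0 ≤ Real.log (R / r) := Real.log_nonneg (by rw [le_div_iff₀ hr]; linarith)
  set k := ⌈Real.log (R / r) / Real.log L⌉₊ with hk
  have hk1 : (k:ℝ) < Real.log (R / r) / Real.log L + 1 := Nat.ceil_lt_add_one (by positivity)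
  have hk2 : Real.log (R / r) / Real.log L ≤ k := Nat.le_ceil _
  have hR0 : 0 < R := hr.trans_le hrR
  have key : ∀ j : ℕ, j ≤ k → Mx F x (L ^ j * r) ≤ Real.exp (j * B) * Mx F x r := by
    intro j
    induction j with
    | zero => intro _; simp
    | succ j ih =>
      intro hj
      have hjR : L ^ j * r ≤ R := by
        have h1 : ((j:ℝ) + 1) ≤ k := by exact_mod_cast hj
        have h2 : (j:ℝ) < Real.log (R / r) / Real.log L := by linarith
        rw [lt_div_iff₀ hll, ← Real.log_pow] at h2
        have := (Real.log_lt_log_iff (by positivity) (by positivity)).1 h2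
        rw [lt_div_iff₀ hr] at this; exact this.le
      have h3 := hd (L ^ j * r) (by positivity) (hjR.trans hR)
      have e : L ^ (j+1) * r = L * (L ^ j * r) := by ring
      rw [e]
      refine h3.trans ?_
      calc _ ≤ Real.exp B * (Real.exp (j * B) * Mx F x r) := by gcongr; exact ih (by omega)
        _ = _ := by rw [← mul_assoc, ← Real.exp_add]; congr 2; push_cast; ring
  have h1 : R ≤ L ^ k * r := by
    rw [div_le_iff₀ hll, ← Real.log_pow] at hk2
    have := (Real.log_le_log_iff (by positivity) (by positivity)).1 hk2
    rwa [div_le_iff₀ hr] at this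
  refine (Mx_mono' hF h1).trans ((key k le_rfl).trans ?_)
  have := Mx_nonneg F x r
  gcongr
  calc (k:ℝ) * B ≤ (Real.log (R / r) / Real.log L + 1) * B := by gcongr
    _ = _ := by ring

end CW

namespace CW
variable {n : ℕ}

lemma iter_deriv_line {f : EE n → ℝ} (hf : Sm f) (p e : EE n) (k : ℕ) :
    iteratedDeriv k (fun t : ℝ => f (p + t • e)) = fun t => (D e)^[k] f (p + t • e) := by
  have hS : ∀ k, Sm ((D e)^[k] f) := by
    intro k
    induction k with
    | zero => exact hf
    | succ k ih => rw [Function.iterate_succ_apply']; exact ih.D e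
  induction k with
  | zero => simp
  | succ k ih =>
    rw [iteratedDeriv_succ, ih, Function.iterate_succ_apply']
    funext t
    have h1 : HasDerivAt (fun t : ℝ => p + t • e) e t := by
      simpa using ((hasDerivAt_id t).smul_const e).const_add p
    exact ((hS k).diff _).hasFDerivAt.comp_hasDerivAt t h1 |>.deriv

noncomputable def c1 (n : ℕ) : ℝ := 1 / (4 * Cg n * Real.exp 1)

lemma c1_pos : 0 < c1 n := by
  have := Cg_pos (n := n)
  unfold c1; positivity

lemma c1_le : c1 n ≤ 1 / 4 := by
  have := Cg_pos (n := n)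
  have h2 : 1 ≤ Real.exp 1 := Real.one_le_exp (by norm_num)
  unfold c1
  apply one_div_le_one_div_of_le (by norm_num)
  nlinarith

lemma coef_le (C : ℝ) (hC : 0 ≤ C) (k : ℕ) : (C * k) ^ k / (k.factorial : ℝ) ≤ (C * Real.exp 1) ^ k := by
  have h := Real.pow_div_factorial_le_exp (x := (k:ℝ)) (by positivity) k
  rw [mul_pow, mul_div_assoc, mul_pow]
  gcongr
  rw [← Real.exp_nat_mul]; simpa using h

lemma line_ext {f : EE n → ℝ} (hf : Sm f) {p e : EE n} (he : ‖e‖ = 1) {R A : ℝ} (hR : 0 < R)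
    (h : ∀ x ∈ ball p R, lap f x = 0) (hA : ∀ x ∈ ball p R, |f x| ≤ A) :
    ∃ g : ℂ → ℂ, DifferentiableOn ℂ g (ball 0 (c1 n * R)) ∧ (∀ z ∈ ball (0:ℂ) (c1 n * R), ‖g z‖ ≤ 2 * A) ∧
      ∀ t : ℝ, |t| < c1 n * R → g t = f (p + t • e) := by
  have hA0 : 0 ≤ A := (abs_nonneg _).trans (hA p (mem_ball_self hR))
  have hC := Cg_pos (n := n)
  have hCR : 0 < Cg n * Real.exp 1 / R := by positivity
  have hq : c1 n * R * (Cg n * Real.exp 1 / R) = 1/4 := by unfold c1; field_simp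
  set a : ℕ → ℝ := fun k => (D e)^[k] f p / (k.factorial : ℝ) with ha
  have hak : ∀ k, |a k| ≤ (Cg n * Real.exp 1 / R) ^ k * A := by
    intro k
    have h1 := grad_iter hf hR h hA he.le k
    have h2 := coef_le (Cg n / R) (by positivity) k
    simp only [ha]
    rw [abs_div, Nat.abs_cast]
    have hk : (0:ℝ) < k.factorial := by positivity
    rw [div_le_iff₀ hk]
    rw [div_le_iff₀ hk] at h2
    calc _ ≤ _ := h1
      _ = (Cg n / R * k) ^ k * A := by congr 2; ring
      _ ≤ ((Cg n / R * Real.exp 1) ^ k * k.factorial) * A := by gcongr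
      _ = _ := by rw [show Cg n / R * Real.exp 1 = Cg n * Real.exp 1 / R by ring]; ring
  have hterm : ∀ k, ∀ z ∈ ball (0:ℂ) (c1 n * R), ‖(a k : ℂ) * z ^ k‖ ≤ A * (1/2) ^ k := by
    intro k z hz
    rw [mem_ball_zero_iff] at hz
    rw [norm_mul, norm_pow, Complex.norm_real]
    calc _ ≤ ((Cg n * Real.exp 1 / R) ^ k * A) * (c1 n * R) ^ k := by
            gcongr; exact hak k
      _ = A * (c1 n * R * (Cg n * Real.exp 1 / R)) ^ k := by rw [mul_pow]; ring
      _ ≤ _ := by rw [hq]; gcongr; norm_num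
  have hsum : Summable fun k : ℕ => A * (1/2:ℝ) ^ k := summable_geometric_two.mul_left A
  refine ⟨fun z => ∑' k, (a k : ℂ) * z ^ k, ?_, ?_, ?_⟩
  · exact Complex.differentiableOn_tsum_of_summable_norm hsum
      (fun k => by fun_prop) isOpen_ball hterm
  · intro z hz
    have := tsum_of_norm_bounded (hsum.hasSum) (fun k => hterm k z hz)
    rw [tsum_mul_left, tsum_geometric_two] at this
    linarith
  · intro t ht
    have htR : |t| ≤ R / 4 := by
      have := c1_le (n := n); nlinarith
    have htz : (t:ℂ) ∈ ball (0:ℂ) (c1 n * R) := by rw [mem_ball_zero_iff, Complex.norm_real]; exact ht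
    have hs : HasSum (fun k => (a k : ℂ) * (t:ℂ) ^ k) (∑' k, (a k : ℂ) * (t:ℂ) ^ k) := by
      apply Summable.hasSum
      exact Summable.of_norm_bounded hsum (fun k => hterm k _ htz)
    have h1 := hs.tendsto_sum_nat
    -- real Taylor
    have hT : ∀ m : ℕ, |f (p + t • e) - ∑ k ∈ Finset.range (m+1), a k * t ^ k| ≤ A * (1/2) ^ (m+1) := by
      intro m
      rcases eq_or_ne t 0 with h0 | h0
      · subst h0
        have : ∑ k ∈ Finset.range (m+1), a k * (0:ℝ) ^ k = f p := by
          rw [Finset.sum_range_succ']; simp [ha]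
        rw [this]; simp; positivity
      have hφ : ContDiff ℝ (⊤ : ℕ∞) (fun t : ℝ => f (p + t • e)) :=
        hf.comp (contDiff_const.add (contDiff_id.smul contDiff_const))
      obtain ⟨ξ, hξ, hξe⟩ := taylor_mean_remainder_lagrange_iteratedDeriv (f := fun t : ℝ => f (p + t • e)) (x := t) (x₀ := 0) (n := m) (Ne.symm h0) (hφ.of_le (by exact_mod_cast le_top)).contDiffOn
      have hξt : |ξ| ≤ |t| := by
        have : (0 < ξ ∧ ξ < t) ∨ (t < ξ ∧ ξ < 0) := by
          rcases lt_or_gt_of_ne h0 with h | h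
          · rw [uIoo_of_gt h] at hξ; exact Or.inr hξ
          · rw [uIoo_of_lt h] at hξ; exact Or.inl hξ
        rcases this with h | h
        · rw [abs_of_pos h.1, abs_of_pos (h.1.trans h.2)]; exact h.2.le
        · rw [abs_of_neg h.2, abs_of_neg (h.1.trans h.2)]; linarith [h.1]
      have hpoly : taylorWithinEval (fun t : ℝ => f (p + t • e)) m (uIcc 0 t) 0 t = ∑ k ∈ Finset.range (m+1), a k * t ^ k := by
        rw [taylor_within_apply]
        apply Finset.sum_congr rfl
        intro k hk
        rw [iteratedDerivWithin_eq_iteratedDeriv (uniqueDiffOn_uIcc (Ne.symm h0)) (hφ.of_le (by exact_mod_cast le_top)).contDiffAt left_mem_uIcc,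
          iter_deriv_line hf]
        simp [ha]; ring
      rw [hpoly, iter_deriv_line hf, sub_zero] at hξe
      rw [hξe]
      have hsub : ball (p + ξ • e) (R/2) ⊆ ball p R := by
        apply ball_subset_ball'
        rw [dist_eq_norm]
        simp [norm_smul, he]; linarith
      have g1 := grad_iter hf (p := p + ξ • e) (R := R/2) (A := A) (by positivity) (fun x hx => h x (hsub hx)) (fun x hx => hA x (hsub hx)) he.le (m+1)
      have g2 := coef_le (Cg n / (R/2)) (by positivity) (m+1)
      rw [abs_div, abs_mul, Nat.abs_cast, abs_pow]
      have hk : (0:ℝ) < (m+1).factorial := by positivity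
      rw [div_le_iff₀ hk] at g2 ⊢
      calc _ ≤ ((Cg n * (m+1 : ℕ) / (R/2)) ^ (m+1) * A) * (c1 n * R) ^ (m+1) := by gcongr
        _ = ((Cg n / (R/2) * (m+1 : ℕ)) ^ (m+1) * A) * (c1 n * R) ^ (m+1) := by congr 3; ring
        _ ≤ (((Cg n / (R/2) * Real.exp 1) ^ (m+1) * (m+1).factorial) * A) * (c1 n * R) ^ (m+1) := by
            have := c1_pos (n := n); gcongr
        _ = A * (2 * (c1 n * R * (Cg n * Real.exp 1 / R))) ^ (m+1) * (m+1).factorial := by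
            rw [show 2 * (c1 n * R * (Cg n * Real.exp 1 / R)) = (Cg n / (R/2) * Real.exp 1) * (c1 n * R) by field_simp, mul_pow]; ring
        _ = _ := by rw [hq]; norm_num
    have h2 : Filter.Tendsto (fun m => ∑ k ∈ Finset.range (m+1), a k * t ^ k) Filter.atTop (nhds (f (p + t • e))) := by
      rw [tendsto_iff_norm_sub_tendsto_zero]
      have h3 : Filter.Tendsto (fun m : ℕ => A * (1/2:ℝ) ^ (m+1)) Filter.atTop (nhds 0) := by
        have := ((tendsto_pow_atTop_nhds_zero_of_lt_one (r := (1/2:ℝ)) (by norm_num) (by norm_num)).comp (Filter.tendsto_add_atTop_nat 1)).const_mul A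
        simpa using this
      refine squeeze_zero (fun m => norm_nonneg _) (fun m => ?_) h3
      rw [norm_sub_rev]; exact hT m
    have h4 := h1.comp (Filter.tendsto_add_atTop_nat 1)
    have h5 : Filter.Tendsto (fun m => ((∑ k ∈ Finset.range (m+1), a k * t ^ k : ℝ) : ℂ)) Filter.atTop (nhds ((f (p + t • e) : ℝ) : ℂ)) :=
      (Complex.continuous_ofReal.tendsto _).comp h2
    refine tendsto_nhds_unique h4 (h5.congr fun m => ?_)
    simp [Function.comp]

end CW

namespace CW
variable {n : ℕ}

/-- second centre -/
lemma line_ext_second {f : EE n → ℝ} (hf : Sm f) {p e : EE n} (he : ‖e‖ = 1) {R : ℝ}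
    {g : ℂ → ℂ} (hg : DifferentiableOn ℂ g (ball 0 (c1 n * R)))
    (hgt : ∀ t : ℝ, |t| < c1 n * R → g t = f (p + t • e))
    {β R' A' : ℝ} (hβ : |β| < c1 n * R) (hR' : 0 < R') (h : ∀ x ∈ ball (p + β • e) R', lap f x = 0)
    (hA' : ∀ x ∈ ball (p + β • e) R', |f x| ≤ A') :
    ∀ z ∈ ball (0:ℂ) (c1 n * R) ∩ ball (β:ℂ) (c1 n * R'), ‖g z‖ ≤ 2 * A' := by
  obtain ⟨g₂, d2, b2, e2⟩ := line_ext hf he hR' h hA'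
  set U : Set ℂ := ball (0:ℂ) (c1 n * R) ∩ ball (β:ℂ) (c1 n * R') with hU
  have hUo : IsOpen U := isOpen_ball.inter isOpen_ball
  have hUc : IsPreconnected U := ((convex_ball _ _).inter (convex_ball _ _)).isPreconnected
  have hc := c1_pos (n := n)
  have hβU : (β:ℂ) ∈ U := ⟨by rw [mem_ball_zero_iff, Complex.norm_real]; exact hβ, mem_ball_self (by positivity)⟩
  have hm : ∀ z ∈ U, z - β ∈ ball (0:ℂ) (c1 n * R') := by
    intro z hz; have := hz.2; rw [mem_ball, dist_eq_norm] at this; rwa [mem_ball_zero_iff]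
  have A1 : AnalyticOnNhd ℂ g U := (hg.mono inter_subset_left).analyticOnNhd hUo
  have A2 : AnalyticOnNhd ℂ (fun z => g₂ (z - β)) U := by
    apply DifferentiableOn.analyticOnNhd _ hUo
    exact d2.comp (by fun_prop) hm
  have hfreq : ∃ᶠ z in nhdsWithin (β:ℂ) {(β:ℂ)}ᶜ, g z = g₂ (z - β) := by
    have hev : ∀ᶠ t : ℝ in nhds β, (t:ℂ) ∈ U := by
      have : Filter.Tendsto (fun t : ℝ => (t:ℂ)) (nhds β) (nhds (β:ℂ)) := Complex.continuous_ofReal.tendsto _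
      exact this.eventually (hUo.mem_nhds hβU)
    have hev2 : ∀ᶠ t : ℝ in nhdsWithin β {β}ᶜ, g t = g₂ ((t:ℂ) - β) := by
      filter_upwards [nhdsWithin_le_nhds hev] with t ht
      have h1 : |t| < c1 n * R := by have := ht.1; rwa [mem_ball_zero_iff, Complex.norm_real] at this
      have h2 : |t - β| < c1 n * R' := by
        have := hm _ ht
        rw [mem_ball_zero_iff, ← Complex.ofReal_sub, Complex.norm_real] at this; exact this
      rw [hgt t h1, ← Complex.ofReal_sub, e2 _ h2]
      congr 2
      rw [sub_smul]; abel
    have htend : Filter.Tendsto (fun t : ℝ => (t:ℂ)) (nhdsWithin β {β}ᶜ) (nhdsWithin (β:ℂ) {(β:ℂ)}ᶜ) := by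
      apply tendsto_nhdsWithin_of_tendsto_nhds_of_eventually_within
      · exact (Complex.continuous_ofReal.tendsto _).mono_left nhdsWithin_le_nhds
      · filter_upwards [self_mem_nhdsWithin] with t ht
        intro hh; apply ht; exact Complex.ofReal_injective hh
    exact htend.frequently hev2.frequently
  have := A1.eqOn_of_preconnected_of_frequently_eq A2 hUc hβU hfreq
  intro z hz
  rw [this hz]
  exact b2 _ (hm z hz)

lemma two_disc {g : ℂ → ℂ} {Λ β s A₁ A₂ A₃ B t : ℝ} {a b : ℕ} (hs : 0 < s) (hsβ : 8 * s ≤ β) (hβ : 2 * β ≤ Λ)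
    (hg : DifferentiableOn ℂ g (ball 0 (2 * Λ))) (h1 : ∀ z ∈ closedBall (0:ℂ) s, ‖g z‖ ≤ A₁)
    (h2 : ∀ z ∈ closedBall (β:ℂ) s, ‖g z‖ ≤ A₂) (h3 : ∀ z ∈ closedBall (0:ℂ) Λ, ‖g z‖ ≤ A₃)
    (ht : β / 4 ≤ t) (ht' : t ≤ 3 * β / 4)
    (hB1 : 2 ^ (a+b) * A₁ * (β / s) ^ a ≤ B) (hB2 : 2 ^ (a+b) * A₂ * (β / s) ^ b ≤ B)
    (hB3 : 2 ^ (a+b) * A₃ * (β / Λ) ^ (a+b) ≤ B) : ‖g t‖ ≤ B := by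
  have hβ0 : 0 < β := by linarith
  have hΛ : 0 < Λ := by linarith
  have hA1 : 0 ≤ A₁ := (norm_nonneg _).trans (h1 0 (mem_closedBall_self hs.le))
  have hA2 : 0 ≤ A₂ := (norm_nonneg _).trans (h2 β (mem_closedBall_self hs.le))
  have hA3 : 0 ≤ A₃ := (norm_nonneg _).trans (h3 0 (mem_closedBall_self hΛ.le))
  set K : Set ℂ := {z | ‖z‖ ≤ Λ ∧ s ≤ ‖z‖ ∧ s ≤ ‖z - β‖} with hK
  set U : Set ℂ := {z | ‖z‖ < Λ ∧ s < ‖z‖ ∧ s < ‖z - β‖} with hU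
  have hUo : IsOpen U := by
    exact (isOpen_lt continuous_norm continuous_const).inter ((isOpen_lt continuous_const continuous_norm).inter
      (isOpen_lt continuous_const (continuous_norm.comp (continuous_id.sub continuous_const))))
  have hKc : IsClosed K := by
    exact (isClosed_le continuous_norm continuous_const).inter ((isClosed_le continuous_const continuous_norm).inter
      (isClosed_le continuous_const (continuous_norm.comp (continuous_id.sub continuous_const))))
  have hUK : U ⊆ K := fun z hz => ⟨hz.1.le, hz.2.1.le, hz.2.2.le⟩
  have hclK : closure U ⊆ K := closure_minimal hUK hKc
  have hUb : Bornology.IsBounded U := by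
    apply (isBounded_ball (x := (0:ℂ)) (r := Λ)).subset
    intro z hz; rw [mem_ball_zero_iff]; exact hz.1
  set hh : ℂ → ℂ := fun z => g z / (z ^ a * (z - β) ^ b) with hhh
  have hne : ∀ z ∈ K, z ^ a * (z - β) ^ b ≠ 0 := by
    intro z hz
    apply mul_ne_zero <;> apply pow_ne_zero
    · exact norm_pos_iff.1 (hs.trans_le hz.2.1)
    · exact norm_pos_iff.1 (hs.trans_le hz.2.2)
  have hdiff : DifferentiableOn ℂ hh K := by
    apply DifferentiableOn.div
    · apply hg.mono; intro z hz; rw [mem_ball_zero_iff]; linarith [hz.1]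
    · fun_prop
    · exact hne
  have hdc : DiffContOnCl ℂ hh U := ⟨hdiff.mono hUK, (hdiff.mono hclK).continuousOn⟩
  have hfr : ∀ z ∈ frontier U, ‖hh z‖ ≤ B / β ^ (a+b) := by
    intro z hz
    have hzK : z ∈ K := hclK hz.1
    have hzU : z ∉ U := by rw [hUo.interior_eq.symm]; exact hz.2
    have hcase : ‖z‖ = Λ ∨ ‖z‖ = s ∨ ‖z - β‖ = s := by
      by_contra hcon
      push Not at hcon
      exact hzU ⟨lt_of_le_of_ne hzK.1 hcon.1, lt_of_le_of_ne hzK.2.1 (Ne.symm hcon.2.1), lt_of_le_of_ne hzK.2.2 (Ne.symm hcon.2.2)⟩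
    have hnβ : ‖(β:ℂ)‖ = β := by rw [Complex.norm_real, Real.norm_of_nonneg hβ0.le]
    -- lower bound of denominators
    have fin : ∀ A r₁ r₂ : ℝ, 0 ≤ A → 0 < r₁ → 0 < r₂ → r₁ ≤ ‖z‖ → r₂ ≤ ‖z - β‖ → ‖g z‖ ≤ A →
        A * (β / r₁) ^ a * (β / r₂) ^ b ≤ B → ‖hh z‖ ≤ B / β ^ (a+b) := by
      intro A r₁ r₂ hA hr₁ hr₂ hz1 hz2 hgz hAB
      rw [hhh]
      simp only [norm_div, norm_mul, norm_pow]
      rw [le_div_iff₀ (by positivity)]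
      refine le_trans ?_ hAB
      calc _ ≤ A / (r₁ ^ a * r₂ ^ b) * β ^ (a+b) := by gcongr
        _ = _ := by rw [pow_add, div_pow, div_pow]; field_simp
    have p2a : ∀ x : ℝ, 0 ≤ x → 2 ^ b * x ≤ 2 ^ (a+b) * x := by
      intro x hx; gcongr <;> norm_num
    have p2b : ∀ x : ℝ, 0 ≤ x → 2 ^ a * x ≤ 2 ^ (a+b) * x := by
      intro x hx; gcongr <;> norm_num
    rcases hcase with hz1 | hz1 | hz1
    · have hlow : Λ / 2 ≤ ‖z - β‖ := by
        have := norm_sub_norm_le z (β:ℂ); rw [hnβ, hz1] at this; linarith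
      refine fin A₃ Λ (Λ/2) hA3 hΛ (by positivity) hz1.ge hlow (h3 z (by rw [mem_closedBall_zero_iff]; exact hzK.1)) ?_
      refine le_trans ?_ hB3
      calc A₃ * (β / Λ) ^ a * (β / (Λ/2)) ^ b = 2 ^ b * (A₃ * (β / Λ) ^ (a+b)) := by
            rw [show β / (Λ/2) = 2 * (β / Λ) by field_simp, mul_pow, pow_add]; ring
        _ ≤ _ := p2a _ (by positivity)
        _ = _ := by ring
    · have hlow : β / 2 ≤ ‖z - β‖ := by
        have := norm_sub_norm_le (β:ℂ) z; rw [hnβ, hz1, norm_sub_rev] at this; linarith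
      refine fin A₁ s (β/2) hA1 hs (by positivity) hz1.ge hlow (h1 z (by rw [mem_closedBall_zero_iff]; exact hz1.le)) ?_
      refine le_trans ?_ hB1
      calc A₁ * (β / s) ^ a * (β / (β/2)) ^ b = 2 ^ b * (A₁ * (β / s) ^ a) := by
            rw [show β / (β/2) = 2 by field_simp]; ring
        _ ≤ _ := p2a _ (by positivity)
        _ = _ := by ring
    · have hlow : β / 2 ≤ ‖z‖ := by
        have := norm_sub_norm_le (β:ℂ) (β - z); rw [hnβ, norm_sub_rev, hz1, _root_.sub_sub_cancel] at this; linarith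
      refine fin A₂ (β/2) s hA2 (by positivity) hs hlow hz1.ge (h2 z (by rw [mem_closedBall, dist_eq_norm]; exact hz1.le)) ?_
      refine le_trans ?_ hB2
      calc A₂ * (β / (β/2)) ^ a * (β / s) ^ b = 2 ^ a * (A₂ * (β / s) ^ b) := by
            rw [show β / (β/2) = 2 by field_simp]; ring
        _ ≤ _ := p2b _ (by positivity)
        _ = _ := by ring
  have ht0 : 0 < t := by linarith
  have hn1 : ‖(t:ℂ)‖ = t := by rw [Complex.norm_real, Real.norm_of_nonneg ht0.le]
  have hn2 : ‖(t:ℂ) - β‖ = β - t := by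
    rw [← Complex.ofReal_sub, Complex.norm_real, Real.norm_eq_abs, abs_sub_comm, abs_of_nonneg (by linarith)]
  have htU : (t:ℂ) ∈ U := ⟨by rw [hn1]; linarith, by rw [hn1]; linarith, by rw [hn2]; linarith⟩
  have hmax := Complex.norm_le_of_forall_mem_frontier_norm_le hUb hdc hfr (subset_closure htU)
  rw [hhh] at hmax
  simp only [norm_div, norm_mul, norm_pow, hn1, hn2] at hmax
  rw [div_le_div_iff₀ (by have : 0 < β - t := by linarith
                          positivity) (by positivity)] at hmax
  have hB0 : 0 ≤ B := le_trans (by positivity) hB3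
  have : t ^ a * (β - t) ^ b ≤ β ^ (a+b) := by
    rw [pow_add]
    have : 0 ≤ β - t := by linarith
    gcongr <;> linarith
  have h5 : ‖g t‖ * β ^ (a+b) ≤ B * β ^ (a+b) := hmax.trans (by gcongr)
  exact le_of_mul_le_mul_right h5 (by positivity)

lemma two_point {f : EE n → ℝ} (hf : Sm f) {p e : EE n} (he : ‖e‖ = 1) {R ρ β A₁ A₂ A₃ B t : ℝ} {a b : ℕ}
    (hρ : 0 < ρ) (hρβ : 4 * c1 n * ρ ≤ β) (hβR : 4 * β ≤ c1 n * R)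
    (h : ∀ x ∈ ball p R, lap f x = 0)
    (h1 : ∀ x ∈ ball p ρ, |f x| ≤ A₁) (h2 : ∀ x ∈ ball (p + β • e) ρ, |f x| ≤ A₂) (h3 : ∀ x ∈ ball p R, |f x| ≤ A₃)
    (ht : β / 4 ≤ t) (ht' : t ≤ 3 * β / 4)
    (hB1 : 2 ^ (a+b) * (2 * A₁) * (2 * β / (c1 n * ρ)) ^ a ≤ B) (hB2 : 2 ^ (a+b) * (2 * A₂) * (2 * β / (c1 n * ρ)) ^ b ≤ B)
    (hB3 : 2 ^ (a+b) * (2 * A₃) * (2 * β / (c1 n * R)) ^ (a+b) ≤ B) : |f (p + t • e)| ≤ B := by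
  have hc := c1_pos (n := n)
  have hc1 := c1_le (n := n)
  have hβ0 : 0 < β := lt_of_lt_of_le (by positivity) hρβ
  have hcR : 0 < c1 n * R := by linarith
  have hR : 0 < R := pos_of_mul_pos_right hcR hc.le
  obtain ⟨g, hg, hgb, hgt⟩ := line_ext hf he hR h h3
  have hρR : c1 n * ρ ≤ c1 n * R := by linarith
  have hρR' : ρ ≤ R := le_of_mul_le_mul_left hρR hc
  have h0 := line_ext_second hf he hg hgt (β := 0) (R' := ρ) (A' := A₁) (by simpa using hcR) hρ
    (fun x hx => h x (by simp only [zero_smul, add_zero] at hx; exact ball_subset_ball hρR' hx)) (by simpa using h1)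
  have hβ1 := line_ext_second hf he hg hgt (β := β) (R' := ρ) (A' := A₂) (by rw [abs_of_pos hβ0]; linarith) hρ
    (fun x hx => h x (by
      refine ball_subset_ball' ?_ hx
      rw [dist_eq_norm]; simp [norm_smul, he, abs_of_pos hβ0]
      have : c1 n * ρ ≤ 1/4 * (β / (4 * c1 n) * (4 * c1 n)) := by
        rw [div_mul_cancel₀ _ (by positivity)]; linarith
      have e3 : ρ ≤ β / (4 * c1 n) := by rw [le_div_iff₀ (by positivity)]; linarith
      have e4 : 4 * (β / c1 n) ≤ R := by rw [← mul_div_assoc, div_le_iff₀ hc]; linarith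
      have e5 : β ≤ β / c1 n := by rw [le_div_iff₀ hc]; nlinarith
      have e6 : β / (4 * c1 n) = (β / c1 n) / 4 := by field_simp
      linarith)) h2
  have := two_disc (g := g) (Λ := c1 n * R / 2) (β := β) (s := c1 n * ρ / 2) (A₁ := 2 * A₁) (A₂ := 2 * A₂) (A₃ := 2 * A₃) (B := B) (t := t) (a := a) (b := b)
    (by positivity) (by linarith) (by linarith) (by convert hg using 2; ring) ?_ ?_ ?_ ht ht' ?_ ?_ ?_
  · rw [hgt t (by rw [abs_of_nonneg (by linarith)]; linarith), Complex.norm_real] at this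
    exact this
  · intro z hz
    rw [mem_closedBall_zero_iff] at hz
    have : 0 < c1 n * ρ := by positivity
    apply h0
    refine ⟨by rw [mem_ball_zero_iff]; linarith, ?_⟩
    simp; linarith
  · intro z hz
    rw [mem_closedBall, dist_eq_norm] at hz
    have : 0 < c1 n * ρ := by positivity
    apply hβ1
    refine ⟨?_, by rw [mem_ball, dist_eq_norm]; linarith⟩
    rw [mem_ball_zero_iff]
    have e1 := norm_add_le (z - β) (β:ℂ)
    rw [sub_add_cancel, Complex.norm_real, Real.norm_of_nonneg hβ0.le] at e1
    linarith
  · intro z hz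
    rw [mem_closedBall_zero_iff] at hz
    apply hgb; rw [mem_ball_zero_iff]; linarith
  · convert hB1 using 3; field_simp
  · convert hB2 using 3; field_simp
  · convert hB3 using 3; field_simp

end CW

namespace CW
variable {n : ℕ}

lemma lap_congr {f g : EE n → ℝ} {x : EE n} (h : f =ᶠ[nhds x] g) : lap f x = lap g x := by
  unfold lap D
  refine Finset.sum_congr rfl fun i _ => ?_
  have h2 : (fun y => fderiv ℝ f y (ev i)) =ᶠ[nhds x] (fun y => fderiv ℝ g y (ev i)) := by
    filter_upwards [h.fderiv (𝕜 := ℝ)] with y hy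
    rw [hy]
  rw [h2.fderiv_eq]

lemma D_comp_inner (χ : ℝ → ℝ) (hχ : ContDiff ℝ (⊤ : ℕ∞) χ) (p e v : EE n) (ρ : ℝ) :
    D v (fun x => χ (inner ℝ (x - p) e / ρ)) = fun x => (inner ℝ v e / ρ) * deriv χ (inner ℝ (x - p) e / ρ) := by
  funext x
  unfold D
  have h1 : HasFDerivAt (fun x : EE n => inner ℝ (x - p) e / ρ) (ρ⁻¹ • innerSL ℝ e) x := by
    have : (fun x : EE n => inner ℝ (x - p) e / ρ) = fun x => (ρ⁻¹ • innerSL ℝ e) x - inner ℝ p e / ρ := by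
      funext y
      rw [inner_sub_left]; simp [real_inner_comm e]; ring
    rw [this]
    exact (ContinuousLinearMap.hasFDerivAt _).sub_const _
  have h2 : HasDerivAt χ (deriv χ (inner ℝ (x - p) e / ρ)) (inner ℝ (x - p) e / ρ) :=
    (hχ.differentiable (by simp) _).hasDerivAt
  have h3 := h2.comp_hasFDerivAt x h1
  have : fderiv ℝ (fun x => χ (inner ℝ (x - p) e / ρ)) x = _ := h3.fderiv
  rw [this]
  simp [real_inner_comm e]; ring

lemma Sm_comp_inner (χ : ℝ → ℝ) (hχ : ContDiff ℝ (⊤ : ℕ∞) χ) (p e : EE n) (ρ : ℝ) :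
    Sm (fun x => χ (inner ℝ (x - p) e / ρ)) := by
  apply hχ.comp
  apply ContDiff.div_const
  exact (contDiff_id.sub contDiff_const).inner ℝ contDiff_const

lemma sum_inner_ev (e : EE n) (he : ‖e‖ = 1) : ∑ i, inner ℝ (ev i) e * inner ℝ (ev i) e = (1:ℝ) := by
  have : ∀ i : Fin n, inner ℝ (ev i) e = e i := by
    intro i; unfold ev; rw [EuclideanSpace.inner_single_left]; simp
  simp only [this]
  have h := EuclideanSpace.norm_sq_eq e
  rw [he] at h
  simp at h
  rw [h]; refine Finset.sum_congr rfl fun i _ => by ring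

lemma lap_cut (χ : ℝ → ℝ) (hχ : ContDiff ℝ (⊤ : ℕ∞) χ) (p e : EE n) (he : ‖e‖ = 1) (ρ : ℝ) {f : EE n → ℝ} (hf : Sm f) (x : EE n) :
    lap (fun x => χ (inner ℝ (x - p) e / ρ) * f x) x = χ (inner ℝ (x - p) e / ρ) * lap f x
      + 2 * (deriv χ (inner ℝ (x - p) e / ρ) / ρ) * D e f x + f x * (deriv (deriv χ) (inner ℝ (x - p) e / ρ) / ρ ^ 2) := by
  have hψ := Sm_comp_inner χ hχ p e ρ
  have hχ' : ContDiff ℝ (⊤ : ℕ∞) (deriv χ) := by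
    have := (contDiff_infty_iff_deriv (𝕜 := ℝ) (f := χ)).1 hχ
    exact this.2
  have key : ∀ i : Fin n, D (ev i) (D (ev i) (fun x => χ (inner ℝ (x - p) e / ρ) * f x)) x =
      χ (inner ℝ (x - p) e / ρ) * D (ev i) (D (ev i) f) x
      + 2 * (deriv χ (inner ℝ (x - p) e / ρ) / ρ) * (inner ℝ (ev i) e * D (ev i) f x)
      + f x * (deriv (deriv χ) (inner ℝ (x - p) e / ρ) / ρ ^ 2) * (inner ℝ (ev i) e * inner ℝ (ev i) e) := by
    intro i
    rw [D_mul hψ hf]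
    have e1 : (fun x => χ (inner ℝ (x - p) e / ρ) * D (ev i) f x + f x * D (ev i) (fun x => χ (inner ℝ (x - p) e / ρ)) x)
        = fun x => χ (inner ℝ (x - p) e / ρ) * D (ev i) f x - (-1 : ℝ) * (f x * D (ev i) (fun x => χ (inner ℝ (x - p) e / ρ)) x) := by
      funext y; ring
    rw [e1, D_sub (hψ.mul (hf.D _)) (contDiff_const.mul (hf.mul (hψ.D _))), D_const_mul (hf.mul (hψ.D _)), D_mul hψ (hf.D _), D_mul hf (hψ.D _), D_comp_inner χ hχ]
    rw [D_const_mul (Sm_comp_inner _ hχ' p e ρ), D_comp_inner _ hχ']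
    simp only
    ring
  have h2 : D e f x = ∑ i, inner ℝ (ev i) e * D (ev i) f x := by
    unfold D
    have := fderiv_eq_sum f x e
    rw [this]
    refine Finset.sum_congr rfl fun i _ => ?_
    unfold ev D; rw [EuclideanSpace.inner_single_left]; simp
  unfold lap
  simp only [key]
  rw [Finset.sum_add_distrib, Finset.sum_add_distrib, ← Finset.mul_sum, ← Finset.mul_sum, ← Finset.mul_sum, ← h2, sum_inner_ev e he, mul_one]

noncomputable def chi (s : ℝ) : ℝ := Real.smoothTransition (2 * s - 1/2)

lemma chi_smooth : ContDiff ℝ (⊤ : ℕ∞) chi := by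
  unfold chi
  exact Real.smoothTransition.contDiff.comp (by fun_prop)

lemma chi_zero {s : ℝ} (h : s ≤ 1/4) : chi s = 0 := Real.smoothTransition.zero_of_nonpos (by linarith)
lemma chi_one {s : ℝ} (h : 3/4 ≤ s) : chi s = 1 := Real.smoothTransition.one_of_one_le (by linarith)
lemma chi_abs (s : ℝ) : |chi s| ≤ 1 := by
  unfold chi; rw [abs_of_nonneg (Real.smoothTransition.nonneg _)]; exact Real.smoothTransition.le_one _

lemma chi_bdd : ∃ C : ℝ, 0 < C ∧ ∀ s ∈ Icc (1/4 : ℝ) (3/4), |deriv chi s| ≤ C ∧ |deriv (deriv chi) s| ≤ C := by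
  have h1 : Continuous (deriv chi) := chi_smooth.continuous_deriv (by simp)
  have hχ' : ContDiff ℝ (⊤ : ℕ∞) (deriv chi) := ((contDiff_infty_iff_deriv (𝕜 := ℝ) (f := chi)).1 chi_smooth).2
  have h2 : Continuous (deriv (deriv chi)) := hχ'.continuous_deriv (by simp)
  obtain ⟨C1, hC1⟩ := (isCompact_Icc (a := (1/4:ℝ)) (b := 3/4)).exists_bound_of_continuousOn h1.continuousOn
  obtain ⟨C2, hC2⟩ := (isCompact_Icc (a := (1/4:ℝ)) (b := 3/4)).exists_bound_of_continuousOn h2.continuousOn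
  refine ⟨max 1 (max C1 C2), by positivity, fun s hs => ⟨?_, ?_⟩⟩
  · exact (hC1 s hs).trans ((le_max_left _ _).trans (le_max_right _ _))
  · exact (hC2 s hs).trans ((le_max_right _ _).trans (le_max_right _ _))

lemma inner_le_of_norm {x e : EE n} (he : ‖e‖ = 1) : |inner ℝ x e| ≤ ‖x‖ := by
  have := abs_real_inner_le_norm x e
  rwa [he, mul_one] at this

lemma lap_w (n : ℕ) : ∃ C : ℝ, 0 < C ∧ ∀ (f : EE n → ℝ), Sm f → ∀ (p e : EE n), ‖e‖ = 1 → ∀ r ρ δ' : ℝ, 0 < ρ → ρ ≤ r →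
    (∀ x ∈ ball p r, lap f x = 0) → (∀ x ∈ ball p r, |inner ℝ (x - p) e| ≤ ρ → |f x| ≤ δ') → 0 ≤ δ' →
    ∀ x ∈ ball p (r / 2), |lap (fun x => chi (inner ℝ (x - p) e / ρ) * f x) x| ≤ C * δ' / ρ ^ 2 := by
  obtain ⟨C, hC, hb⟩ := chi_bdd
  have hCg := Cg_pos (n := n)
  refine ⟨C * (8 * Cg n + 1), by positivity, ?_⟩
  intro f hf p e he r ρ δ' hρ hρr hh hs hδ x hx
  have hcont : Continuous (fun x : EE n => inner ℝ (x - p) e / ρ) := by fun_prop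
  have hR0 : 0 ≤ C * (8 * Cg n + 1) * δ' / ρ ^ 2 := by positivity
  rcases lt_or_ge (inner ℝ (x - p) e / ρ) (1/4) with h1 | h1
  · have : (fun x => chi (inner ℝ (x - p) e / ρ) * f x) =ᶠ[nhds x] fun _ => 0 := by
      filter_upwards [hcont.continuousAt.eventually_lt_const h1] with y hy
      rw [chi_zero hy.le, zero_mul]
    rw [lap_congr this]
    have : lap (fun _ : EE n => (0:ℝ)) x = 0 := by unfold lap D; simp
    rw [this]; simpa using hR0
  rcases lt_or_ge (3/4) (inner ℝ (x - p) e / ρ) with h2 | h2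
  · have : (fun x => chi (inner ℝ (x - p) e / ρ) * f x) =ᶠ[nhds x] f := by
      filter_upwards [hcont.continuousAt.eventually_const_lt h2] with y hy
      rw [chi_one hy.le, one_mul]
    rw [lap_congr this, hh x (ball_subset_ball (by linarith) hx)]; simpa using hR0
  have hsub : ∀ z ∈ ball x (ρ/4), z ∈ ball p r ∧ |inner ℝ (z - p) e| ≤ ρ := by
    intro z hz
    rw [mem_ball, dist_eq_norm] at hz hx
    constructor
    · rw [mem_ball, dist_eq_norm]
      have := norm_sub_le_norm_sub_add_norm_sub z x p
      linarith
    · have e1 := inner_le_of_norm (x := z - x) he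
      have e2 : inner ℝ (z - p) e = inner ℝ (z - x) e + inner ℝ (x - p) e := by rw [← inner_add_left]; congr 1; abel
      rw [le_div_iff₀ hρ] at h1
      rw [div_le_iff₀ hρ] at h2
      rw [abs_le] at e1 ⊢
      constructor <;> linarith [e1.1, e1.2]
  have hx' : x ∈ ball x (ρ/4) := mem_ball_self (by positivity)
  have hg := grad hf (p := x) (R := ρ/4) (A := δ') (by positivity) (fun z hz => hh z (hsub z hz).1)
    (fun z hz => hs z (hsub z hz).1 (hsub z hz).2) he.le
  have hf' := hs x (hsub x hx').1 (hsub x hx').2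
  rw [lap_cut chi chi_smooth p e he ρ hf, hh x (hsub x hx').1, mul_zero, zero_add]
  obtain ⟨b1, b2⟩ := hb _ ⟨h1, h2⟩
  calc _ ≤ |2 * (deriv chi (inner ℝ (x - p) e / ρ) / ρ) * D e f x| + |f x * (deriv (deriv chi) (inner ℝ (x - p) e / ρ) / ρ ^ 2)| := abs_add_le _ _
    _ = 2 * (|deriv chi (inner ℝ (x - p) e / ρ)| / ρ) * |D e f x| + |f x| * (|deriv (deriv chi) (inner ℝ (x - p) e / ρ)| / ρ ^ 2) := by
        simp only [abs_mul, abs_div, abs_pow, abs_of_pos hρ]; norm_num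
    _ ≤ 2 * (C / ρ) * (Cg n / (ρ/4) * δ') + δ' * (C / ρ ^ 2) := by gcongr
    _ = _ := by field_simp; ring

lemma half_est (n : ℕ) : ∃ C : ℝ, 0 < C ∧ ∀ (f : EE n → ℝ), Sm f → ∀ (p e : EE n), ‖e‖ = 1 → ∀ r ρ δ' A : ℝ, 0 < ρ → ρ ≤ r →
    (∀ x ∈ ball p r, lap f x = 0) → (∀ x ∈ ball p r, |inner ℝ (x - p) e| ≤ ρ → |f x| ≤ δ') → 0 ≤ δ' →
    (∀ x ∈ ball p r, |f x| ≤ A) → 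
    ∀ z ∈ ball p (r / 64), ∫ y, (chi (inner ℝ (z + (r/64) • y - p) e / ρ) * f (z + (r/64) • y)) ^ 2 * ph y ^ 2 ≤ C * (δ' * A * (r / ρ) ^ 2) := by
  obtain ⟨C, hC, hb⟩ := lap_w n
  have hI : 0 < ∫ y : EE n, ph y ^ 3 := ph_integ_pos 2
  refine ⟨(7/16)⁻¹ ^ 2 * 8 ^ n * (Real.log 2 * (2 / 16 * C * ∫ y : EE n, ph y ^ 3)), by
    have := Real.log_pos (x := 2) (by norm_num); positivity, ?_⟩
  intro f hf p e he r ρ δ' A hρ hρr hh hs hδ hA z hz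
  have hr : 0 < r := by linarith
  set w : EE n → ℝ := fun x => chi (inner ℝ (x - p) e / ρ) * f x with hw
  have hA0 : 0 ≤ A := (abs_nonneg _).trans (hA p (mem_ball_self hr))
  have hws : Sm w := (Sm_comp_inner chi chi_smooth p e ρ).mul hf
  have hwA : ∀ x ∈ ball p r, |w x| ≤ A := by
    intro x hx
    rw [hw]; simp only [abs_mul]
    calc _ ≤ 1 * A := mul_le_mul (chi_abs _) (hA x hx) (abs_nonneg _) zero_le_one
      _ = A := one_mul _
  have hwl := hb f hf p e he r ρ δ' hρ hρr hh hs hδ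
  set x0 := p - (r/16) • e with hx0
  have hx0p : ‖x0 - p‖ = r/16 := by
    rw [hx0, _root_.sub_sub_cancel_left, norm_neg, norm_smul, he, mul_one, Real.norm_of_nonneg (by positivity)]
  have hsub : ∀ y ∈ ball (0 : EE n) (r/4), x0 + y ∈ ball p (r/2) := by
    intro y hy
    rw [mem_ball_zero_iff] at hy
    rw [mem_ball, dist_eq_norm]
    have : x0 + y - p = (x0 - p) + y := by abel
    rw [this]
    have := norm_add_le (x0 - p) y
    linarith
  have hga := G_approx (f := fun y => w (x0 + y)) (g := fun y => w (x0 + y)) (hws.trans x0) (hws.trans x0) (R := r/4) (Mf := A) (Mg := A)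
    (ef := C * δ' / ρ ^ 2) (eg := C * δ' / ρ ^ 2) (fun y hy => hwA _ (ball_subset_ball (by linarith) (hsub y hy)))
    (fun y hy => hwA _ (ball_subset_ball (by linarith) (hsub y hy)))
    (fun y hy => by rw [lap_trans]; exact hwl _ (hsub y hy)) (fun y hy => by rw [lap_trans]; exact hwl _ (hsub y hy))
    (a := r/16) (b := r/4) (t := Real.log 2) (by positivity) (by positivity) (Real.log_nonneg (by norm_num))
    (by rw [Real.exp_log (by norm_num)]; linarith) le_rfl
  rw [Real.exp_neg, Real.exp_log (by norm_num), show r/16*2 = r/8 by ring, show r/4*2⁻¹ = r/8 by ring] at hga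
  have hG0 : G (fun y => w (x0 + y)) (fun y => w (x0 + y)) (r/16) (r/4) = 0 := by
    unfold G
    apply integral_eq_zero_of_ae
    refine Filter.Eventually.of_forall fun y => ?_
    by_cases hy : ph y = 0
    · simp [hy]
    · have hy1 := norm_lt_of_ph hy
      have : w (x0 + (r/16) • y) = 0 := by
        rw [hw]; simp only
        rw [chi_zero, zero_mul]
        have e2 : inner ℝ (x0 + (r/16) • y - p) e = -(r/16) + (r/16) * inner ℝ y e := by
          have : x0 + (r/16) • y - p = (-(r/16)) • e + (r/16) • y := by rw [hx0, neg_smul]; abel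
          rw [this, inner_add_left, inner_smul_left, inner_smul_left, real_inner_self_eq_norm_sq, he]; simp
        have e3 := (le_abs_self _).trans (inner_le_of_norm (x := y) he)
        have : inner ℝ (x0 + (r/16) • y - p) e ≤ 0 := by rw [e2]; nlinarith
        have := div_nonpos_of_nonpos_of_nonneg this hρ.le
        linarith
      simp [this]
  rw [hG0, sub_zero] at hga
  have hga2 := (le_abs_self _).trans hga
  have hn : n ≠ 0 := by
    rintro rfl
    have : e = 0 := Subsingleton.elim _ _
    rw [this] at he; simp at he
  have hn' : (0:ℝ) < n := by positivity
  set F : Fam n := fun _ => w with hF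
  have hnF : ∀ x, nF F x ^ 2 = n * w x ^ 2 := by intro x; rw [nF_sq]; simp [hF]
  have hac := avg_compare (F := F) (fun _ => hws) (x := x0) (z := z) (t := r/64) (s := r/8) (κ := 7/16) (by positivity) (by positivity) (by norm_num) (by
    intro y hy
    unfold ph
    apply le_max_of_le_left
    have : ‖(r/8)⁻¹ • ((z - x0) + (r/64) • y)‖ ≤ 3/4 := by
      rw [norm_smul, Real.norm_of_nonneg (by positivity)]
      rw [mem_ball, dist_eq_norm] at hz
      have e1 := norm_add_le (z - x0) ((r/64) • y)
      rw [norm_smul, Real.norm_of_nonneg (by positivity)] at e1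
      have e2 := norm_sub_le_norm_sub_add_norm_sub z p x0
      rw [norm_sub_rev p x0, hx0p] at e2
      have : ‖(z - x0) + (r/64) • y‖ ≤ (r/8) * (3/4) := by nlinarith
      calc _ ≤ (r/8)⁻¹ * ((r/8) * (3/4)) := by gcongr
        _ = _ := by field_simp
    have h0 := norm_nonneg ((r/8)⁻¹ • ((z - x0) + (r/64) • y))
    nlinarith)
  rw [H_eq (F := F) (fun _ => hws)] at hac
  simp only [hnF, mul_assoc] at hac
  rw [integral_const_mul, integral_const_mul] at hac
  have hac2 : ∫ y, w (z + (r/64) • y) ^ 2 * ph y ^ 2 ≤ (7/16)⁻¹ ^ 2 * 8 ^ n * ∫ y, w (x0 + (r/8) • y) ^ 2 * ph y ^ 2 := by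
    have : r / 8 / (r/64) = 8 := by field_simp; norm_num
    rw [this] at hac
    apply le_of_mul_le_mul_left _ hn'
    linarith
  refine hac2.trans ?_
  have e5 : ∫ y, w (x0 + (r/8) • y) ^ 2 * ph y ^ 2 = G (fun y => w (x0 + y)) (fun y => w (x0 + y)) (r/8) (r/8) := by
    unfold G; congr 1; funext y; ring
  rw [e5]
  calc _ ≤ (7/16)⁻¹ ^ 2 * 8 ^ n * (Real.log 2 * ((r/4) ^ 2 * (A * (C * δ' / ρ ^ 2) + A * (C * δ' / ρ ^ 2)) * ∫ y : EE n, ph y ^ 3)) := by gcongr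
    _ = _ := by field_simp; ring

lemma slab (n : ℕ) : ∃ C : ℝ, 0 < C ∧ ∀ (f : EE n → ℝ), Sm f → ∀ (p e : EE n), ‖e‖ = 1 → ∀ r ρ δ' A : ℝ, 0 < ρ → ρ ≤ r →
    (∀ x ∈ ball p r, lap f x = 0) → (∀ x ∈ ball p r, |inner ℝ (x - p) e| ≤ ρ → |f x| ≤ δ') → 0 ≤ δ' → δ' ≤ A →
    (∀ x ∈ ball p r, |f x| ≤ A) → 
    ∀ z ∈ ball p (r / 64), f z ^ 2 ≤ C * (δ' * A * (r / ρ) ^ 2) := by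
  obtain ⟨C, hC, hb⟩ := half_est n
  have hc := c0_pos (n := n)
  refine ⟨(2 * C + c0 n) / c0 n, by positivity, ?_⟩
  intro f hf p e he r ρ δ' A hρ hρr hh hs hδ hδA hA z hz
  have hr : 0 < r := by linarith
  have h1 := hb f hf p e he r ρ δ' A hρ hρr hh hs hδ hA z hz
  have h2 := hb f hf p (-e) (by rwa [norm_neg]) r ρ δ' A hρ hρr hh (by simpa using hs) hδ hA z hz
  have hsub : ∀ y : EE n, ‖y‖ ≤ 1 → z + (r/64) • y ∈ ball p r := by
    intro y hy
    rw [mem_ball, dist_eq_norm] at hz ⊢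
    have e1 := norm_add_le (z - p) ((r/64) • y)
    rw [norm_smul, Real.norm_of_nonneg (by positivity)] at e1
    have : z + (r/64) • y - p = z - p + (r/64) • y := by abel
    rw [this]; nlinarith
  have h3 := sq_le_avg hf (p := z) (t := r/64) (by positivity) (fun x hx => hh x (by
    rw [mem_ball, dist_eq_norm] at hx hz ⊢
    have := norm_sub_le_norm_sub_add_norm_sub x z p
    linarith))
  have hcf := hf.cont
  have hcc := chi_smooth.continuous
  have hi1 : Integrable (fun y : EE n => (chi (inner ℝ (z + (r/64) • y - p) e / ρ) * f (z + (r/64) • y)) ^ 2 * ph y ^ 2) := 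
    integ_ph 1 (g := fun y : EE n => (chi (inner ℝ (z + (r/64) • y - p) e / ρ) * f (z + (r/64) • y)) ^ 2) (by fun_prop)
  have hi2 : Integrable (fun y : EE n => (chi (inner ℝ (z + (r/64) • y - p) (-e) / ρ) * f (z + (r/64) • y)) ^ 2 * ph y ^ 2) := 
    integ_ph 1 (g := fun y : EE n => (chi (inner ℝ (z + (r/64) • y - p) (-e) / ρ) * f (z + (r/64) • y)) ^ 2) (by fun_prop)
  have hi3 : Integrable (fun y : EE n => δ' ^ 2 * ph y ^ 2) := integ_ph 1 (g := fun _ => δ' ^ 2) (by fun_prop)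
  have hi4 : Integrable (fun y : EE n => f (z + (r/64) • y) ^ 2 * ph y ^ 2) := integ_ph 1 (g := fun y => f (z + (r/64) • y) ^ 2) (by fun_prop)
  have h4 : ∫ y, f (z + (r/64) • y) ^ 2 * ph y ^ 2 ≤ ∫ y, (((chi (inner ℝ (z + (r/64) • y - p) e / ρ) * f (z + (r/64) • y)) ^ 2 * ph y ^ 2 +
      (chi (inner ℝ (z + (r/64) • y - p) (-e) / ρ) * f (z + (r/64) • y)) ^ 2 * ph y ^ 2) + δ' ^ 2 * ph y ^ 2) := by
    apply integral_mono hi4 ((hi1.add hi2).add hi3)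
    intro y
    simp only [Pi.add_apply]
    by_cases hy : ph y = 0
    · simp [hy]
    have hy1 := (norm_lt_of_ph hy).le
    rw [← add_mul, ← add_mul]
    have hp2 : 0 ≤ ph y ^ 2 := by positivity
    apply mul_le_mul_of_nonneg_right _ hp2
    rcases le_or_gt |inner ℝ (z + (r/64) • y - p) e| ρ with h | h
    · have := hs _ (hsub y hy1) h
      have : f (z + (r/64) • y) ^ 2 ≤ δ' ^ 2 := by rw [← sq_abs]; gcongr
      have q1 := sq_nonneg (chi (inner ℝ (z + (r/64) • y - p) e / ρ) * f (z + (r/64) • y))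
      have q2 := sq_nonneg (chi (inner ℝ (z + (r/64) • y - p) (-e) / ρ) * f (z + (r/64) • y))
      linarith
    · rcases lt_abs.1 h with h | h
      · rw [chi_one (s := inner ℝ (z + (r/64) • y - p) e / ρ) (by rw [le_div_iff₀ hρ]; linarith), one_mul]
        have q2 := sq_nonneg (chi (inner ℝ (z + (r/64) • y - p) (-e) / ρ) * f (z + (r/64) • y))
        have := sq_nonneg δ'
        linarith
      · rw [chi_one (s := inner ℝ (z + (r/64) • y - p) (-e) / ρ) (by rw [le_div_iff₀ hρ, inner_neg_right]; linarith), one_mul]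
        have q2 := sq_nonneg (chi (inner ℝ (z + (r/64) • y - p) e / ρ) * f (z + (r/64) • y))
        have := sq_nonneg δ'
        linarith
  have h4' := integral_add (hi1.add hi2) hi3
  simp only [Pi.add_apply] at h4'
  rw [h4', integral_add hi1 hi2, integral_const_mul] at h4
  have h5 : δ' ^ 2 ≤ δ' * A * (r/ρ) ^ 2 := by
    have : 1 ≤ r/ρ := by rw [le_div_iff₀ hρ]; linarith
    have : 1 ≤ (r/ρ) ^ 2 := by nlinarith
    have : 0 ≤ A := hδ.trans hδA
    calc δ' ^ 2 = δ' * δ' * 1 := by ring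
      _ ≤ _ := by gcongr
  rw [div_mul_eq_mul_div, le_div_iff₀ hc]
  have h6 : δ' ^ 2 * c0 n ≤ δ' * A * (r/ρ) ^ 2 * c0 n := by gcongr
  change c0 n * f z ^ 2 ≤ _ at h3
  unfold c0 at *
  linarith

end CW

namespace CW
variable {n : ℕ}

lemma step_arith {ν c σ bj κ lL k0 kj ln : ℝ} (hbj : 0 < bj) (hbj4 : bj ≤ 1/4) (hν : 16 ≤ bj * ν) (hc : 0 < c) (hcb : 3 * c ≤ bj / 8)
    (hκ : 0 ≤ κ) (hl : 0 ≤ lL) (hk0 : 0 ≤ k0) (hkj : k0 ≤ kj) (hln : ln ≤ ν) (hσ : 0 ≤ σ) :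
    ∃ a b : ℕ, (a + b + 1) * Real.log 2 + ν * (kj - bj * σ) + a * (κ + σ) + ln ≤ ν * (kj + (k0 + 2 * κ + 2 * lL + 5) - bj / 4 * σ) ∧
      (a + b + 1) * Real.log 2 + ν * (k0 - (1 - c) * σ) + b * (κ + σ) + ln ≤ ν * (kj + (k0 + 2 * κ + 2 * lL + 5) - bj / 4 * σ) ∧
      (a + b + 1) * Real.log 2 + ν * (2 * lL + (1 + c) * (σ / c + Real.log 2)) + (a + b) * (κ - σ / c) + ln ≤ ν * (kj + (k0 + 2 * κ + 2 * lL + 5) - bj / 4 * σ) := by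
  have hν0 : 64 ≤ ν := by nlinarith
  have hlog : 0 ≤ Real.log 2 := Real.log_nonneg (by norm_num)
  have hlog1 : Real.log 2 ≤ 1 := by have := Real.log_two_lt_d9; linarith
  set a := ⌊bj * ν / 2⌋₊ with ha
  have ha1 : (a : ℝ) ≤ bj * ν / 2 := Nat.floor_le (by positivity)
  have ha2 : bj * ν / 2 - 1 ≤ a := by have := Nat.lt_floor_add_one (bj * ν / 2); linarith
  set d := ⌈(1 + 2 * c) * ν⌉₊ with hd
  have hd1 : (1 + 2 * c) * ν ≤ d := Nat.le_ceil _
  have hd2 : (d : ℝ) ≤ (1 + 2 * c) * ν + 1 := (Nat.ceil_lt_add_one (by positivity)).le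
  have hc1 : c ≤ 1/96 := by linarith
  have hcν : c * ν ≤ bj * ν / 24 := by nlinarith
  have hbν : bj * ν ≤ ν / 4 := by nlinarith
  have had : a ≤ d := by
    have : (a:ℝ) ≤ d := by nlinarith
    exact_mod_cast this
  refine ⟨a, d - a, ?_⟩
  rw [Nat.cast_sub had]
  have hd3 : (d:ℝ) + 1 ≤ 2 * ν := by nlinarith
  have ha0 : (0:ℝ) ≤ a := Nat.cast_nonneg _
  have h0 : ((a:ℝ) + (d - a) + 1) * Real.log 2 ≤ 2 * ν := by
    rw [show (a:ℝ) + (d - a) + 1 = d + 1 by ring]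
    nlinarith
  have hdκ : (d:ℝ) * κ ≤ 2 * ν * κ := by gcongr; linarith
  have haκ : (a:ℝ) * κ ≤ d * κ := by gcongr
  have haκ0 : 0 ≤ (a:ℝ) * κ := by positivity
  have hνκ : 0 ≤ ν * κ := by positivity
  have hνl : 0 ≤ ν * lL := by positivity
  have hνk : 0 ≤ ν * k0 := by positivity
  have hνkj : ν * k0 ≤ ν * kj := by gcongr
  have hνs : 0 ≤ ν * σ := by positivity
  have hbs : bj * (ν * σ) ≤ ν * σ := by nlinarith
  have hbs0 : 0 ≤ bj * (ν * σ) := by positivity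
  refine ⟨?_, ?_, ?_⟩
  · have : (a:ℝ) * σ ≤ bj * ν / 2 * σ := by gcongr
    nlinarith
  · have : ((d:ℝ) - a - (1 - c) * ν) * σ ≤ (- (bj / 4) * ν) * σ := by
      gcongr; nlinarith
    nlinarith
  · have hT : 0 ≤ σ / c := by positivity
    have e1 : ((1 + 2 * c) * ν) * (σ / c) ≤ d * (σ / c) := by gcongr
    have e2 : c * (σ / c) = σ := by field_simp
    have e3 : ((1 + 2 * c) * ν) * (σ / c) = ν * (σ / c) + 2 * ν * (c * (σ / c)) := by ring
    have e4 : ν * (2 * lL + (1 + c) * (σ / c + Real.log 2)) = 2 * (ν * lL) + ν * (σ / c) + ν * (c * (σ / c)) + ν * ((1 + c) * Real.log 2) := by ring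
    have e5 : ν * ((1 + c) * Real.log 2) ≤ ν * 2 := by gcongr; nlinarith
    have e6 : ((a:ℝ) + (d - a)) * (κ - σ / c) = d * κ - d * (σ / c) := by ring
    rw [e4, e6]
    rw [e3] at e1
    rw [e2] at *
    linarith

lemma exp_helper {X q E T ln μ : ℝ} {a b m : ℕ} (hX : X ≤ Real.exp q) (hX0 : 0 ≤ X) (hμ : 0 ≤ μ)
    (h : (a + b + 1) * Real.log 2 + E + m * q + ln ≤ T) : 2 ^ (a+b) * (2 * (Real.exp E * μ)) * X ^ m ≤ Real.exp (T - ln) * μ := by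
  have h1 : X ^ m ≤ Real.exp (m * q) := by
    rw [Real.exp_nat_mul]; gcongr
  have h2 : (2:ℝ) ^ (a+b) * 2 = Real.exp ((a + b + 1) * Real.log 2) := by
    rw [mul_comm ((a:ℝ) + b + 1), Real.exp_mul, Real.exp_log (by norm_num)]
    rw [← pow_succ, ← Real.rpow_natCast]; push_cast; rfl
  calc 2 ^ (a+b) * (2 * (Real.exp E * μ)) * X ^ m ≤ 2 ^ (a+b) * (2 * (Real.exp E * μ)) * Real.exp (m * q) := by gcongr
    _ = (2 ^ (a+b) * 2) * Real.exp E * Real.exp (m * q) * μ := by ring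
    _ = Real.exp ((a + b + 1) * Real.log 2 + E + m * q) * μ := by rw [h2, Real.exp_add, Real.exp_add]
    _ ≤ _ := by gcongr; linarith

noncomputable def k0 (n : ℕ) : ℝ := 6 * Real.log (10 * n) + 2
noncomputable def kap (n : ℕ) : ℝ := Real.log (6 * 2 ^ (n+1) / c1 n)
noncomputable def kk (n : ℕ) : ℝ := k0 n + 2 * kap n + 2 * Real.log (10 * n) + 5
noncomputable def cc (n : ℕ) : ℝ := 1 / 4 ^ (n + 4)

def St (F : Fam n) (K : Set (EE n)) (x1 : EE n) (μ ν σ ε : ℝ) (j : ℕ) : Prop :=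
  ∃ p ∈ K, ‖p - x1‖ ≤ 1 ∧ ∃ V : Submodule ℝ (EE n), Module.finrank ℝ V = j ∧
    ∀ v ∈ V, ‖v‖ ≤ (ε / 16) ^ j → ∀ y : EE n, ‖y‖ < Real.exp (-σ) / 2 ^ j →
      nF F (p + v + y) ≤ Real.exp (ν * (kk n * (j + 1) - 1 / 4 ^ (j+1) * σ)) * μ

lemma kap_arg : 24 ≤ 6 * 2 ^ (n+1) / c1 n := by
  have hc := c1_pos (n := n)
  have hc1 := c1_le (n := n)
  rw [le_div_iff₀ hc]
  have : (1:ℝ) ≤ 2 ^ (n+1) := one_le_pow₀ (by norm_num)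
  nlinarith

lemma kap_nonneg : 0 ≤ kap n := Real.log_nonneg (by linarith [kap_arg (n := n)])

set_option maxHeartbeats 1000000 in
lemma step (hn : 1 ≤ n) {F : Fam n} (hF : SmF F) {K : Set (EE n)} (hK : Convex ℝ K) {x1 x : EE n} (hxK : x ∈ K) (hx1 : ‖x - x1‖ ≤ 1)
    {μ ν σ ε : ℝ} {j : ℕ} (hj : j + 1 ≤ n) (hμ : 0 < μ) (hν : 16 * 4 ^ n ≤ ν) (hln : Real.log n ≤ ν) (hσ : 0 ≤ σ) (hε : 0 < ε) (hε1 : ε ≤ 1)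
    (hσε : Real.exp (-σ) ≤ ε) (hΛ : 12 ≤ c1 n * Real.exp (σ / cc n))
    (hbig : ∀ z ∈ ball x1 (2 * Real.exp (σ / cc n)), nF F z ≤ Real.exp (ν * (2 * Real.log (10 * n) + (1 + cc n) * (σ / cc n + Real.log 2))) * μ)
    (hha : HaF F x1 (2 * Real.exp (σ / cc n)))
    (hbad : ∀ z ∈ ball x (Real.exp (-σ)), nF F z ≤ Real.exp (ν * (k0 n - (1 - cc n) * σ)) * μ)
    {p : EE n} (hpK : p ∈ K) (hp1 : ‖p - x1‖ ≤ 1) {V : Submodule ℝ (EE n)} (hV : Module.finrank ℝ V = j)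
    (hst : ∀ v ∈ V, ‖v‖ ≤ (ε / 16) ^ j → ∀ y : EE n, ‖y‖ < Real.exp (-σ) / 2 ^ j →
      nF F (p + v + y) ≤ Real.exp (ν * (kk n * (j + 1) - 1 / 4 ^ (j+1) * σ)) * μ)
    (hfar : ∀ v ∈ V, ε ≤ ‖x - (p + v)‖) : St F K x1 μ ν σ ε (j + 1) := by
  have hlL := logL_ge hn
  have hc := c1_pos (n := n)
  have hc1 := c1_le (n := n)
  have hκ := kap_nonneg (n := n)
  have hn0 : (0:ℝ) < n := by exact_mod_cast hn
  have hk0 : 0 ≤ k0 n := by unfold k0; linarith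
  have hkk : k0 n ≤ kk n := by unfold kk; linarith
  have hcc : 0 < cc n := by unfold cc; positivity
  have hpow : (1:ℝ) / 4 ^ n ≤ 1 / 4 ^ (j+1) := by
    apply one_div_le_one_div_of_le (by positivity)
    exact pow_le_pow_right₀ (by norm_num) hj
  have hν0 : 0 < ν := lt_of_lt_of_le (by positivity) hν
  obtain ⟨a, b, ab1, ab2, ab3⟩ := step_arith (ν := ν) (c := cc n) (σ := σ) (bj := 1 / 4 ^ (j+1)) (κ := kap n) (lL := Real.log (10 * n))
    (k0 := k0 n) (kj := kk n * (j + 1)) (ln := Real.log n) (by positivity) (by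
      rw [pow_succ]; apply one_div_le_one_div_of_le (by norm_num)
      have : (1:ℝ) ≤ 4 ^ j := one_le_pow₀ (by norm_num)
      linarith) (by
      calc (16:ℝ) = 1 / 4 ^ n * (16 * 4 ^ n) := by field_simp
        _ ≤ _ := by gcongr) hcc (by
      have : cc n = 1 / 4 ^ n / 256 := by unfold cc; rw [pow_add]; norm_num; ring
      rw [this]
      have : (0:ℝ) < 1 / 4 ^ n := by positivity
      linarith) hκ (by linarith) hk0 (by nlinarith [(Nat.cast_nonneg j : (0:ℝ) ≤ j)]) hln hσ
  have hkk' : kk n * (j + 1) + (k0 n + 2 * kap n + 2 * Real.log (10 * n) + 5) = kk n * (j + 1 + 1) := by unfold kk; ring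
  rw [hkk'] at ab1 ab2 ab3
  have hb4 : (1:ℝ) / 4 ^ (j+1) / 4 = 1 / 4 ^ (j+1+1) := by rw [pow_succ 4 (j+1)]; field_simp
  rw [hb4] at ab1 ab2 ab3
  have hxp : x - p ∉ V := by
    intro h
    have := hfar _ h
    simp at this; linarith
  refine ⟨(1/2 : ℝ) • p + (1/2 : ℝ) • x, hK hpK hxK (by norm_num) (by norm_num) (by norm_num), ?_, V ⊔ Submodule.span ℝ {x - p}, ?_, ?_⟩
  · have : (1/2 : ℝ) • p + (1/2 : ℝ) • x - x1 = (1/2 : ℝ) • (p - x1) + (1/2 : ℝ) • (x - x1) := by module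
    rw [this]
    refine (norm_add_le _ _).trans ?_
    rw [norm_smul, norm_smul]; norm_num; linarith
  · rw [← hV]
    have hx0 : x - p ≠ 0 := fun h => hxp (h ▸ V.zero_mem)
    have hdis : V ⊓ Submodule.span ℝ {x - p} = ⊥ := by
      rw [eq_bot_iff]
      intro w hw
      obtain ⟨hw1, hw2⟩ := hw
      obtain ⟨s, rfl⟩ := Submodule.mem_span_singleton.1 hw2
      by_cases hs : s = 0
      · simp [hs]
      · exfalso; apply hxp
        have := V.smul_mem s⁻¹ hw1
        rwa [smul_smul, inv_mul_cancel₀ hs, one_smul] at this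
    have := Submodule.finrank_sup_add_finrank_inf_eq V (Submodule.span ℝ {x - p})
    rw [hdis, finrank_bot, finrank_span_singleton hx0] at this
    exact this
  · intro w hw hwr y hy
    obtain ⟨v, hv, w', hw', rfl⟩ := Submodule.mem_sup.1 hw
    obtain ⟨s, rfl⟩ := Submodule.mem_span_singleton.1 hw'
    set r := (ε / 16) ^ j with hr
    have hr0 : 0 < r := by positivity
    have hr1 : r ≤ 1 := pow_le_one₀ (by positivity) (by linarith)
    rw [pow_succ, ← hr] at hwr
    have hxpn : ‖x - p‖ ≤ 2 := by
      have := norm_sub_le_norm_sub_add_norm_sub x x1 p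
      rw [norm_sub_rev x1 p] at this; linarith
    have hs : |s| * ε ≤ r * (ε / 16) := by
      by_cases hs : s = 0
      · rw [hs]; simp; positivity
      have e1 := hfar _ (V.smul_mem (-s⁻¹) hv)
      have e2 : v + s • (x - p) = s • (x - (p + (-s⁻¹) • v)) := by
        rw [smul_sub, smul_sub, smul_add, smul_smul]
        rw [show s * -s⁻¹ = -1 by field_simp]; simp; abel
      rw [e2, norm_smul, Real.norm_eq_abs] at hwr
      refine le_trans ?_ hwr
      gcongr
    have hs16 : |s| ≤ r / 16 := by
      apply le_of_mul_le_mul_right _ hε; linarith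
    have hs4 : |s| ≤ 1/4 := by linarith
    obtain ⟨hsl, hsu⟩ := abs_le.1 hs4
    have hvn : ‖v‖ ≤ r * (3/16) := by
      have e1 : v = (v + s • (x - p)) - s • (x - p) := by abel
      have e2 : ‖v‖ ≤ ‖v + s • (x - p)‖ + ‖s • (x - p)‖ := by
        conv_lhs => rw [e1]
        exact norm_sub_le _ _
      rw [norm_smul, Real.norm_eq_abs] at e2
      have : |s| * ‖x - p‖ ≤ r / 16 * 2 := by gcongr
      have q1 : r * (ε / 16) ≤ r * (1/16) := by gcongr
      linarith only [this, q1, e2, hwr]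
    set tt : ℝ := 1/2 + s with htt
    have htt1 : 1/4 ≤ 1 - tt := by rw [htt]; linarith
    set v' := (1 - tt)⁻¹ • v with hv'
    have hv'V : v' ∈ V := V.smul_mem _ hv
    have hv'n : ‖v'‖ ≤ r := by
      rw [hv', norm_smul, Real.norm_of_nonneg (by positivity)]
      have : (1 - tt)⁻¹ ≤ 4 := by rw [inv_le_comm₀ (by linarith) (by norm_num)]; linarith
      calc _ ≤ 4 * (r * (3/16)) := by gcongr
        _ ≤ r := by linarith
    set q := p + v' with hq
    set β := ‖x - q‖ with hβ
    have hβε : ε ≤ β := hfar _ hv'V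
    have hβ0 : 0 < β := by linarith
    have hβ3 : β ≤ 3 := by
      have : x - q = (x - p) - v' := by rw [hq]; abel
      rw [hβ, this]
      have := norm_sub_le (x - p) v'
      linarith
    set e := β⁻¹ • (x - q) with he
    have hen : ‖e‖ = 1 := by rw [he, norm_smul, norm_inv, norm_norm, inv_mul_cancel₀ hβ0.ne']
    have hβe : β • e = x - q := by rw [he, smul_smul, mul_inv_cancel₀ hβ0.ne', one_smul]
    have hpt : (1/2 : ℝ) • p + (1/2 : ℝ) • x + (v + s • (x - p)) + y = (q + y) + (tt * β) • e := by
      rw [mul_smul, hβe, hq]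
      have : v = (1 - tt) • v' := by rw [hv', smul_smul, mul_inv_cancel₀ (by linarith), one_smul]
      rw [this, htt]; module
    rw [hpt]
    set ρ' := Real.exp (-σ) / 2 ^ (j+1) with hρ'
    have hρ'0 : 0 < ρ' := by positivity
    have hρj : Real.exp (-σ) / 2 ^ j = 2 * ρ' := by rw [hρ', pow_succ]; field_simp
    have hρle : 2 * ρ' ≤ Real.exp (-σ) := by
      rw [← hρj]; apply div_le_self (Real.exp_pos _).le (one_le_pow₀ (by norm_num))
    have hρ1 : Real.exp (-σ) ≤ 1 := by linarith
    have hqx1 : ‖q + y - x1‖ ≤ 3 := by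
      have : q + y - x1 = (p - x1) + v' + y := by rw [hq]; abel
      rw [this]
      have := norm_add_le ((p - x1) + v') y
      have := norm_add_le (p - x1) v'
      linarith
    set Λ := Real.exp (σ / cc n) with hΛd
    have hΛ3 : 3 ≤ Λ := by nlinarith only [Real.exp_pos (σ / cc n), hc1, hΛ, hΛd]
    have hsubΛ : ball (q + y) Λ ⊆ ball x1 (2 * Λ) := by
      apply ball_subset_ball'
      rw [dist_eq_norm]; linarith
    have hB : ∀ i, |F i ((q + y) + (tt * β) • e)| ≤ Real.exp (ν * (kk n * (j + 1 + 1) - 1 / 4 ^ (j+1+1) * σ) - Real.log n) * μ := by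
      intro i
      have hκe : Real.exp (kap n) = 6 * 2 ^ (n+1) / c1 n := by unfold kap; rw [Real.exp_log (by linarith [kap_arg (n := n)])]
      have hXρ : 2 * β / (c1 n * ρ') ≤ Real.exp (kap n + σ) := by
        rw [Real.exp_add, hκe, hρ']
        have e1 : (2:ℝ) ^ (j+1) ≤ 2 ^ (n+1) := pow_le_pow_right₀ (by norm_num) (by omega)
        calc 2 * β / (c1 n * (Real.exp (-σ) / 2 ^ (j+1))) = 2 * β * 2 ^ (j+1) / c1 n * Real.exp σ := by
              rw [Real.exp_neg]; field_simp
          _ ≤ 2 * 3 * 2 ^ (n+1) / c1 n * Real.exp σ := by gcongr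
          _ = _ := by norm_num
      have hXΛ : 2 * β / (c1 n * Λ) ≤ Real.exp (kap n - σ / cc n) := by
        rw [Real.exp_sub, hκe, ← hΛd]
        calc 2 * β / (c1 n * Λ) = 2 * β * 1 / c1 n / Λ := by field_simp
          _ ≤ 2 * 3 * 2 ^ (n+1) / c1 n / Λ := by
            gcongr; exact one_le_pow₀ (by norm_num)
          _ = _ := by norm_num
      refine two_point (hF i) hen (R := Λ) (ρ := ρ') (β := β) (A₁ := Real.exp (ν * (kk n * (j + 1) - 1 / 4 ^ (j+1) * σ)) * μ)
        (A₂ := Real.exp (ν * (k0 n - (1 - cc n) * σ)) * μ)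
        (A₃ := Real.exp (ν * (2 * Real.log (10 * n) + (1 + cc n) * (σ / cc n + Real.log 2))) * μ) (a := a) (b := b) hρ'0 ?_ ?_ ?_ ?_ ?_ ?_ ?_ ?_ ?_ ?_ ?_
      · have q1 : 4 * c1 n * ρ' ≤ 1 * ρ' := mul_le_mul_of_nonneg_right (by linarith only [hc1]) hρ'0.le
        linarith only [q1, hρle, hσε, hβε, hρ'0]
      · linarith only [hΛ, hβ3]
      · intro z hz; exact hha i z (hsubΛ hz)
      · intro z hz
        refine (abs_le_nF F i z).trans ?_
        have : z = p + v' + (z - q) := by rw [hq]; abel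
        rw [this]
        apply hst v' hv'V hv'n
        rw [hρj]
        rw [mem_ball, dist_eq_norm] at hz
        have : z - q = (z - (q + y)) + y := by abel
        rw [this]
        have := norm_add_le (z - (q + y)) y
        linarith
      · intro z hz
        refine (abs_le_nF F i z).trans (hbad z ?_)
        rw [hβe, mem_ball, dist_eq_norm] at hz
        rw [mem_ball, dist_eq_norm]
        have e1 : z - x = (z - (q + y + (x - q))) + y := by abel
        rw [e1]
        have := norm_add_le (z - (q + y + (x - q))) y
        linarith
      · intro z hz; exact (abs_le_nF F i z).trans (hbig z (hsubΛ hz))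
      · have q1 := mul_le_mul_of_nonneg_right (show 1/4 ≤ tt by linarith only [htt, hsl]) hβ0.le
        linarith only [q1]
      · have q1 := mul_le_mul_of_nonneg_right (show tt ≤ 3/4 by linarith only [htt, hsu]) hβ0.le
        linarith only [q1]
      · exact exp_helper hXρ (by positivity) hμ.le ab1
      · exact exp_helper hXρ (by positivity) hμ.le ab2
      · exact exp_helper hXΛ (by positivity) hμ.le (by push_cast; exact ab3)
    refine (nF_le F _ hB).trans (le_of_eq ?_)
    rw [Real.exp_sub, Real.exp_log hn0]
    push_cast
    field_simp

end CW

namespace CW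
variable {n : ℕ}

lemma normal_exists {V : Submodule ℝ (EE n)} (hV : Module.finrank ℝ V + 1 = n) : ∃ e : EE n, ‖e‖ = 1 ∧
    ∀ w : EE n, w - (inner ℝ w e : ℝ) • e ∈ V ∧ ‖w - (inner ℝ w e : ℝ) • e‖ ≤ ‖w‖ := by
  have h1 : Module.finrank ℝ Vᗮ = 1 := by
    have := Submodule.finrank_add_finrank_orthogonal V
    rw [finrank_euclideanSpace_fin] at this; omega
  obtain ⟨e0, he0, -⟩ := finrank_eq_one_iff'.1 h1
  have he0' : (e0 : EE n) ≠ 0 := by simpa using he0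
  have hpos : 0 < ‖(e0 : EE n)‖ := norm_pos_iff.2 he0'
  refine ⟨‖(e0 : EE n)‖⁻¹ • (e0 : EE n), ?_, ?_⟩
  · rw [norm_smul, norm_inv, norm_norm, inv_mul_cancel₀ hpos.ne']
  have hen : ‖‖(e0 : EE n)‖⁻¹ • (e0 : EE n)‖ = 1 := by rw [norm_smul, norm_inv, norm_norm, inv_mul_cancel₀ hpos.ne']
  have hspan : ∀ w ∈ Vᗮ, ∃ c : ℝ, w = c • (‖(e0 : EE n)‖⁻¹ • (e0 : EE n)) := by
    intro w hw
    obtain ⟨c, hc⟩ := (finrank_eq_one_iff_of_nonzero' e0 he0).1 h1 ⟨w, hw⟩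
    refine ⟨c * ‖(e0 : EE n)‖, ?_⟩
    have : c • (e0 : EE n) = w := by simpa using congrArg Subtype.val hc
    rw [smul_smul, mul_assoc, mul_inv_cancel₀ hpos.ne', mul_one, this]
  generalize ‖(e0 : EE n)‖⁻¹ • (e0 : EE n) = e at hen hspan
  intro w
  have hee : (inner ℝ e e : ℝ) = 1 := by rw [real_inner_self_eq_norm_sq, hen]; norm_num
  constructor
  · rw [← Submodule.orthogonal_orthogonal V, Submodule.mem_orthogonal]
    intro u hu
    obtain ⟨c, rfl⟩ := hspan u hu
    rw [inner_smul_left, inner_sub_right, inner_smul_right, hee, real_inner_comm]; simp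
  · apply le_of_sq_le_sq _ (norm_nonneg _)
    rw [norm_sub_sq_real, norm_smul, hen, inner_smul_right, mul_one, Real.norm_eq_abs, sq_abs]
    nlinarith [sq_nonneg (inner ℝ w e : ℝ)]

lemma no_top (hn : 1 ≤ n) : ∃ ν₁ : ℝ, ∀ ε : ℝ, 0 < ε → ε ≤ 1 → ∃ σ₀ : ℝ, ∀ σ ν : ℝ, σ₀ ≤ σ → 0 ≤ σ → ν₁ ≤ ν → 16 * 4 ^ n ≤ ν →
    ∀ (F : Fam n), SmF F → ∀ (K : Set (EE n)) (x1 : EE n) (μ : ℝ), 0 < μ → HaF F x1 2 →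
    (∀ z ∈ ball x1 2, nF F z ≤ Real.exp (ν * (2 * Real.log (10 * n) + 2)) * μ) →
    (∀ p ∈ K, ‖p - x1‖ ≤ 1 → ∀ r : ℝ, 0 < r → r ≤ 1 → μ ≤ Real.exp (ν * (2 * Real.log (10 * n) + 2 * Real.log (2 / r))) * Mx F p r) →
    ¬ St F K x1 μ ν σ ε (n - 1) := by
  obtain ⟨C, hC, hslab⟩ := slab n
  refine ⟨Real.log (n * C * 4 ^ n), fun ε hε hε1 => ?_⟩
  set r := (ε / 16) ^ (n - 1) with hr
  have hr0 : 0 < r := by positivity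
  have hr1 : r ≤ 1 := pow_le_one₀ (by positivity) (by linarith)
  have hlL := logL_ge hn
  have hκ := kap_nonneg (n := n)
  have hn0 : (1:ℝ) ≤ n := by exact_mod_cast hn
  have hk0 : 0 ≤ k0 n := by unfold k0; linarith
  set k := kk n * n with hk
  have hk1 : 2 * Real.log (10 * n) + 2 ≤ k := by
    have : 2 * Real.log (10 * n) + 2 ≤ kk n := by unfold kk; linarith
    rw [hk]; nlinarith
  set lL := Real.log (10 * n) with hlLd
  have hlr : 0 ≤ Real.log (128 / r) := Real.log_nonneg (by rw [le_div_iff₀ hr0]; linarith)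
  refine ⟨max (-Real.log r) ((4 * lL + 4 * Real.log (128 / r) + 2 + 2 * k) * 2 * 4 ^ n), ?_⟩
  intro σ ν hσ₀ hσ hν₁ hν F hF K x1 μ hμ hha hbig hlow ⟨p, hpK, hp1, V, hV, hst⟩
  have hσ1 := (le_max_left _ _).trans hσ₀
  have hσ2 := (le_max_right _ _).trans hσ₀
  have hν0 : 0 < ν := lt_of_lt_of_le (by positivity) hν
  obtain ⟨e, hen, he⟩ := normal_exists (V := V) (by omega)
  rw [← hr] at hst
  have hj : ((n - 1 : ℕ) : ℝ) + 1 = n := by rw [Nat.cast_sub hn]; simp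
  have hj' : n - 1 + 1 = n := by omega
  rw [hj, ← hk, hj'] at hst
  set ρs := Real.exp (-σ) / 2 ^ n with hρs
  have hρs0 : 0 < ρs := by positivity
  have hρ2 : Real.exp (-σ) / 2 ^ (n - 1) = 2 * ρs := by
    rw [hρs]; conv_rhs => rw [← hj', pow_succ]
    field_simp
  have hρr : ρs ≤ r := by
    have e1 : Real.exp (-σ) ≤ r := by
      rw [← Real.le_log_iff_exp_le hr0]; linarith
    exact (div_le_self (Real.exp_pos _).le (one_le_pow₀ (by norm_num))).trans e1
  have hsub : ball p r ⊆ ball x1 2 := by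
    apply ball_subset_ball'; rw [dist_eq_norm]; linarith
  set δ' := Real.exp (ν * (k - 1 / 4 ^ n * σ)) * μ with hδ'
  set A := Real.exp (ν * k) * μ with hA
  have hδ0 : 0 ≤ δ' := by positivity
  have hδA : δ' ≤ A := by
    rw [hδ', hA]; gcongr
    have : 0 ≤ 1 / 4 ^ n * σ := by positivity
    linarith
  have hcomp : ∀ i, ∀ z ∈ ball p (r / 64), F i z ^ 2 ≤ C * (δ' * A * (r / ρs) ^ 2) := by
    intro i
    apply hslab (F i) (hF i) p e hen r ρs δ' A hρs0 hρr (fun x hx => hha i x (hsub hx)) _ hδ0 hδA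
    · intro x hx
      refine (abs_le_nF F i x).trans ((hbig x (hsub hx)).trans ?_)
      rw [hA]; gcongr
    · intro x hx hxe
      refine (abs_le_nF F i x).trans ?_
      have e1 : x = p + ((x - p) - (inner ℝ (x - p) e : ℝ) • e) + (inner ℝ (x - p) e : ℝ) • e := by abel
      rw [e1]
      rw [mem_ball, dist_eq_norm] at hx
      apply hst _ (he (x - p)).1 ((he (x - p)).2.trans hx.le)
      rw [norm_smul, hen, mul_one, Real.norm_eq_abs, hρ2]; linarith
  have hrρ : r / ρs ≤ 2 ^ n * Real.exp σ := by
    rw [hρs, div_le_iff₀ (by positivity), Real.exp_neg]; field_simp; exact hr1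
  have hM : Mx F p (r / 64) ≤ √(n * (C * (δ' * A * (2 ^ n * Real.exp σ) ^ 2))) := by
    apply Mx_le (Real.sqrt_nonneg _)
    intro z hz
    apply Real.le_sqrt_of_sq_le
    rw [nF_sq]
    calc ∑ i, F i z ^ 2 ≤ ∑ i : Fin n, C * (δ' * A * (2 ^ n * Real.exp σ) ^ 2) := by
          apply Finset.sum_le_sum; intro i _
          refine (hcomp i z hz).trans ?_
          gcongr
      _ = _ := by simp
  have hl := hlow p hpK hp1 (r / 64) (by positivity) (by linarith)
  have e0 : 2 / (r / 64) = 128 / r := by field_simp; norm_num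
  rw [e0] at hl
  have hl2 := hl.trans (mul_le_mul_of_nonneg_left hM (Real.exp_pos _).le)
  have hl3 : μ ^ 2 ≤ (Real.exp (ν * (2 * lL + 2 * Real.log (128 / r)))) ^ 2 * (n * (C * (δ' * A * (2 ^ n * Real.exp σ) ^ 2))) := by
    calc μ ^ 2 ≤ _ := pow_le_pow_left₀ hμ.le hl2 2
      _ = _ := by rw [mul_pow, Real.sq_sqrt (by positivity)]
  have hCn : 0 < n * C * 4 ^ n := by positivity
  have hl4 : (Real.exp (ν * (2 * lL + 2 * Real.log (128 / r)))) ^ 2 * (n * (C * (δ' * A * (2 ^ n * Real.exp σ) ^ 2)))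
      = Real.exp (2 * (ν * (2 * lL + 2 * Real.log (128 / r))) + Real.log (n * C * 4 ^ n) + ν * (k - 1 / 4 ^ n * σ) + ν * k + 2 * σ) * μ ^ 2 := by
    rw [Real.exp_add, Real.exp_add, Real.exp_add, Real.exp_add, Real.exp_log hCn, hδ', hA]
    rw [two_mul (ν * _), Real.exp_add, two_mul σ, Real.exp_add]
    have : (4:ℝ) ^ n = 2 ^ n * 2 ^ n := by rw [← mul_pow]; norm_num
    rw [this]; ring
  rw [hl4] at hl3
  have hneg : 2 * (ν * (2 * lL + 2 * Real.log (128 / r))) + Real.log (n * C * 4 ^ n) + ν * (k - 1 / 4 ^ n * σ) + ν * k + 2 * σ < 0 := by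
    have q1 : (16:ℝ) ≤ ν * (1 / 4 ^ n) := by
      rw [mul_one_div, le_div_iff₀ (by positivity)]; linarith
    have q2 : 16 * σ ≤ ν * (1 / 4 ^ n) * σ := by gcongr
    have q3 : (4 * lL + 4 * Real.log (128 / r) + 2 + 2 * k) ≤ 1 / 4 ^ n * σ / 2 := by
      rw [div_mul_eq_mul_div, one_mul, div_div, le_div_iff₀ (by positivity)]; linarith
    have q4 := mul_le_mul_of_nonneg_left q3 hν0.le
    linarith
  have : Real.exp (2 * (ν * (2 * lL + 2 * Real.log (128 / r))) + Real.log (n * C * 4 ^ n) + ν * (k - 1 / 4 ^ n * σ) + ν * k + 2 * σ) < 1 := by have q := Real.exp_lt_exp.2 hneg; rwa [Real.exp_zero] at q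
  have hμ2 : 0 < μ ^ 2 := by positivity
  have := mul_lt_mul_of_pos_right this hμ2
  linarith

set_option maxHeartbeats 1000000 in
theorem core (hn : 2 ≤ n) : ∃ N₀ : ℝ, 0 < N₀ ∧ ∀ ε : ℝ, 0 < ε → ε ≤ 1 → ∃ s₀ : ℝ, 0 < s₀ ∧ ∃ R₀ : ℝ, 1 ≤ R₀ ∧ ∀ N : ℝ, N₀ ≤ N →
    ∀ F : Fam n, SmF F → ∀ K : Set (EE n), Convex ℝ K → (∀ x ∈ K, HaF F x R₀) → (∀ x ∈ K, ∀ r : ℝ, 0 < r → 0 < Mx F x r) →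
    (∀ x ∈ K, ∀ r : ℝ, 0 < r → r ≤ R₀ → Mx F x (10 * n * r) ≤ Real.exp ((1 + cc n) * N) * Mx F x r) →
    ∀ S : Set (EE n), S ⊆ K → (∀ x ∈ S, ∀ y ∈ S, ‖x - y‖ ≤ 1) →
    (∀ x ∈ S, ∃ r : ℝ, 0 < r ∧ r ≤ s₀ ∧ Real.exp N * Mx F x r ≤ Mx F x (10 * n * r)) →
    ∃ (p : EE n) (V : Submodule ℝ (EE n)), Module.finrank ℝ V + 2 ≤ n ∧ ∀ x ∈ S, ∃ v ∈ V, ‖x - (p + v)‖ ≤ ε := by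
  have hn1 : 1 ≤ n := by omega
  have hlL := logL_ge hn1
  have hcc : 0 < cc n := by unfold cc; positivity
  have hcc1 : cc n ≤ 1/256 := by
    unfold cc; rw [pow_add]
    apply one_div_le_one_div_of_le (by norm_num)
    have : (1:ℝ) ≤ 4 ^ n := one_le_pow₀ (by norm_num)
    linarith
  obtain ⟨N1, hN1, hbd⟩ := bad_decay hn1 hcc (by linarith)
  obtain ⟨ν₁, hnt⟩ := no_top hn1
  refine ⟨max N1 (Real.log (10 * n) * max (max ν₁ (16 * 4 ^ n)) (Real.log n)), lt_max_of_lt_left hN1, ?_⟩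
  intro ε hε hε1
  obtain ⟨σ₀, hσ₀⟩ := hnt ε hε hε1
  have hc := c1_pos (n := n)
  have hc1 := c1_le (n := n)
  set σ := max 0 (max σ₀ (max (-Real.log ε) (cc n * Real.log (12 / c1 n)))) with hσd
  have hσ : 0 ≤ σ := le_max_left _ _
  have hσ1 : σ₀ ≤ σ := (le_max_left _ _).trans (le_max_right _ _)
  have hσ2 : -Real.log ε ≤ σ := (le_max_left _ _).trans ((le_max_right _ _).trans (le_max_right _ _))
  have hσ3 : cc n * Real.log (12 / c1 n) ≤ σ := (le_max_right _ _).trans ((le_max_right _ _).trans (le_max_right _ _))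
  clear_value σ
  have hσε : Real.exp (-σ) ≤ ε := by rw [← Real.le_log_iff_exp_le hε]; linarith
  have hΛ : 12 ≤ c1 n * Real.exp (σ / cc n) := by
    have : Real.log (12 / c1 n) ≤ σ / cc n := by rw [le_div_iff₀ hcc]; linarith
    rw [Real.log_le_iff_le_exp (by positivity), div_le_iff₀ hc] at this
    linarith
  set Λ := Real.exp (σ / cc n) with hΛd
  have hΛ3 : 3 ≤ Λ := by nlinarith [Real.exp_pos (σ / cc n)]
  have hn0 : (2:ℝ) ≤ n := by exact_mod_cast hn
  refine ⟨Real.exp (-σ) / (20 * n), by positivity, 4 * Λ, by linarith, ?_⟩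
  intro N hN F hF K hK hha hpos hdb S hSK hS1 hSbad
  have hNN1 := (le_max_left _ _).trans hN
  have hN2 := (le_max_right _ _).trans hN
  have hN0 : 0 < N := hN1.trans_le hNN1
  set lL := Real.log (10 * n) with hlLd
  have hl0 : 0 < lL := by linarith
  set ν := N / lL with hν
  have hNν : N = ν * lL := by rw [hν]; field_simp
  have hνm : max (max ν₁ (16 * 4 ^ n)) (Real.log n) ≤ ν := by rw [hν, le_div_iff₀ hl0]; linarith
  have hν1 : ν₁ ≤ ν := (le_max_left _ _).trans ((le_max_left _ _).trans hνm)
  have hν2 : 16 * 4 ^ n ≤ ν := (le_max_right _ _).trans ((le_max_left _ _).trans hνm)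
  have hν3 : Real.log n ≤ ν := (le_max_right _ _).trans hνm
  have hν0 : 0 < ν := lt_of_lt_of_le (by positivity) hν2
  rcases S.eq_empty_or_nonempty with rfl | ⟨x1, hx1⟩
  · exact ⟨0, ⊥, by simpa using hn, by simp⟩
  have hx1K := hSK hx1
  set μ := Mx F x1 1 with hμd
  have hμ : 0 < μ := hpos x1 hx1K 1 one_pos
  have hgr : ∀ x ∈ K, ∀ r R : ℝ, 0 < r → r ≤ R → R ≤ 4 * Λ → Mx F x R ≤ Real.exp (ν * (2 * lL + (1 + cc n) * Real.log (R / r))) * Mx F x r := by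
    intro x hx r R hr hrR hR
    refine (growth hn1 hF (by positivity) (hdb x hx) hr hrR hR).trans ?_
    have hM := Mx_nonneg F x r
    gcongr
    rw [← hlLd, hNν]
    have q1 : (1 + cc n) * (ν * lL) / lL = (1 + cc n) * ν := by field_simp
    rw [q1]
    have q2 : (1 + cc n) * (ν * lL) ≤ 2 * (ν * lL) := by
      have : 0 < ν * lL := by positivity
      gcongr; linarith
    linarith
  have hgr1 : ∀ R : ℝ, 1 ≤ R → R ≤ 4 * Λ → ∀ z ∈ ball x1 R, nF F z ≤ Real.exp (ν * (2 * lL + (1 + cc n) * Real.log R)) * μ := by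
    intro R h1 h2 z hz
    refine (le_Mx hF hz).trans ?_
    have := hgr x1 hx1K 1 R one_pos h1 h2
    rwa [div_one] at this
  have hl2 : Real.log 2 ≤ 1 := by have := Real.log_two_lt_d9; linarith
  have hl20 : 0 ≤ Real.log 2 := Real.log_nonneg (by norm_num)
  have hl2c : (1 + cc n) * Real.log 2 ≤ 2 := by nlinarith
  have hρ1 : Real.exp (-σ) ≤ 1 := by linarith
  have hbad : ∀ x ∈ S, ∀ z ∈ ball x (Real.exp (-σ)), nF F z ≤ Real.exp (ν * (k0 n - (1 - cc n) * σ)) * μ := by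
    intro x hx z hz
    obtain ⟨r, hr, hrs, hrb⟩ := hSbad x hx
    rw [le_div_iff₀ (by positivity)] at hrs
    have e1 := hbd N hNN1 F hF x ((hha x (hSK hx)).mono (by linarith)) (hpos x (hSK hx)) r hr (by linarith) hrb (Real.exp (-σ)) (by nlinarith) hρ1
    have e2 : Mx F x 1 ≤ Real.exp (ν * (2 * lL + (1 + cc n) * Real.log 2)) * μ := by
      apply Mx_le (by positivity)
      intro w hw
      apply hgr1 2 (by norm_num) (by linarith)
      refine ball_subset_ball' ?_ hw
      rw [dist_eq_norm]; linarith [hS1 x hx x1 hx1]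
    refine (le_Mx hF hz).trans (e1.trans ((mul_le_mul_of_nonneg_left e2 (Real.exp_pos _).le).trans ?_))
    rw [← mul_assoc, ← Real.exp_add]
    gcongr
    rw [one_div, ← Real.exp_neg, neg_neg, Real.log_exp, hNν]
    have q1 : (1 - cc n) * (ν * lL) / lL = (1 - cc n) * ν := by field_simp
    rw [q1]; unfold k0; rw [← hlLd]
    have := mul_le_mul_of_nonneg_left hl2c hν0.le
    linarith
  have hmain : ∀ j : ℕ, j + 1 ≤ n → (∃ (p : EE n) (V : Submodule ℝ (EE n)), Module.finrank ℝ V + 2 ≤ n ∧ ∀ x ∈ S, ∃ v ∈ V, ‖x - (p + v)‖ ≤ ε)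
      ∨ St F K x1 μ ν σ ε j := by
    intro j
    induction j with
    | zero =>
      intro _
      right
      refine ⟨x1, hx1K, by simp, ⊥, finrank_bot _ _, ?_⟩
      intro v hv _ y hy
      rw [Submodule.mem_bot] at hv
      subst hv
      refine (hbad x1 hx1 _ (by rw [mem_ball, dist_eq_norm]; simpa using hy)).trans ?_
      refine mul_le_mul_of_nonneg_right (Real.exp_le_exp.2 (mul_le_mul_of_nonneg_left ?_ hν0.le)) hμ.le
      have q1 : k0 n ≤ kk n := by have := kap_nonneg (n := n); unfold kk; rw [← hlLd]; linarith
      have q2 : (1 / 4 ^ (0+1)) * σ ≤ (1 - cc n) * σ := mul_le_mul_of_nonneg_right (by norm_num; linarith) (by linarith)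
      simp only [Nat.cast_zero, zero_add, mul_one] at q2 ⊢
      linarith
    | succ j ih =>
      intro hj
      rcases ih (by omega) with h | ⟨p, hpK, hp1, V, hV, hst⟩
      · exact Or.inl h
      by_cases hall : ∀ x ∈ S, ∃ v ∈ V, ‖x - (p + v)‖ ≤ ε
      · exact Or.inl ⟨p, V, by omega, hall⟩
      push Not at hall
      obtain ⟨x, hx, hfar⟩ := hall
      right
      refine step hn1 hF hK (hSK hx) (hS1 x hx x1 hx1) (by omega) hμ hν2 hν3 hσ hε hε1 hσε hΛ ?_ ((hha x1 hx1K).mono (by linarith)) (hbad x hx)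
        hpK hp1 hV hst (fun v hv => (hfar v hv).le)
      intro z hz
      have := hgr1 (2 * Λ) (by linarith) (by linarith) z hz
      rwa [Real.log_mul (by norm_num) (by positivity), hΛd, Real.log_exp, add_comm (Real.log 2)] at this
  rcases hmain (n - 1) (by omega) with h | h
  · exact h
  · exfalso
    refine hσ₀ σ ν hσ1 hσ hν1 hν2 F hF K x1 μ hμ ((hha x1 hx1K).mono (by linarith)) ?_ ?_ h
    · intro z hz
      refine (hgr1 2 (by norm_num) (by linarith) z hz).trans ?_
      gcongr
    · intro p hpK hp1 r hr hr1
      have e1 : μ ≤ Mx F p 2 := Mx_mono hF (ball_subset_ball' (by rw [dist_eq_norm, norm_sub_rev]; linarith))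
      refine e1.trans ((hgr p hpK r 2 hr (by linarith) (by linarith)).trans ?_)
      have hM := Mx_nonneg F p r
      have : 0 ≤ Real.log (2 / r) := Real.log_nonneg (by rw [le_div_iff₀ hr]; linarith)
      gcongr
      linarith

end CW

namespace CW
variable {n : ℕ}

theorem rounding {α : Type*} {d : ℕ} (X : Set α) (a : Fin d → α → ℝ) (h : ∀ x ∈ X, ∀ y ∈ X, ∀ i, |a i x - a i y| ≤ 1)
    {η : ℝ} (hη : 0 < η) : ∃ f : α → (Fin d → Fin (⌊2 / η⌋₊ + 1)), ∀ x ∈ X, ∀ y ∈ X, f x = f y → ∀ i, |a i x - a i y| ≤ η := by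
  rcases X.eq_empty_or_nonempty with rfl | ⟨x0, hx0⟩
  · exact ⟨fun _ _ => 0, by simp⟩
  refine ⟨fun x i => Fin.ofNat _ ⌊(a i x - a i x0 + 1) / η⌋₊, ?_⟩
  intro x hx y hy hxy i
  have h1 := congrFun hxy i
  have hval : ∀ z ∈ X, ⌊(a i z - a i x0 + 1) / η⌋₊ < ⌊2 / η⌋₊ + 1 := by
    intro z hz
    have := abs_le.1 (h z hz x0 hx0 i)
    refine Nat.lt_succ_of_le (Nat.floor_le_floor ?_)
    gcongr; linarith
  have h2 := congrArg Fin.val h1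
  simp only [Fin.val_ofNat, Nat.mod_eq_of_lt (hval x hx), Nat.mod_eq_of_lt (hval y hy)] at h2
  have hnn : ∀ z ∈ X, 0 ≤ (a i z - a i x0 + 1) / η := by
    intro z hz
    have := abs_le.1 (h z hz x0 hx0 i)
    apply div_nonneg _ hη.le
    linarith
  have u1 := Nat.floor_le (hnn x hx)
  have u2 := Nat.lt_floor_add_one ((a i x - a i x0 + 1) / η)
  have u3 := Nat.floor_le (hnn y hy)
  have u4 := Nat.lt_floor_add_one ((a i y - a i x0 + 1) / η)
  rw [h2] at u1 u2
  rw [le_div_iff₀ hη] at u1 u3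
  rw [div_lt_iff₀ hη] at u2 u4
  rw [abs_le]
  constructor <;> linarith

theorem norm_le_basis {V : Type*} [NormedAddCommGroup V] [InnerProductSpace ℝ V] {d : ℕ} (b : OrthonormalBasis (Fin d) ℝ V) (w : V) {c : ℝ}
    (h : ∀ i, |inner ℝ (b i) w| ≤ c) : ‖w‖ ≤ d * c := by
  rw [← b.sum_repr' w]
  refine (norm_sum_le _ _).trans ?_
  have : ∀ i ∈ Finset.univ, ‖inner ℝ (b i) w • b i‖ ≤ c := by
    intro i _
    rw [norm_smul, b.norm_eq_one, mul_one]; exact h i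
  simpa using Finset.sum_le_card_nsmul _ _ _ this

theorem plane_cover (hn : 2 ≤ n) {ι : Type*} (pt : ι → EE n) (X : Set ι) {D ε : ℝ} (hD : 0 < D) (hε : 0 < ε)
    (hX : ∀ x ∈ X, ∀ y ∈ X, ‖pt x - pt y‖ ≤ D) (p : EE n) (V : Submodule ℝ (EE n)) (hV : Module.finrank ℝ V + 2 ≤ n)
    (h : ∀ x ∈ X, ∃ v ∈ V, ‖pt x - (p + v)‖ ≤ ε * D) :
    ∃ f : ι → (Fin (n - 2) → Fin (⌊2 / ε⌋₊ + 1)), ∀ x ∈ X, ∀ y ∈ X, f x = f y → ‖pt x - pt y‖ ≤ (3 * n + 2) * ε * D := by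
  set d := Module.finrank ℝ V with hd
  let b := stdOrthonormalBasis ℝ V
  have hb1 : ∀ (i) (w : EE n), |inner ℝ (b i : EE n) w| ≤ ‖w‖ := by
    intro i w
    refine (abs_real_inner_le_norm _ _).trans ?_
    have : ‖(b i : EE n)‖ = 1 := b.norm_eq_one i
    rw [this, one_mul]
  obtain ⟨f, hf⟩ := rounding (d := n - 2) X (fun i x => if h : i.1 < d then inner ℝ (b ⟨i.1, h⟩ : EE n) (pt x) / D else 0) (by
    intro x hx y hy i
    by_cases hi : i.1 < d
    · simp only [hi, dif_pos]
      rw [← sub_div, ← inner_sub_right, abs_div, abs_of_pos hD, div_le_one hD]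
      exact (hb1 _ _).trans (hX x hx y hy)
    · simp [hi]) hε
  refine ⟨f, ?_⟩
  intro x hx y hy hxy
  obtain ⟨v, hv, hv'⟩ := h x hx
  obtain ⟨w, hw, hw'⟩ := h y hy
  have hq := hf x hx y hy hxy
  have hq2 : ∀ i : Fin d, |inner ℝ (b i : EE n) (pt x - pt y)| ≤ ε * D := by
    intro i
    have := hq ⟨i.1, by omega⟩
    simp only [i.2, dif_pos] at this
    rw [← sub_div, ← inner_sub_right, abs_div, abs_of_pos hD, div_le_iff₀ hD] at this
    exact this
  set e := (pt x - (p + v)) - (pt y - (p + w)) with he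
  have hee : ‖e‖ ≤ 2 * (ε * D) := (norm_sub_le _ _).trans (by linarith)
  have hdec : pt x - pt y = (v - w) + e := by rw [he]; abel
  have hvw : ‖v - w‖ ≤ d * (3 * (ε * D)) := by
    have := norm_le_basis b (⟨v - w, V.sub_mem hv hw⟩ : V) (c := 3 * (ε * D)) (by
      intro i
      have e1 : inner ℝ (b i) (⟨v - w, V.sub_mem hv hw⟩ : V) = inner ℝ (b i : EE n) (pt x - pt y) - inner ℝ (b i : EE n) e := by
        rw [← inner_sub_right, hdec, add_sub_cancel_right]; rfl
      rw [e1]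
      refine (abs_sub _ _).trans ?_
      linarith [hq2 i, hb1 i e])
    exact this
  rw [hdec]
  refine (norm_add_le _ _).trans ?_
  have hdn : (d : ℝ) ≤ n := by exact_mod_cast (by omega : d ≤ n)
  have hp : 0 < ε * D := by positivity
  have := mul_le_mul_of_nonneg_right hdn hp.le
  linarith

theorem iter {ι κ : Type*} [Fintype κ] [DecidableEq κ] [DecidableEq ι] (pt : ι → EE n) {θ τ D₀ : ℝ} (hθ : 0 < θ) (hθ1 : θ ≤ 1) (C : ℕ)
    (hstep : ∀ D : ℝ, 0 < D → τ ≤ D → D ≤ D₀ → ∀ X : Finset ι, (∀ x ∈ X, ∀ y ∈ X, ‖pt x - pt y‖ ≤ D) →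
      ∃ f : ι → κ, ∀ x ∈ X, ∀ y ∈ X, f x = f y → ‖pt x - pt y‖ ≤ θ * D) :
    ∀ (m : ℕ) (D : ℝ), 0 < D → τ ≤ θ ^ m * D → D ≤ D₀ →
      (∀ X : Finset ι, (∀ x ∈ X, ∀ y ∈ X, ‖pt x - pt y‖ ≤ θ ^ (m + 1) * D) → X.card ≤ C) →
      ∀ X : Finset ι, (∀ x ∈ X, ∀ y ∈ X, ‖pt x - pt y‖ ≤ D) → X.card ≤ C * Fintype.card κ ^ (m + 1) := by
  intro m
  induction m with
  | zero =>
    intro D hD hτ hD0 hC X hX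
    obtain ⟨f, hf⟩ := hstep D hD (by simpa using hτ) hD0 X hX
    rw [zero_add, pow_one]
    have := Finset.card_le_mul_card_image_of_maps_to (f := f) (s := X) (t := Finset.univ) (fun _ _ => Finset.mem_univ _) C (by
      intro b _
      apply hC
      intro x hx y hy
      rw [Finset.mem_filter] at hx hy
      simpa using hf x hx.1 y hy.1 (hx.2.trans hy.2.symm))
    simpa using this
  | succ m ih =>
    intro D hD hτ hD0 hC X hX
    have hθm : θ ^ (m + 1) ≤ 1 := pow_le_one₀ hθ.le hθ1
    have hτD : τ ≤ D := hτ.trans (by nlinarith)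
    obtain ⟨f, hf⟩ := hstep D hD hτD hD0 X hX
    have := Finset.card_le_mul_card_image_of_maps_to (f := f) (s := X) (t := Finset.univ) (fun _ _ => Finset.mem_univ _) (C * Fintype.card κ ^ (m + 1)) (by
      intro b _
      apply ih (θ * D) (by positivity) (by rw [← mul_assoc, ← pow_succ]; exact hτ) (by nlinarith)
      · intro Y hY
        apply hC Y
        intro x hx y hy
        refine (hY x hx y hy).trans (le_of_eq ?_)
        ring
      intro x hx y hy
      rw [Finset.mem_filter] at hx hy
      exact hf x hx.1 y hy.1 (hx.2.trans hy.2.symm))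
    rw [Finset.card_univ] at this
    rw [pow_succ, ← mul_assoc]; exact this

end CW

namespace CW
variable {n : ℕ}

lemma Mx_scale (F : Fam n) {D : ℝ} (hD : 0 < D) (x : EE n) (r : ℝ) :
    Mx (fun i y => F i (D • y)) x r = Mx F (D • x) (D * r) := by
  unfold Mx
  congr 1
  ext t
  constructor
  · rintro ⟨z, hz, rfl⟩
    refine ⟨D • z, ?_, rfl⟩
    rw [mem_ball, dist_smul₀, Real.norm_of_nonneg hD.le]
    rw [mem_ball] at hz
    gcongr
  · rintro ⟨z, hz, rfl⟩
    refine ⟨D⁻¹ • z, ?_, ?_⟩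
    · rw [mem_ball] at hz ⊢
      have : z = D • (D⁻¹ • z) := (smul_inv_smul₀ hD.ne' z).symm
      rw [this, dist_smul₀, Real.norm_of_nonneg hD.le] at hz
      exact lt_of_mul_lt_mul_left hz hD.le
    · unfold nF
      simp only [smul_inv_smul₀ hD.ne']

theorem core_scaled (hn : 2 ≤ n) : ∃ N₀ : ℝ, 0 < N₀ ∧ ∀ ε : ℝ, 0 < ε → ε ≤ 1 → ∃ s₀ : ℝ, 0 < s₀ ∧ ∃ R₀ : ℝ, 1 ≤ R₀ ∧ ∀ N : ℝ, N₀ ≤ N →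
    ∀ F : Fam n, SmF F → ∀ K : Set (EE n), Convex ℝ K → ∀ ℓ : ℝ, 0 < ℓ → (∀ x ∈ K, HaF F x ℓ) → (∀ x ∈ K, ∀ r : ℝ, 0 < r → 0 < Mx F x r) →
    (∀ x ∈ K, ∀ r : ℝ, 0 < r → r ≤ ℓ → Mx F x (10 * n * r) ≤ Real.exp ((1 + cc n) * N) * Mx F x r) →
    ∀ D : ℝ, 0 < D → D ≤ ℓ / R₀ →
    ∀ S : Set (EE n), S ⊆ K → (∀ x ∈ S, ∀ y ∈ S, ‖x - y‖ ≤ D) →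
    (∀ x ∈ S, ∃ r : ℝ, 0 < r ∧ r ≤ s₀ * D ∧ Real.exp N * Mx F x r ≤ Mx F x (10 * n * r)) →
    ∃ (p : EE n) (V : Submodule ℝ (EE n)), Module.finrank ℝ V + 2 ≤ n ∧ ∀ x ∈ S, ∃ v ∈ V, ‖x - (p + v)‖ ≤ ε * D := by
  obtain ⟨N₀, hN₀, hc⟩ := core hn
  refine ⟨N₀, hN₀, fun ε hε hε1 => ?_⟩
  obtain ⟨s₀, hs₀, R₀, hR₀, hc⟩ := hc ε hε hε1
  refine ⟨s₀, hs₀, R₀, hR₀, ?_⟩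
  intro N hN F hF K hK ℓ hℓ hha hpos hdb D hD hDl S hSK hS1 hbad
  rw [le_div_iff₀ (by linarith)] at hDl
  obtain ⟨p, V, hV, h⟩ := hc N hN (fun i y => F i (D • y)) (fun i => (hF i).comp_smul D) ((fun y => D • y) ⁻¹' K)
    (hK.linear_preimage (D • LinearMap.id)) (by
      intro x hx i y hy
      rw [lap_smul _ (hF i)]
      rw [hha _ hx i, mul_zero]
      rw [mem_ball] at hy ⊢
      rw [dist_smul₀, Real.norm_of_nonneg hD.le]
      exact lt_of_lt_of_le ((mul_lt_mul_iff_right₀ hD).2 hy) hDl)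
    (by
      intro x hx r hr
      rw [Mx_scale F hD]
      exact hpos _ hx _ (by positivity))
    (by
      intro x hx r hr hrR
      rw [Mx_scale F hD, Mx_scale F hD]
      have := hdb _ hx (D * r) (by positivity) ((mul_le_mul_of_nonneg_left hrR hD.le).trans hDl)
      rwa [mul_left_comm] at this)
    ((fun y => D • y) ⁻¹' S) (fun y hy => hSK hy) (by
      intro x hx y hy
      have := hS1 _ hx _ hy
      rw [← smul_sub, norm_smul, Real.norm_of_nonneg hD.le] at this
      have q : D * ‖x - y‖ ≤ D * 1 := by linarith
      exact le_of_mul_le_mul_left q hD)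
    (by
      intro x hx
      obtain ⟨r, hr, hrs, hb⟩ := hbad _ hx
      refine ⟨r / D, by positivity, by rwa [div_le_iff₀ hD], ?_⟩
      rw [Mx_scale F hD, Mx_scale F hD, mul_left_comm, mul_div_cancel₀ _ hD.ne']
      exact hb)
  refine ⟨D • p, V, hV, ?_⟩
  intro x hx
  obtain ⟨v, hv, h⟩ := h (D⁻¹ • x) (by show D • (D⁻¹ • x) ∈ S; rwa [smul_inv_smul₀ hD.ne'])
  refine ⟨D • v, V.smul_mem _ hv, ?_⟩
  have : x - (D • p + D • v) = D • (D⁻¹ • x - (p + v)) := by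
    rw [smul_sub, smul_inv_smul₀ hD.ne', smul_add]
  rw [this, norm_smul, Real.norm_of_nonneg hD.le, mul_comm]
  gcongr

lemma cube_convex (c : EE n) (ℓ : ℝ) : Convex ℝ (cube c ℓ) := by
  intro x hx y hy a b ha hb hab i
  have h1 := hx i
  have h2 := hy i
  have : (a • x + b • y) i - c i = a * (x i - c i) + b * (y i - c i) := by
    simp only [PiLp.add_apply, PiLp.smul_apply, smul_eq_mul]
    have : c i = (a + b) * c i := by rw [hab, one_mul]
    linear_combination -this
  rw [this]
  refine (abs_add_le _ _).trans ?_
  rw [abs_mul, abs_mul, abs_of_nonneg ha, abs_of_nonneg hb]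
  calc _ ≤ a * (ℓ / 2) + b * (ℓ / 2) := by gcongr
    _ = ℓ / 2 := by rw [← add_mul, hab, one_mul]

lemma sub_coord {c x : EE n} {ℓ : ℝ} (M : ℕ) (hM : 0 < M) (k : Fin n → Fin M) (hx : x ∈ cube (subCenter c ℓ M k) (ℓ / M)) (i : Fin n) :
    (k i : ℝ) * (ℓ / M) ≤ x i - c i + ℓ / 2 ∧ x i - c i + ℓ / 2 ≤ ((k i : ℝ) + 1) * (ℓ / M) := by
  have h := abs_le.1 (hx i)
  have hM' : (0:ℝ) < M := by exact_mod_cast hM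
  have e : subCenter c ℓ M k i = c i + (((k i : ℝ) + 1/2) / M - 1/2) * ℓ := rfl
  have e2 : (((k i : ℝ) + 1/2) / M - 1/2) * ℓ = (k i : ℝ) * (ℓ / M) + ℓ / M / 2 - ℓ / 2 := by field_simp
  rw [e, e2] at h
  constructor <;> linarith

lemma sub_cube {c x : EE n} {ℓ : ℝ} (hℓ : 0 < ℓ) (M : ℕ) (hM : 0 < M) (k : Fin n → Fin M) (hx : x ∈ cube (subCenter c ℓ M k) (ℓ / M)) :
    x ∈ cube c ℓ := by
  intro i
  have ⟨h1, h2⟩ := sub_coord M hM k hx i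
  have hM' : (0:ℝ) < M := by exact_mod_cast hM
  have q : 0 < ℓ / M := by positivity
  have h3 : 0 ≤ (k i : ℝ) * (ℓ / M) := by positivity
  have h4 : ((k i : ℝ) + 1) * (ℓ / M) ≤ M * (ℓ / M) := by
    gcongr
    exact_mod_cast (k i).2
  rw [mul_div_cancel₀ _ hM'.ne'] at h4
  rw [abs_le]; constructor <;> linarith

lemma coord_le (x : EE n) (i : Fin n) : |x i| ≤ ‖x‖ := PiLp.norm_apply_le x i

lemma small_count {M : ℕ} (hM : 0 < M) {c : EE n} {ℓ s₀ : ℝ} (hℓ : 0 < ℓ) (hs₀ : 0 < s₀) (B : Set (Fin n → Fin M)) (pt : B → EE n)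
    (hpt : ∀ k : B, pt k ∈ cube (subCenter c ℓ M k) (ℓ / M)) (X : Finset B)
    (hX : ∀ x ∈ X, ∀ y ∈ X, ‖pt x - pt y‖ ≤ ℓ / M / s₀) : X.card ≤ (2 * (⌊1 / s₀⌋₊ + 1) + 1) ^ n := by
  rcases X.eq_empty_or_nonempty with rfl | ⟨k0, hk0⟩
  · simp
  set W : ℕ := ⌊1 / s₀⌋₊ + 1 with hW
  have hM' : (0:ℝ) < M := by exact_mod_cast hM
  have q : 0 < ℓ / M := by positivity
  let g : B → (Fin n → ℤ) := fun k i => ((k.1 i : ℕ) : ℤ)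
  have hg : Function.Injective g := by
    intro a b hab
    apply Subtype.ext
    funext i
    have := congrFun hab i
    simp only [g] at this
    exact Fin.ext (by exact_mod_cast this)
  have hmaps : ∀ k ∈ X, g k ∈ Fintype.piFinset (fun i => Finset.Icc (g k0 i - W) (g k0 i + W)) := by
    intro k hk
    rw [Fintype.mem_piFinset]
    intro i
    have a1 := sub_coord M hM k.1 (hpt k) i
    have a2 := sub_coord M hM k0.1 (hpt k0) i
    have a3 := abs_le.1 ((coord_le (pt k - pt k0) i).trans (hX k hk k0 hk0))
    rw [PiLp.sub_apply] at a3
    have e : ℓ / M / s₀ = (1 / s₀) * (ℓ / M) := by ring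
    rw [e] at a3
    have a4 := Nat.lt_floor_add_one (1 / s₀)
    have a5 : (1 / s₀) < (W:ℝ) := by rw [hW]; push_cast; exact a4
    have b1 : ((k.1 i : ℕ) : ℝ) * (ℓ / M) < ((k0.1 i : ℕ) + 1 + W : ℝ) * (ℓ / M) := by
      have := mul_lt_mul_of_pos_right a5 q
      linarith
    have b2 : ((k0.1 i : ℕ) : ℝ) * (ℓ / M) < ((k.1 i : ℕ) + 1 + W : ℝ) * (ℓ / M) := by
      have := mul_lt_mul_of_pos_right a5 q
      linarith
    have b1' := lt_of_mul_lt_mul_right b1 q.le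
    have b2' := lt_of_mul_lt_mul_right b2 q.le
    norm_cast at b1' b2'
    rw [Finset.mem_Icc]
    simp only [g]
    constructor <;> omega
  have h1 := Finset.card_le_card_of_injOn g hmaps hg.injOn
  refine h1.trans (le_of_eq ?_)
  rw [Fintype.card_piFinset]
  have : ∀ i : Fin n, (Finset.Icc (g k0 i - W) (g k0 i + W)).card = 2 * W + 1 := by
    intro i
    rw [Int.card_Icc]; omega
  simp [this]

lemma eps_choice (hn : 2 ≤ n) {δ : ℝ} (hδ : 0 < δ) : ∃ ε : ℝ, 0 < ε ∧ ε ≤ 1 ∧ (3 * n + 2) * ε < 1 ∧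
    (((⌊2 / ε⌋₊ + 1) ^ (n - 2) : ℕ) : ℝ) ≤ ((3 * n + 2) * ε) ^ (-((n:ℝ) - 2 + δ / 2)) := by
  set P : ℝ := (9 * n + 6) ^ (n - 2) + 1 with hP
  have hP1 : 1 < P := by
    have : (0:ℝ) < (9 * n + 6) ^ (n - 2) := by positivity
    rw [hP]; linarith
  set θ : ℝ := P ^ (-(2 / δ)) with hθ
  have hP0 : 0 < P := by linarith
  have hθ0 : 0 < θ := Real.rpow_pos_of_pos hP0 _
  have h2δ : 0 < 2 / δ := by positivity
  have hθ1 : θ < 1 := Real.rpow_lt_one_of_one_lt_of_neg hP1 (by linarith)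
  have hn0 : (0:ℝ) ≤ n := by positivity
  have hq : (0:ℝ) < 3 * n + 2 := by positivity
  have hε1 : θ / (3 * n + 2) ≤ 1 := by rw [div_le_one hq]; linarith
  have hε0 : 0 < θ / (3 * n + 2) := by positivity
  have e : (3 * n + 2) * (θ / (3 * n + 2)) = θ := by field_simp
  refine ⟨θ / (3 * n + 2), hε0, hε1, by rw [e]; exact hθ1, ?_⟩
  rw [e]
  have h1 : ((⌊2 / (θ / (3 * n + 2))⌋₊ + 1 : ℕ) : ℝ) ≤ (9 * n + 6) / θ := by
    push_cast
    have a1 := Nat.floor_le (show 0 ≤ 2 / (θ / (3 * (n:ℝ) + 2)) by positivity)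
    have a2 : 1 ≤ (3 * n + 2) / θ := by rw [le_div_iff₀ hθ0]; linarith
    have a3 : 2 / (θ / (3 * (n:ℝ) + 2)) = 2 * ((3 * n + 2) / θ) := by field_simp
    have a4 : (9 * (n:ℝ) + 6) / θ = 3 * ((3 * n + 2) / θ) := by ring
    rw [a4]; rw [a3] at a1 ⊢; linarith
  have h2 : θ ^ (-((n:ℝ) - 2 + δ / 2)) = P * (θ ^ (n - 2))⁻¹ := by
    have : -((n:ℝ) - 2 + δ / 2) = -(δ / 2) + -((n - 2 : ℕ) : ℝ) := by
      rw [Nat.cast_sub hn]; push_cast; ring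
    rw [this, Real.rpow_add hθ0, Real.rpow_neg hθ0.le ((n - 2 : ℕ) : ℝ), Real.rpow_natCast]
    congr 1
    rw [hθ, ← Real.rpow_mul hP0.le]
    have : -(2 / δ) * -(δ / 2) = 1 := by field_simp
    rw [this, Real.rpow_one]
  rw [h2]
  rw [Nat.cast_pow]
  calc _ ≤ ((9 * n + 6) / θ) ^ (n - 2) := by gcongr
    _ = (9 * n + 6) ^ (n - 2) * (θ ^ (n - 2))⁻¹ := by rw [div_pow]; rfl
    _ ≤ _ := by gcongr; linarith

set_option maxHeartbeats 1000000 in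
theorem count (hn : 2 ≤ n) : ∃ N₀ : ℝ, 0 < N₀ ∧ ∀ δ : ℝ, 0 < δ → ∃ A₀ : ℕ, ∀ M : ℕ, A₀ ≤ M → ∀ N : ℝ, N₀ ≤ N →
    ∀ F : Fam n, SmF F → ∀ (c : EE n) (ℓ : ℝ), 0 < ℓ → (∀ x ∈ cube c ℓ, HaF F x ℓ) → (∀ x ∈ cube c ℓ, ∀ r : ℝ, 0 < r → 0 < Mx F x r) →
    (∀ x ∈ cube c ℓ, ∀ r : ℝ, 0 < r → r ≤ ℓ → Mx F x (10 * n * r) ≤ Real.exp ((1 + cc n) * N) * Mx F x r) →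
    ∀ B : Set (Fin n → Fin M), (∀ k ∈ B, ∃ x ∈ cube (subCenter c ℓ M k) (ℓ / M), ∃ r : ℝ, 0 < r ∧ r ≤ ℓ / M ∧
      Real.exp N * Mx F x r ≤ Mx F x (10 * n * r)) → (B.ncard : ℝ) < (1/2) * (M:ℝ) ^ ((n:ℝ) - 2 + δ) := by
  classical
  obtain ⟨N₀, hN₀, hc⟩ := core_scaled hn
  refine ⟨N₀, hN₀, fun δ hδ => ?_⟩
  obtain ⟨ε, hε, hε1, hθ1, hκ⟩ := eps_choice hn hδ
  obtain ⟨s₀, hs₀, R₀, hR₀, hc⟩ := hc ε hε hε1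
  set θ : ℝ := (3 * n + 2) * ε with hθ
  have hθ0 : 0 < θ := by positivity
  set a : ℝ := (n:ℝ) - 2 + δ / 2 with ha
  have hn2 : (2:ℝ) ≤ n := by exact_mod_cast hn
  have ha0 : 0 ≤ a := by rw [ha]; linarith
  have hR0 : 0 < R₀ := by linarith
  set C' : ℕ := (2 * (⌊1 / s₀⌋₊ + 1) + 1) ^ n with hC'
  set η : ℝ := 1 / (n * R₀) with hη
  have hη0 : 0 < η := by positivity
  set C₀ : ℕ := (⌊2 / η⌋₊ + 1) ^ n with hC₀
  set κ : ℕ := (⌊2 / ε⌋₊ + 1) ^ (n - 2) with hκd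
  set C2 : ℝ := C' * C₀ * (θ ^ (-a) * (R₀ / s₀) ^ (-a)) with hC2
  have hlim : Filter.Tendsto (fun M : ℕ => (M:ℝ) ^ (δ / 2)) Filter.atTop Filter.atTop :=
    (tendsto_rpow_atTop (by positivity)).comp tendsto_natCast_atTop_atTop
  obtain ⟨A₁, hA₁⟩ := Filter.eventually_atTop.1 (hlim.eventually_gt_atTop (2 * C2))
  refine ⟨max (max A₁ 1) (⌈R₀ / s₀⌉₊), ?_⟩
  intro M hM N hN F hF c ℓ hℓ hha hpos hdb B hB
  have hMA : A₁ ≤ M := by omega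
  have hM1 : 0 < M := by omega
  have hMR : R₀ / s₀ ≤ M := by
    refine (Nat.le_ceil _).trans ?_
    exact_mod_cast (by omega : ⌈R₀ / s₀⌉₊ ≤ M)
  have hM0 : (0:ℝ) < M := by exact_mod_cast hM1
  have hex : ∀ k : B, ∃ x ∈ cube (subCenter c ℓ M k) (ℓ / M), ∃ r : ℝ, 0 < r ∧ r ≤ ℓ / M ∧
      Real.exp N * Mx F x r ≤ Mx F x (10 * n * r) := fun k => hB k.1 k.2
  choose pt hpt hbad using hex
  have hptQ : ∀ k, pt k ∈ cube c ℓ := fun k => sub_cube hℓ M hM1 k.1 (hpt k)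
  set τ : ℝ := ℓ / M / s₀ with hτ
  have hstep : ∀ D : ℝ, 0 < D → τ ≤ D → D ≤ ℓ / R₀ → ∀ X : Finset B, (∀ x ∈ X, ∀ y ∈ X, ‖pt x - pt y‖ ≤ D) →
      ∃ f : B → (Fin (n - 2) → Fin (⌊2 / ε⌋₊ + 1)), ∀ x ∈ X, ∀ y ∈ X, f x = f y → ‖pt x - pt y‖ ≤ θ * D := by
    intro D hD hτD hDR X hX
    rw [hτ, div_le_iff₀ hs₀] at hτD
    obtain ⟨p, V, hV, h⟩ := hc N hN F hF (cube c ℓ) (cube_convex c ℓ) ℓ hℓ hha hpos hdb D hD hDR (pt '' (X : Set B))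
      (by rintro _ ⟨k, _, rfl⟩; exact hptQ k)
      (by rintro _ ⟨k, hk, rfl⟩ _ ⟨l, hl, rfl⟩; exact hX k hk l hl)
      (by
        rintro _ ⟨k, _, rfl⟩
        obtain ⟨r, h1, h2, h3⟩ := hbad k
        exact ⟨r, h1, by linarith, h3⟩)
    exact plane_cover hn pt (X : Set B) hD hε hX p V hV (fun x hx => h _ ⟨x, hx, rfl⟩)
  set x₀ : ℝ := R₀ / s₀ / M with hx₀
  have hx₀0 : 0 < x₀ := by positivity
  obtain ⟨m, hm1, hm2⟩ := exists_nat_pow_near_of_lt_one hx₀0 ((div_le_one hM0).2 hMR) hθ0 hθ1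
  have hD₀ : 0 < ℓ / R₀ := by positivity
  have hτx : τ = x₀ * (ℓ / R₀) := by rw [hτ, hx₀]; field_simp
  have hit := iter pt hθ0 hθ1.le C' hstep m (ℓ / R₀) hD₀ (by rw [hτx]; gcongr) le_rfl (by
    intro X hX
    apply small_count hM1 hℓ hs₀ B pt hpt X
    intro x hx y hy
    refine (hX x hx y hy).trans ?_
    rw [← hτ, hτx]; gcongr)
  have hcard : Fintype.card (Fin (n - 2) → Fin (⌊2 / ε⌋₊ + 1)) = κ := by simp [hκd]
  rw [hcard] at hit
  obtain ⟨f, hf⟩ := rounding (d := n) (Set.univ : Set B) (fun i k => pt k i / ℓ) (by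
    intro x _ y _ i
    have h1 := abs_le.1 (hptQ x i)
    have h2 := abs_le.1 (hptQ y i)
    rw [← sub_div, abs_div, abs_of_pos hℓ, div_le_one hℓ, abs_le]
    constructor <;> linarith) hη0
  have htot := Finset.card_le_mul_card_image_of_maps_to (f := f) (s := (Finset.univ : Finset B)) (t := Finset.univ) (fun _ _ => Finset.mem_univ _)
    (C' * κ ^ (m + 1)) (by
      intro b _
      apply hit
      intro x hx y hy
      rw [Finset.mem_filter] at hx hy
      have h1 := hf x (mem_univ _) y (mem_univ _) (hx.2.trans hy.2.symm)
      have h2 := norm_le_basis (EuclideanSpace.basisFun (Fin n) ℝ) (pt x - pt y) (c := η * ℓ) (by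
        intro i
        have := h1 i
        rw [← sub_div, abs_div, abs_of_pos hℓ, div_le_iff₀ hℓ] at this
        rw [EuclideanSpace.basisFun_apply, EuclideanSpace.inner_single_left]
        simpa using this)
      refine h2.trans (le_of_eq ?_)
      rw [hη]; field_simp)
  have hB' : B.ncard = (Finset.univ : Finset B).card := by
    rw [Finset.card_univ, ← Nat.card_eq_fintype_card]; rfl
  rw [← hB', Finset.card_univ] at htot
  have hcard2 : Fintype.card (Fin n → Fin (⌊2 / η⌋₊ + 1)) = C₀ := by simp [hC₀]
  rw [hcard2] at htot
  have htot' : (B.ncard : ℝ) ≤ C' * (κ:ℝ) ^ (m + 1) * C₀ := by exact_mod_cast htot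
  have hκm : (κ:ℝ) ^ (m + 1) ≤ θ ^ (-a) * ((R₀ / s₀) ^ (-a) * (M:ℝ) ^ a) := by
    calc (κ:ℝ) ^ (m + 1) ≤ (θ ^ (-a)) ^ (m + 1) := by gcongr
      _ = θ ^ (-a) * (θ ^ m) ^ (-a) := by
        rw [pow_succ, mul_comm]
        congr 1
        rw [← Real.rpow_natCast, ← Real.rpow_natCast, ← Real.rpow_mul hθ0.le, ← Real.rpow_mul hθ0.le, mul_comm]
      _ ≤ θ ^ (-a) * x₀ ^ (-a) := by
        gcongr 1
        exact Real.rpow_le_rpow_of_nonpos hx₀0 hm2 (by linarith)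
      _ = _ := by
        congr 1
        rw [hx₀, Real.div_rpow (by positivity) hM0.le, Real.rpow_neg hM0.le, div_inv_eq_mul]
  have hfin := hA₁ M hMA
  have hMa : (0:ℝ) < (M:ℝ) ^ a := Real.rpow_pos_of_pos hM0 _
  have hsplit : (M:ℝ) ^ ((n:ℝ) - 2 + δ) = (M:ℝ) ^ a * (M:ℝ) ^ (δ / 2) := by
    rw [← Real.rpow_add hM0]; congr 1; rw [ha]; ring
  rw [hsplit]
  calc (B.ncard : ℝ) ≤ C' * (κ:ℝ) ^ (m + 1) * C₀ := htot'
    _ ≤ C' * (θ ^ (-a) * ((R₀ / s₀) ^ (-a) * (M:ℝ) ^ a)) * C₀ := by gcongr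
    _ = C2 * (M:ℝ) ^ a := by rw [hC2]; ring
    _ < 1 / 2 * ((M:ℝ) ^ a * (M:ℝ) ^ (δ / 2)) := by
      have := mul_lt_mul_of_pos_right hfin hMa
      linarith

end CW

namespace CW
variable {n : ℕ}

lemma cube_norm {c x : EE n} {ℓ : ℝ} (hx : x ∈ cube c ℓ) : ‖x - c‖ ≤ n * (ℓ / 2) := by
  refine norm_le_basis (EuclideanSpace.basisFun (Fin n) ℝ) (x - c) ?_
  intro i
  rw [EuclideanSpace.basisFun_apply, EuclideanSpace.inner_single_left]
  simpa using hx i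

lemma cube_compact (c : EE n) (ℓ : ℝ) : IsCompact (cube c ℓ) := by
  apply Metric.isCompact_of_isClosed_isBounded
  · have : cube c ℓ = ⋂ i, {x : EE n | |x i - c i| ≤ ℓ / 2} := by
      ext x; simp [cube]
    rw [this]
    apply isClosed_iInter
    intro i
    apply isClosed_le _ continuous_const
    fun_prop
  · apply (Metric.isBounded_closedBall (x := c) (r := n * (ℓ / 2))).subset
    intro x hx
    rw [mem_closedBall, dist_eq_norm]; exact cube_norm hx

lemma norm_fderiv_eq (f : EE n → ℝ) (x : EE n) : ‖fderiv ℝ f x‖ = nF (fun i => D (ev i) f) x := by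
  rw [← (InnerProductSpace.toDual ℝ (EE n)).symm.norm_map, EuclideanSpace.norm_eq]
  unfold nF
  congr 1
  apply Finset.sum_congr rfl
  intro i _
  rw [Real.norm_eq_abs, sq_abs]
  congr 1
  have : inner ℝ ((InnerProductSpace.toDual ℝ (EE n)).symm (fderiv ℝ f x)) (ev i) = fderiv ℝ f x (ev i) :=
    InnerProductSpace.toDual_symm_apply
  show _ = fderiv ℝ f x (ev i)
  rw [← this, ev, EuclideanSpace.inner_single_right]
  simp

lemma setup (hn : 1 ≤ n) {u : EE n → ℝ} {c : EE n} {ℓ : ℝ} (hℓ : 0 < ℓ) (hu : IsHarmonicOn u (ball c (100 * n * ℓ))) :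
    ∃ F : Fam n, SmF F ∧ HaF F c (60 * n * ℓ) ∧ (∀ x ∈ ball c (60 * n * ℓ), ∑ i, D (ev i) (F i) x = 0) ∧
      ∀ x r, ball x r ⊆ ball c (60 * n * ℓ) → supGrad u (ball x r) = Mx F x r := by
  have hn' : (1:ℝ) ≤ n := by exact_mod_cast hn
  have hnl : 0 < n * ℓ := by positivity
  let χ : ContDiffBump c := ⟨60 * n * ℓ, 80 * n * ℓ, by positivity, by linarith⟩
  set v : EE n → ℝ := fun x => χ x * u x with hv
  have hvs : Sm v := by
    refine contDiff_iff_contDiffAt.2 ?_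
    intro x
    by_cases hx : x ∈ ball c (100 * n * ℓ)
    · exact χ.contDiffAt.mul (hu.1.contDiffAt (isOpen_ball.mem_nhds hx))
    · have hx2 : x ∈ (closedBall c (80 * n * ℓ))ᶜ := by
        rw [mem_compl_iff, mem_closedBall]
        rw [mem_ball] at hx
        intro h; apply hx; linarith
      have : v =ᶠ[nhds x] fun _ => 0 := by
        filter_upwards [isClosed_closedBall.isOpen_compl.mem_nhds hx2] with y hy
        have : χ y = 0 := χ.zero_of_le_dist (by
          rw [mem_compl_iff, mem_closedBall] at hy
          exact (not_le.1 hy).le)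
        simp [hv, this]
      exact contDiffAt_const.congr_of_eventuallyEq this
  have hveq : ∀ x ∈ ball c (60 * n * ℓ), v =ᶠ[nhds x] u := by
    intro x hx
    filter_upwards [isOpen_ball.mem_nhds hx] with y hy
    have : χ y = 1 := χ.one_of_mem_closedBall (ball_subset_closedBall hy)
    simp [hv, this]
  have hlap : ∀ x ∈ ball c (60 * n * ℓ), lap v x = 0 := by
    intro x hx
    rw [lap_congr (hveq x hx)]
    exact hu.2 x (ball_subset_ball (by linarith) hx)
  refine ⟨fun i => D (ev i) v, fun i => hvs.D _, fun i => lap_D hvs isOpen_ball hlap _, hlap, ?_⟩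
  intro x r hr
  unfold supGrad Mx
  congr 1
  apply image_congr
  intro y hy
  show ‖fderiv ℝ u y‖ = _
  rw [← (hveq y (hr hy)).fderiv_eq, norm_fderiv_eq]

lemma zero_prop {F : Fam n} (hF : SmF F) {y : EE n} {R r : ℝ} (hr : 0 < r) (hha : HaF F y (4 * R)) (hz : Mx F y r = 0) (hR : 0 < R) :
    Mx F y R = 0 := by
  have key : ∀ k : ℕ, ∀ s : ℝ, 0 < s → s ≤ 2 * R → s / 2 ^ k ≤ r → H F y s = 0 := by
    intro k
    induction k with
    | zero =>
      intro s hs _ hsr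
      rw [pow_zero, div_one] at hsr
      have h1 := H_le hF y hs
      have h2 : Mx F y s = 0 := le_antisymm (hz ▸ Mx_mono' hF hsr) (Mx_nonneg _ _ _)
      rw [h2] at h1
      exact le_antisymm (by simpa using h1) (H_nonneg hF y s)
    | succ k ih =>
      intro s hs hsR hsr
      have h0 : H F y (s / 2) = 0 := ih _ (by positivity) (by linarith) (by rw [div_div, ← pow_succ']; exact hsr)
      have := H_logconv hF hha (a := s / 2) (b := 2 * s) (s := s) (by positivity) (by positivity) hs (by linarith) (by linarith) (by linarith) (by ring)
      rw [h0, zero_mul] at this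
      exact pow_eq_zero_iff (two_ne_zero) |>.1 (le_antisymm this (sq_nonneg _))
  obtain ⟨k, hk⟩ := pow_unbounded_of_one_lt (2 * R / r) (one_lt_two : (1:ℝ) < 2)
  have hH := key k (2 * R) (by positivity) le_rfl (by
    rw [div_lt_iff₀ hr] at hk
    rw [div_le_iff₀ (by positivity)]; linarith)
  have h := Mx_sq_le hF (x := y) (s := R) (ε := 1) hR one_pos (HaF.mono hha (by linarith))
  rw [show R * (1 + 1) = 2 * R by ring, hH, mul_zero] at h
  exact pow_eq_zero_iff (two_ne_zero) |>.1 (le_antisymm h (sq_nonneg _))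

lemma lower_bd {F : Fam n} (hF : SmF F) {K : Set (EE n)} (hK : IsCompact K) (hpos : ∀ x ∈ K, ∀ r : ℝ, 0 < r → 0 < Mx F x r) {ρ : ℝ} (hρ : 0 < ρ) :
    ∃ m : ℝ, 0 < m ∧ ∀ x ∈ K, m ≤ Mx F x ρ := by
  refine hK.induction_on (p := fun s => ∃ m : ℝ, 0 < m ∧ ∀ x ∈ s, m ≤ Mx F x ρ) ⟨1, one_pos, by simp⟩ ?_ ?_ ?_
  · rintro s t hst ⟨m, hm, h⟩
    exact ⟨m, hm, fun x hx => h x (hst hx)⟩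
  · rintro s t ⟨m, hm, h⟩ ⟨m', hm', h'⟩
    refine ⟨min m m', lt_min hm hm', ?_⟩
    rintro x (hx | hx)
    · exact (min_le_left _ _).trans (h x hx)
    · exact (min_le_right _ _).trans (h' x hx)
  · intro x hx
    refine ⟨ball x (ρ / 2), mem_nhdsWithin_of_mem_nhds (ball_mem_nhds x (by positivity)), Mx F x (ρ / 2), hpos x hx _ (by positivity), ?_⟩
    intro y hy
    apply Mx_mono hF
    apply ball_subset_ball'
    rw [mem_ball, dist_comm] at hy
    linarith

lemma index_bdd (hn : 1 ≤ n) {F : Fam n} (hF : SmF F) {K : Set (EE n)} (hK : IsCompact K) {ℓ : ℝ} (hℓ : 0 < ℓ)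
    (hha : ∀ x ∈ K, HaF F x ℓ) (hpos : ∀ x ∈ K, ∀ r : ℝ, 0 < r → 0 < Mx F x r) {U : ℝ} (hU : ∀ x ∈ K, Mx F x (10 * n * ℓ) ≤ U) :
    ∃ C : ℝ, ∀ x ∈ K, ∀ r : ℝ, 0 < r → r ≤ ℓ → Real.log (Mx F x (10 * n * r) / Mx F x r) ≤ C := by
  obtain ⟨N₁, hN₁, hb⟩ := bad_decay hn (η := 1/2) (by norm_num) (by norm_num)
  have hn' : (1:ℝ) ≤ n := by exact_mod_cast hn
  set ρ : ℝ := ((10 * n : ℝ) ^ 10)⁻¹ with hρ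
  have hρ0 : 0 < ρ := by positivity
  have hlog := logL_ge hn
  have hρ1 : ρ * (20 * n) ≤ 1 := by
    rw [hρ, inv_mul_le_iff₀ (by positivity), mul_one]
    have h1 : (10:ℝ) ≤ 10 * n := by linarith
    have h2 : (10 * n : ℝ) ^ 2 ≤ (10 * n) ^ 10 := pow_le_pow_right₀ (by linarith) (by norm_num)
    nlinarith
  obtain ⟨m, hm, hlow⟩ := lower_bd hF hK hpos (ρ := ℓ * ρ) (by positivity)
  refine ⟨max N₁ (Real.log (U / m)), ?_⟩
  intro x hx r hr hrl
  have p1 := hpos x hx r hr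
  have p2 := hpos x hx (10 * n * r) (by positivity)
  by_contra hcon
  rw [not_le, max_lt_iff] at hcon
  obtain ⟨hc1, hc2⟩ := hcon
  set q := Mx F x (10 * n * r) / Mx F x r with hq
  have hq0 : 0 < q := by positivity
  have hUx : Mx F x ℓ ≤ U := (Mx_mono' hF (by nlinarith)).trans (hU x hx)
  have hmU : 0 < U := lt_of_lt_of_le (hpos x hx ℓ hℓ) hUx
  have hgoal : q ≤ U / m := by
    rcases le_total r (ℓ * ρ) with h | h
    · have hsx : ℓ • (ℓ⁻¹ • x) = x := smul_inv_smul₀ hℓ.ne' x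
      have := hb (Real.log q) hc1.le (fun i y => F i (ℓ • y)) (fun i => (hF i).comp_smul ℓ) (ℓ⁻¹ • x)
        (by
          intro i y hy
          rw [lap_smul _ (hF i), hha x hx i, mul_zero]
          rw [mem_ball] at hy ⊢
          rw [← hsx, dist_smul₀, Real.norm_of_nonneg hℓ.le]
          calc _ < ℓ * 1 := (mul_lt_mul_iff_right₀ hℓ).2 hy
            _ = ℓ := mul_one _)
        (by
          intro s hs
          rw [Mx_scale F hℓ, hsx]
          exact hpos x hx _ (by positivity))
        (r / ℓ) (by positivity) (by
          have : r / ℓ ≤ ρ := by rw [div_le_iff₀ hℓ]; linarith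
          nlinarith)
        (by
          rw [Mx_scale F hℓ, Mx_scale F hℓ, hsx, mul_left_comm, mul_div_cancel₀ _ hℓ.ne', Real.exp_log hq0, hq, div_mul_cancel₀ _ p1.ne'])
        ρ (by rw [div_le_iff₀ hℓ]; linarith) (by nlinarith)
      rw [Mx_scale F hℓ, Mx_scale F hℓ, hsx, mul_one] at this
      have e1 : Real.log (1 / ρ) = 10 * Real.log (10 * n) := by
        rw [hρ, one_div, inv_inv, Real.log_pow]; norm_num
      have e2 : 4 * Real.log q - (1 - 1/2) * Real.log q / Real.log (10 * n) * Real.log (1 / ρ) = - Real.log q := by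
        rw [e1]; field_simp; ring
      rw [e2, Real.exp_neg, Real.exp_log hq0] at this
      have h3 := (hlow x hx).trans this
      rw [le_div_iff₀ hm]
      have h4 : m ≤ q⁻¹ * U := h3.trans (by gcongr)
      rw [inv_mul_eq_div, le_div_iff₀ hq0] at h4
      linarith
    · have a1 : m ≤ Mx F x r := (hlow x hx).trans (Mx_mono' hF h)
      have a2 : Mx F x (10 * n * r) ≤ U := (Mx_mono' hF (by gcongr)).trans (hU x hx)
      rw [hq]
      gcongr
  have := Real.log_le_log hq0 hgoal
  linarith

lemma empty_concl {M : ℕ} {B : Set (Fin n → Fin M)} {A : ℕ} {a : ℝ} (h : ∀ k, k ∉ B) : (B.ncard : ℝ) < (1 / 2) * (2 * (A:ℝ) + 1) ^ a := by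
  have : B = ∅ := Set.eq_empty_of_forall_notMem h
  rw [this]
  have : (0:ℝ) < (2 * (A:ℝ) + 1) ^ a := Real.rpow_pos_of_pos (by positivity) _
  simp only [Set.ncard_empty, Nat.cast_zero]
  linarith

lemma index_nonpos {u : EE n → ℝ} {c : EE n} {ℓ : ℝ} 
    (h : ∀ x ∈ cube c ℓ, ∀ r : ℝ, 0 < r → r ≤ ℓ → supGrad u (ball x (10 * n * r)) = supGrad u (ball x r) ∨ supGrad u (ball x (10 * n * r)) = 0) :
    cubeDoublingIndex u c ℓ ≤ 0 := by
  apply Real.sSup_le _ le_rfl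
  rintro t ⟨x, hx, r, hr, hrl, rfl⟩
  rcases h x hx r hr hrl with h | h
  · rw [h]
    rcases eq_or_ne (supGrad u (ball x r)) 0 with h0 | h0
    · simp [h0]
    · simp [h0]
  · simp [h]

set_option maxHeartbeats 1000000 in
theorem main (n : ℕ) :
    ∃ N₀ : ℝ, 0 < N₀ ∧ ∀ δ : ℝ, 0 < δ → ∃ A₀ : ℕ, ∀ A : ℕ, A₀ ≤ A →
    ∀ N : ℝ, N₀ < N → ∀ (cQ : EE n) (ℓ : ℝ), 0 < ℓ → ∀ u, IsHarmonicOn u (ball cQ (100 * n * ℓ)) →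
      cubeDoublingIndex u cQ ℓ ≤ (1 + cc n) * N →
      (Set.ncard {k : Fin n → Fin (2*A+1) | N < cubeDoublingIndex u (subCenter cQ ℓ (2*A+1) k) (ℓ/(2*(A:ℝ)+1))} : ℝ) < (1/2) * (2*(A:ℝ)+1) ^ ((n:ℝ) - 2 + δ) := by
  rcases Nat.eq_zero_or_pos n with rfl | hn1
  · refine ⟨1, one_pos, fun δ _ => ⟨0, fun A _ N hN cQ ℓ hℓ u hu _ => empty_concl ?_⟩⟩
    intro k hk
    have : cubeDoublingIndex u (subCenter cQ ℓ (2*A+1) k) (ℓ/(2*(A:ℝ)+1)) ≤ 0 := by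
      apply index_nonpos
      intro x _ r _ _
      right
      simp [supGrad]
    have hk' := lt_of_lt_of_le hk this
    linarith
  have hn' : (1:ℝ) ≤ n := by exact_mod_cast hn1
  obtain ⟨N₀, hN₀, hc⟩ : ∃ N₀ : ℝ, 0 < N₀ ∧ ∀ δ : ℝ, 0 < δ → ∃ A₀ : ℕ, ∀ M : ℕ, A₀ ≤ M → ∀ N : ℝ, N₀ ≤ N →
    ∀ F : Fam n, SmF F → ∀ (c : EE n) (ℓ : ℝ), 0 < ℓ → (∀ x ∈ cube c ℓ, HaF F x ℓ) → (∀ x ∈ cube c ℓ, ∀ r : ℝ, 0 < r → 0 < Mx F x r) →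
    (∀ x ∈ cube c ℓ, ∀ r : ℝ, 0 < r → r ≤ ℓ → Mx F x (10 * n * r) ≤ Real.exp ((1 + cc n) * N) * Mx F x r) →
    (n = 1 → False) →
    ∀ B : Set (Fin n → Fin M), (∀ k ∈ B, ∃ x ∈ cube (subCenter c ℓ M k) (ℓ / M), ∃ r : ℝ, 0 < r ∧ r ≤ ℓ / M ∧
      Real.exp N * Mx F x r ≤ Mx F x (10 * n * r)) → (B.ncard : ℝ) < (1/2) * (M:ℝ) ^ ((n:ℝ) - 2 + δ) := by
    by_cases h1 : n = 1
    · refine ⟨1, one_pos, fun δ _ => ⟨0, ?_⟩⟩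
      intro _ _ _ _ _ _ _ _ _ _ _ _ h
      exact absurd h1 h
    · obtain ⟨N₀, hN₀, hc⟩ := count (n := n) (by omega)
      refine ⟨N₀, hN₀, fun δ hδ => ?_⟩
      obtain ⟨A₀, hc⟩ := hc δ hδ
      exact ⟨A₀, fun M hM N hN F hF c ℓ hℓ a1 a2 a3 _ => hc M hM N hN F hF c ℓ hℓ a1 a2 a3⟩
  refine ⟨N₀, hN₀, fun δ hδ => ?_⟩
  obtain ⟨A₀, hc⟩ := hc δ hδ
  refine ⟨A₀, fun A hA N hN cQ ℓ hℓ u hu hidx => ?_⟩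
  obtain ⟨F, hF, hha, hdiv, hsup⟩ := setup hn1 hℓ hu
  have hnl : 0 < n * ℓ := by positivity
  have hnl' : ℓ ≤ n * ℓ := by nlinarith
  have hM0 : (0:ℝ) < 2 * (A:ℝ) + 1 := by positivity
  have hMl : ℓ / (2 * (A:ℝ) + 1) ≤ ℓ := div_le_self hℓ.le (by have : (0:ℝ) ≤ A := by positivity
                                                              linarith)
  have hcast : ((2 * A + 1 : ℕ) : ℝ) = 2 * (A:ℝ) + 1 := by push_cast; ring
  have hsubQ : ∀ (k : Fin n → Fin (2*A+1)), ∀ x ∈ cube (subCenter cQ ℓ (2*A+1) k) (ℓ/(2*(A:ℝ)+1)), x ∈ cube cQ ℓ := by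
    intro k x hx
    apply sub_cube hℓ (2 * A + 1) (by omega) k
    rw [hcast]; exact hx
  have hballs : ∀ x ∈ cube cQ ℓ, ∀ r : ℝ, r ≤ 50 * (n * ℓ) → ball x r ⊆ ball cQ (60 * n * ℓ) := by
    intro x hx r hr
    apply ball_subset_ball'
    have := cube_norm hx
    rw [dist_eq_norm]
    linarith
  have h10 : ∀ r : ℝ, r ≤ ℓ → 10 * n * r ≤ 50 * (n * ℓ) := by
    intro r hr
    have : n * r ≤ n * ℓ := by gcongr
    linarith
  have hsup1 : ∀ x ∈ cube cQ ℓ, ∀ r : ℝ, r ≤ ℓ → supGrad u (ball x r) = Mx F x r := by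
    intro x hx r hr
    exact hsup x r (hballs x hx r (by linarith))
  have hsup2 : ∀ x ∈ cube cQ ℓ, ∀ r : ℝ, r ≤ ℓ → supGrad u (ball x (10 * n * r)) = Mx F x (10 * n * r) := by
    intro x hx r hr
    exact hsup x _ (hballs x hx _ (h10 r hr))
  have hhaQ : ∀ x ∈ cube cQ ℓ, ∀ r : ℝ, r ≤ 50 * (n * ℓ) → HaF F x r :=
    fun x hx r hr i y hy => hha i y (hballs x hx r hr hy)
  by_cases hz : ∃ y ∈ cube cQ ℓ, ∃ r : ℝ, 0 < r ∧ Mx F y r = 0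
  · obtain ⟨y, hy, r, hr, hyr⟩ := hz
    have h12 := zero_prop hF (R := 12 * (n * ℓ)) hr (hhaQ y hy _ (by linarith)) hyr (by positivity)
    apply empty_concl
    intro k hk
    have : cubeDoublingIndex u (subCenter cQ ℓ (2*A+1) k) (ℓ/(2*(A:ℝ)+1)) ≤ 0 := by
      apply index_nonpos
      intro x hx r hr hrl
      right
      have hxQ := hsubQ k x hx
      rw [hsup2 x hxQ r (hrl.trans hMl)]
      refine le_antisymm (h12 ▸ Mx_mono hF ?_) (Mx_nonneg _ _ _)
      apply ball_subset_ball'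
      have h1 := cube_norm hxQ
      have h2 := cube_norm hy
      have h3 : dist x y ≤ n * ℓ := by
        have := dist_triangle_right x y cQ
        rw [dist_eq_norm x cQ, dist_eq_norm y cQ] at this
        linarith
      have : n * r ≤ n * ℓ := by gcongr; exact hrl.trans hMl
      linarith
    have hk' := lt_of_lt_of_le hk this
    linarith
  have hpos : ∀ x ∈ cube cQ ℓ, ∀ r : ℝ, 0 < r → 0 < Mx F x r := by
    intro x hx r hr
    refine lt_of_le_of_ne (Mx_nonneg _ _ _) fun h => hz ⟨x, hx, r, hr, h.symm⟩
  by_cases h1 : n = 1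
  · subst h1
    apply empty_concl
    intro k hk
    have hconst : ∀ x ∈ ball cQ (60 * (1:ℕ) * ℓ), nF F x = nF F cQ := by
      intro x hx
      have e0 : ∀ z, nF F z = |F 0 z| := by
        intro z; unfold nF; simp [Real.sqrt_sq_eq_abs]
      have hfd : ∀ z ∈ ball cQ (60 * (1:ℕ) * ℓ), fderiv ℝ (F 0) z = 0 := by
        intro z hz
        ext y
        rw [fderiv_eq_sum]
        have := hdiv z hz
        simp only [Finset.univ_unique, Fin.default_eq_zero, Finset.sum_singleton] at this ⊢
        rw [this]; simp
      have := isOpen_ball.is_const_of_fderiv_eq_zero (𝕜 := ℝ) (f := F 0) (convex_ball cQ (60 * (1:ℕ) * ℓ)).isPreconnected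
        (hF 0).diff.differentiableOn hfd hx (mem_ball_self (by positivity))
      rw [e0, e0, this]
    have hMc : ∀ x r, 0 < r → ball x r ⊆ ball cQ (60 * (1:ℕ) * ℓ) → Mx F x r = nF F cQ := by
      intro x r hr hb
      apply le_antisymm
      · apply Mx_le (nF_nonneg _ _)
        intro z hz
        exact (hconst z (hb hz)).le
      · have hx : x ∈ ball x r := mem_ball_self hr
        rw [← hconst x (hb hx)]
        exact le_Mx hF hx
    have : cubeDoublingIndex u (subCenter cQ ℓ (2*A+1) k) (ℓ/(2*(A:ℝ)+1)) ≤ 0 := by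
      apply index_nonpos
      intro x hx r hr hrl
      left
      have hxQ := hsubQ k x hx
      have hrl' := hrl.trans hMl
      rw [hsup2 x hxQ r hrl', hsup1 x hxQ r hrl', hMc x _ (by positivity) (hballs x hxQ _ (h10 r hrl')),
        hMc x _ hr (hballs x hxQ _ (by linarith))]
    have hk' := lt_of_lt_of_le hk this
    linarith
  obtain ⟨C, hC⟩ := index_bdd hn1 hF (cube_compact cQ ℓ) hℓ (fun x hx => hhaQ x hx ℓ (by linarith)) hpos (U := Mx F cQ (60 * n * ℓ))
    (fun x hx => Mx_mono hF (hballs x hx _ (h10 ℓ le_rfl)))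
  have hbdd : BddAbove {t | ∃ x ∈ cube cQ ℓ, ∃ r : ℝ, 0 < r ∧ r ≤ ℓ ∧
    t = Real.log (supGrad u (ball x (10 * n * r)) / supGrad u (ball x r))} := by
    refine ⟨C, ?_⟩
    rintro t ⟨x, hx, r, hr, hrl, rfl⟩
    rw [hsup1 x hx r hrl, hsup2 x hx r hrl]
    exact hC x hx r hr hrl
  have hfinal := hc (2 * A + 1) (by omega) N hN.le F hF cQ ℓ hℓ (fun x hx => hhaQ x hx ℓ (by linarith)) hpos (by
    intro x hx r hr hrl
    have h2 := (le_csSup hbdd ⟨x, hx, r, hr, hrl, rfl⟩).trans hidx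
    rw [hsup1 x hx r hrl, hsup2 x hx r hrl] at h2
    have p1 := hpos x hx r hr
    have p2 := hpos x hx (10 * n * r) (by positivity)
    rw [Real.log_le_iff_le_exp (by positivity), div_le_iff₀ p1] at h2
    exact h2) h1 {k : Fin n → Fin (2*A+1) | N < cubeDoublingIndex u (subCenter cQ ℓ (2*A+1) k) (ℓ/(2*(A:ℝ)+1))} (by
    intro k hk
    rw [hcast]
    by_contra hcon
    push Not at hcon
    have : cubeDoublingIndex u (subCenter cQ ℓ (2*A+1) k) (ℓ/(2*(A:ℝ)+1)) ≤ N := by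
      apply Real.sSup_le _ (by linarith)
      rintro t ⟨x, hx, r, hr, hrl, rfl⟩
      have hxQ := hsubQ k x hx
      have hrl' := hrl.trans hMl
      have p1 := hpos x hxQ r hr
      have p2 := hpos x hxQ (10 * n * r) (by positivity)
      rw [hsup1 x hxQ r hrl', hsup2 x hxQ r hrl', Real.log_le_iff_le_exp (by positivity), div_le_iff₀ p1]
      exact (hcon x hx r hr hrl).le
    exact absurd hk (not_lt.2 this))
  rw [hcast] at hfinal
  exact hfinal

end CW

/-- **Bounding the count of bad subcubes.** There is `c > 0` such that for all `A ≥ A₀(δ,n)`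
(with `2A+1` a power of 3) and `N > N₀(n)`: if `N(Q) ≤ (1+c)N`, then upon partitioning `Q`
into `(2A+1)ⁿ` congruent subcubes, the number of subcubes with doubling index greater than
`N` is less than `(1/2)(2A+1)^{n-2+δ}`. -/
theorem cubes_with_large_index (n : ℕ) :
    ∃ N₀ : ℝ, 0 < N₀ ∧
    ∀ δ : ℝ, 0 < δ →
    ∃ c : ℝ, 0 < c ∧
    ∃ A₀ : ℕ, ∀ A : ℕ, A₀ ≤ A → (∃ i : ℕ, 2 * A + 1 = 3 ^ i) →
    ∀ N : ℝ, N₀ < N →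
    ∀ (cQ : EuclideanSpace ℝ (Fin n)) (ℓ : ℝ), 0 < ℓ →
    ∀ u : EuclideanSpace ℝ (Fin n) → ℝ,
      IsHarmonicOn u (ball cQ (100 * n * ℓ)) →
      cubeDoublingIndex u cQ ℓ ≤ (1 + c) * N →
      (Set.ncard {k : Fin n → Fin (2 * A + 1) |
          N < cubeDoublingIndex u (subCenter cQ ℓ (2 * A + 1) k)
            (ℓ / (2 * (A : ℝ) + 1))} : ℝ) <
        (1 / 2) * (2 * (A : ℝ) + 1) ^ ((n : ℝ) - 2 + δ) := by
  obtain ⟨N₀, hN₀, h⟩ := CW.main n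
  refine ⟨N₀, hN₀, fun δ hδ => ⟨CW.cc n, by unfold CW.cc; positivity, ?_⟩⟩
  obtain ⟨A₀, h⟩ := h δ hδ
  exact ⟨A₀, fun A hA _ => h A hA⟩
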